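/- Suppose MN > 0 and M ≠ N. Then for every (P̲, f, c) ∈ R_{M,N}, the module S'(P̲, f, c) (the unique U'-simple quotient of the Verma module M(P̲, f, c)) is simple already as a module over U_q(Lsl(M,N)). -/

import Mathlib

noncomputable section

namespace QAS

open Polynomial
open scoped TensorProduct

/-! ### Basic combinatorial data -/

/-- `l_i = 1` for `i ≤ M`, `-1` otherwise. -/
def lof (M : ℕ) (i : ℕ) : ℤ := if i ≤ M then 1 else -1

/-- the bilinear form `(ε_i, ε_j) = l_i δ_{ij}`. -/
def innerE (M : ℕ) (i j : ℕ) : ℤ := if i = j then lof M i else 0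

/-- `(ε_a − ε_b, ε_c − ε_d)`. -/
def form4 (M : ℕ) (a b c d : ℕ) : ℤ :=
  innerE M a c - innerE M a d - innerE M b c + innerE M b d

/-- the Cartan pairing `c_{ij} = (ε_i − ε_{i+1}, ε_j − ε_{j+1})`. -/
def cc (M : ℕ) (i j : ℕ) : ℤ := form4 M i (i + 1) j (j + 1)

/-- `q_i = q^{l_i}`. -/
def qpar (q : ℂ) (M : ℕ) (i : ℕ) : ℂ := q ^ lof M i

/-- the quantum integer `[m]_v`. -/
def qint (v : ℂ) (m : ℤ) : ℂ := (v ^ m - v ^ (-m)) / (v - v⁻¹)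

/-- the sign `(−1)^{|X_i||X_j|}` for the generators `X_i`, `X_j`. -/
def sgn (M : ℕ) (i j : ℕ) : ℂ := if i = M ∧ j = M then -1 else 1

/-- index set `1 ≤ i ≤ M+N−1`. -/
abbrev Idx (M N : ℕ) := {i : ℕ // 1 ≤ i ∧ i ≤ M + N - 1}

/-! ### Generators and the free superalgebra -/

/-- Drinfel'd generators; when `ext = true` we also have `K₀^{±1}`. -/
inductive Gen (M N : ℕ) (ext : Bool) : Type
  | Xp : Idx M N → ℤ → Gen M N ext
  | Xm : Idx M N → ℤ → Gen M N ext
  | K : Idx M N → Gen M N ext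
  | Ki : Idx M N → Gen M N ext
  | H : Idx M N → {s : ℤ // s ≠ 0} → Gen M N ext
  | K0 : ext = true → Gen M N ext
  | K0i : ext = true → Gen M N ext

abbrev FA (M N : ℕ) (ext : Bool) := FreeAlgebra ℂ (Gen M N ext)

def gi {M N : ℕ} {ext : Bool} (g : Gen M N ext) : FA M N ext := FreeAlgebra.ι ℂ g

def XpF (M N : ℕ) (ext : Bool) (i : ℕ) (n : ℤ) : FA M N ext :=
  if h : 1 ≤ i ∧ i ≤ M + N - 1 then gi (Gen.Xp ⟨i, h⟩ n) else 0

def XmF (M N : ℕ) (ext : Bool) (i : ℕ) (n : ℤ) : FA M N ext :=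
  if h : 1 ≤ i ∧ i ≤ M + N - 1 then gi (Gen.Xm ⟨i, h⟩ n) else 0

def KF (M N : ℕ) (ext : Bool) (i : ℕ) : FA M N ext :=
  if h : 1 ≤ i ∧ i ≤ M + N - 1 then gi (Gen.K ⟨i, h⟩) else 0

def KiF (M N : ℕ) (ext : Bool) (i : ℕ) : FA M N ext :=
  if h : 1 ≤ i ∧ i ≤ M + N - 1 then gi (Gen.Ki ⟨i, h⟩) else 0

def HF (M N : ℕ) (ext : Bool) (i : ℕ) (s : ℤ) : FA M N ext :=
  if h : (1 ≤ i ∧ i ≤ M + N - 1) ∧ s ≠ 0 then gi (Gen.H ⟨i, h.1⟩ ⟨s, h.2⟩) else 0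

def K0F (M N : ℕ) (ext : Bool) : FA M N ext :=
  if h : ext = true then gi (Gen.K0 h) else 0

def K0iF (M N : ℕ) (ext : Bool) : FA M N ext :=
  if h : ext = true then gi (Gen.K0i h) else 0

/-- coefficients of `exp (t · Σ_{s ≥ 1} a_s z^s)`. -/
def expC {A : Type} [Ring A] [Algebra ℂ A] (t : ℂ) (a : ℕ → A) : ℕ → A
  | 0 => 1
  | n + 1 =>
      ((n : ℂ) + 1)⁻¹ •
        (t • ∑ s ∈ Finset.range (n + 1), ((s : ℂ) + 1) • (a (s + 1) * expC t a (n - s)))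
termination_by n => n
decreasing_by omega

/-- `φ⁺_{i,n}`, the coefficient of `z^n` in
`K_i exp((q_i − q_i⁻¹) Σ_{s>0} h_{i,s} z^s)`. -/
def phiPF (q : ℂ) (M N : ℕ) (ext : Bool) (i : ℕ) (n : ℤ) : FA M N ext :=
  if 0 ≤ n then
    KF M N ext i *
      expC (qpar q M i - (qpar q M i)⁻¹) (fun s => HF M N ext i (s : ℤ)) n.toNat
  else 0

/-- `φ⁻_{i,n}`, the coefficient of `z^n` (`n ≤ 0`) in
`K_i⁻¹ exp(−(q_i − q_i⁻¹) Σ_{s>0} h_{i,−s} z^{−s})`. -/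
def phiMF (q : ℂ) (M N : ℕ) (ext : Bool) (i : ℕ) (n : ℤ) : FA M N ext :=
  if n ≤ 0 then
    KiF M N ext i *
      expC (-(qpar q M i - (qpar q M i)⁻¹)) (fun s => HF M N ext i (-(s : ℤ))) (-n).toNat
  else 0

/-- the `u`-bracket `[x,y]_u = xy − u·yx` (for `x` or `y` of even parity). -/
def brF {A : Type} [Ring A] [Module ℂ A] (u : ℂ) (x y : A) : A := x * y - u • (y * x)

/-- the quartic oscillation expression
`[[[X_{M−1,m}, X_{M,n}]_{q⁻¹}, X_{M+1,k}]_q, X_{M,u}]` (a graded anticommutator in the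
outermost bracket, both entries being odd). -/
def oscOf {A : Type} [Ring A] [Module ℂ A] (q : ℂ) (M : ℕ) (X : ℕ → ℤ → A) (m n k u : ℤ) : A :=
  brF q (brF q⁻¹ (X (M - 1) m) (X M n)) (X (M + 1) k) * X M u +
    X M u * brF q (brF q⁻¹ (X (M - 1) m) (X M n)) (X (M + 1) k)

/-! ### The defining relations.
`lvl = 1`: only (R1)–(R3);  `lvl = 2`: (R1)–(R5);  `lvl = 3`: all of (R1)–(R7).
`ext = true` adds `K₀^{±1}` together with its relations. -/

inductive rel (q : ℂ) (M N : ℕ) (ext : Bool) (lvl : ℕ) : FA M N ext → FA M N ext → Prop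
  | KKi (i : Idx M N) : rel q M N ext lvl (gi (Gen.K i) * gi (Gen.Ki i)) 1
  | KiK (i : Idx M N) : rel q M N ext lvl (gi (Gen.Ki i) * gi (Gen.K i)) 1
  | KK (i j : Idx M N) :
      rel q M N ext lvl (gi (Gen.K i) * gi (Gen.K j)) (gi (Gen.K j) * gi (Gen.K i))
  | KKi2 (i j : Idx M N) :
      rel q M N ext lvl (gi (Gen.K i) * gi (Gen.Ki j)) (gi (Gen.Ki j) * gi (Gen.K i))
  | KiKi (i j : Idx M N) :
      rel q M N ext lvl (gi (Gen.Ki i) * gi (Gen.Ki j)) (gi (Gen.Ki j) * gi (Gen.Ki i))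
  | KH (i j : Idx M N) (s : {s : ℤ // s ≠ 0}) :
      rel q M N ext lvl (gi (Gen.K i) * gi (Gen.H j s)) (gi (Gen.H j s) * gi (Gen.K i))
  | KiH (i j : Idx M N) (s : {s : ℤ // s ≠ 0}) :
      rel q M N ext lvl (gi (Gen.Ki i) * gi (Gen.H j s)) (gi (Gen.H j s) * gi (Gen.Ki i))
  | HH (i j : Idx M N) (s t : {s : ℤ // s ≠ 0}) :
      rel q M N ext lvl (gi (Gen.H i s) * gi (Gen.H j t)) (gi (Gen.H j t) * gi (Gen.H i s))
  | KXp (i j : Idx M N) (n : ℤ) :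
      rel q M N ext lvl (gi (Gen.K i) * gi (Gen.Xp j n))
        ((q ^ cc M i.1 j.1) • (gi (Gen.Xp j n) * gi (Gen.K i)))
  | KXm (i j : Idx M N) (n : ℤ) :
      rel q M N ext lvl (gi (Gen.K i) * gi (Gen.Xm j n))
        ((q ^ (-cc M i.1 j.1)) • (gi (Gen.Xm j n) * gi (Gen.K i)))
  | HXp (i j : Idx M N) (s : {s : ℤ // s ≠ 0}) (n : ℤ) :
      rel q M N ext lvl
        (gi (Gen.H i s) * gi (Gen.Xp j n) - gi (Gen.Xp j n) * gi (Gen.H i s))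
        ((qint (qpar q M i.1) (s.1 * lof M i.1 * cc M i.1 j.1) / (s.1 : ℂ)) •
          gi (Gen.Xp j (n + s.1)))
  | HXm (i j : Idx M N) (s : {s : ℤ // s ≠ 0}) (n : ℤ) :
      rel q M N ext lvl
        (gi (Gen.H i s) * gi (Gen.Xm j n) - gi (Gen.Xm j n) * gi (Gen.H i s))
        (-((qint (qpar q M i.1) (s.1 * lof M i.1 * cc M i.1 j.1) / (s.1 : ℂ)) •
          gi (Gen.Xm j (n + s.1))))
  | XpXm (i j : Idx M N) (m n : ℤ) :
      rel q M N ext lvl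
        (gi (Gen.Xp i m) * gi (Gen.Xm j n) -
          sgn M i.1 j.1 • (gi (Gen.Xm j n) * gi (Gen.Xp i m)))
        (if i = j then
            (qpar q M i.1 - (qpar q M i.1)⁻¹)⁻¹ •
              (phiPF q M N ext i.1 (m + n) - phiMF q M N ext i.1 (m + n))
          else 0)
  | XX0p (i j : Idx M N) (m n : ℤ) (h2 : 2 ≤ lvl) (h : cc M i.1 j.1 = 0) :
      rel q M N ext lvl
        (gi (Gen.Xp i m) * gi (Gen.Xp j n) -
          sgn M i.1 j.1 • (gi (Gen.Xp j n) * gi (Gen.Xp i m))) 0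
  | XX0m (i j : Idx M N) (m n : ℤ) (h2 : 2 ≤ lvl) (h : cc M i.1 j.1 = 0) :
      rel q M N ext lvl
        (gi (Gen.Xm i m) * gi (Gen.Xm j n) -
          sgn M i.1 j.1 • (gi (Gen.Xm j n) * gi (Gen.Xm i m))) 0
  | XXp (i j : Idx M N) (m n : ℤ) (h2 : 2 ≤ lvl) (h : cc M i.1 j.1 ≠ 0) :
      rel q M N ext lvl
        (gi (Gen.Xp i (m + 1)) * gi (Gen.Xp j n) -
          (q ^ cc M i.1 j.1) • (gi (Gen.Xp j n) * gi (Gen.Xp i (m + 1))))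
        ((q ^ cc M i.1 j.1) • (gi (Gen.Xp i m) * gi (Gen.Xp j (n + 1))) -
          gi (Gen.Xp j (n + 1)) * gi (Gen.Xp i m))
  | XXm (i j : Idx M N) (m n : ℤ) (h2 : 2 ≤ lvl) (h : cc M i.1 j.1 ≠ 0) :
      rel q M N ext lvl
        (gi (Gen.Xm i (m + 1)) * gi (Gen.Xm j n) -
          (q ^ (-cc M i.1 j.1)) • (gi (Gen.Xm j n) * gi (Gen.Xm i (m + 1))))
        ((q ^ (-cc M i.1 j.1)) • (gi (Gen.Xm i m) * gi (Gen.Xm j (n + 1))) -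
          gi (Gen.Xm j (n + 1)) * gi (Gen.Xm i m))
  | serreP (i j : Idx M N) (m n k : ℤ) (h3 : 3 ≤ lvl)
      (h : cc M i.1 j.1 = 1 ∨ cc M i.1 j.1 = -1) (hi : i.1 ≠ M) :
      rel q M N ext lvl
        (brF q (gi (Gen.Xp i m)) (brF q⁻¹ (gi (Gen.Xp i n)) (gi (Gen.Xp j k))) +
          brF q (gi (Gen.Xp i n)) (brF q⁻¹ (gi (Gen.Xp i m)) (gi (Gen.Xp j k)))) 0
  | serreM (i j : Idx M N) (m n k : ℤ) (h3 : 3 ≤ lvl)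
      (h : cc M i.1 j.1 = 1 ∨ cc M i.1 j.1 = -1) (hi : i.1 ≠ M) :
      rel q M N ext lvl
        (brF q (gi (Gen.Xm i m)) (brF q⁻¹ (gi (Gen.Xm i n)) (gi (Gen.Xm j k))) +
          brF q (gi (Gen.Xm i n)) (brF q⁻¹ (gi (Gen.Xm i m)) (gi (Gen.Xm j k)))) 0
  | oscP (m n k u : ℤ) (h3 : 3 ≤ lvl) (hM : 1 < M) (hN : 1 < N) :
      rel q M N ext lvl
        (oscOf q M (XpF M N ext) m n k u + oscOf q M (XpF M N ext) m u k n) 0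
  | oscM (m n k u : ℤ) (h3 : 3 ≤ lvl) (hM : 1 < M) (hN : 1 < N) :
      rel q M N ext lvl
        (oscOf q M (XmF M N ext) m n k u + oscOf q M (XmF M N ext) m u k n) 0
  | K0K0i (he : ext = true) : rel q M N ext lvl (gi (Gen.K0 he) * gi (Gen.K0i he)) 1
  | K0iK0 (he : ext = true) : rel q M N ext lvl (gi (Gen.K0i he) * gi (Gen.K0 he)) 1
  | K0K (he : ext = true) (i : Idx M N) :
      rel q M N ext lvl (gi (Gen.K0 he) * gi (Gen.K i)) (gi (Gen.K i) * gi (Gen.K0 he))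
  | K0Ki (he : ext = true) (i : Idx M N) :
      rel q M N ext lvl (gi (Gen.K0 he) * gi (Gen.Ki i)) (gi (Gen.Ki i) * gi (Gen.K0 he))
  | K0H (he : ext = true) (i : Idx M N) (s : {s : ℤ // s ≠ 0}) :
      rel q M N ext lvl (gi (Gen.K0 he) * gi (Gen.H i s)) (gi (Gen.H i s) * gi (Gen.K0 he))
  | K0Xp (he : ext = true) (i : Idx M N) (n : ℤ) :
      rel q M N ext lvl (gi (Gen.K0 he) * gi (Gen.Xp i n))
        ((q ^ (if i.1 = 1 then (1 : ℤ) else 0)) • (gi (Gen.Xp i n) * gi (Gen.K0 he)))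
  | K0Xm (he : ext = true) (i : Idx M N) (n : ℤ) :
      rel q M N ext lvl (gi (Gen.K0 he) * gi (Gen.Xm i n))
        ((q ^ (if i.1 = 1 then (-1 : ℤ) else 0)) • (gi (Gen.Xm i n) * gi (Gen.K0 he)))

/-! ### The quantum affine superalgebras -/

abbrev ALG (q : ℂ) (M N : ℕ) (ext : Bool) (lvl : ℕ) := RingQuot (rel q M N ext lvl)

def mkA (q : ℂ) (M N : ℕ) (ext : Bool) (lvl : ℕ) : FA M N ext →ₐ[ℂ] ALG q M N ext lvl :=
  RingQuot.mkAlgHom ℂ (rel q M N ext lvl)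

def XpA (q : ℂ) (M N : ℕ) (ext : Bool) (lvl : ℕ) (i : ℕ) (n : ℤ) : ALG q M N ext lvl :=
  mkA q M N ext lvl (XpF M N ext i n)

def XmA (q : ℂ) (M N : ℕ) (ext : Bool) (lvl : ℕ) (i : ℕ) (n : ℤ) : ALG q M N ext lvl :=
  mkA q M N ext lvl (XmF M N ext i n)

def KA (q : ℂ) (M N : ℕ) (ext : Bool) (lvl : ℕ) (i : ℕ) : ALG q M N ext lvl :=
  mkA q M N ext lvl (KF M N ext i)

def KiA (q : ℂ) (M N : ℕ) (ext : Bool) (lvl : ℕ) (i : ℕ) : ALG q M N ext lvl :=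
  mkA q M N ext lvl (KiF M N ext i)

def HA (q : ℂ) (M N : ℕ) (ext : Bool) (lvl : ℕ) (i : ℕ) (s : ℤ) : ALG q M N ext lvl :=
  mkA q M N ext lvl (HF M N ext i s)

def K0A (q : ℂ) (M N : ℕ) (ext : Bool) (lvl : ℕ) : ALG q M N ext lvl :=
  mkA q M N ext lvl (K0F M N ext)

def K0iA (q : ℂ) (M N : ℕ) (ext : Bool) (lvl : ℕ) : ALG q M N ext lvl :=
  mkA q M N ext lvl (K0iF M N ext)

def phiPA (q : ℂ) (M N : ℕ) (ext : Bool) (lvl : ℕ) (i : ℕ) (n : ℤ) : ALG q M N ext lvl :=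
  mkA q M N ext lvl (phiPF q M N ext i n)

def phiMA (q : ℂ) (M N : ℕ) (ext : Bool) (lvl : ℕ) (i : ℕ) (n : ℤ) : ALG q M N ext lvl :=
  mkA q M N ext lvl (phiMF q M N ext i n)

/-- `U⁺`: the subalgebra generated by the `X⁺_{i,n}`. -/
def Aplus (q : ℂ) (M N : ℕ) (ext : Bool) (lvl : ℕ) : Subalgebra ℂ (ALG q M N ext lvl) :=
  Algebra.adjoin ℂ {x | ∃ i : ℕ, ∃ n : ℤ, x = XpA q M N ext lvl i n}

/-- `U⁻`: the subalgebra generated by the `X⁻_{i,n}`. -/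
def Aminus (q : ℂ) (M N : ℕ) (ext : Bool) (lvl : ℕ) : Subalgebra ℂ (ALG q M N ext lvl) :=
  Algebra.adjoin ℂ {x | ∃ i : ℕ, ∃ n : ℤ, x = XmA q M N ext lvl i n}

/-- `U⁰`: the subalgebra generated by the `K_i^{±1}` and `h_{i,s}`. -/
def Azero (q : ℂ) (M N : ℕ) (ext : Bool) (lvl : ℕ) : Subalgebra ℂ (ALG q M N ext lvl) :=
  Algebra.adjoin ℂ {x | (∃ i : ℕ, x = KA q M N ext lvl i) ∨ (∃ i : ℕ, x = KiA q M N ext lvl i) ∨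
    ∃ i : ℕ, ∃ s : ℤ, x = HA q M N ext lvl i s}

/-- `U'⁰`: the subalgebra generated by `U⁰` and `K₀^{±1}`. -/
def AzeroE (q : ℂ) (M N : ℕ) (ext : Bool) (lvl : ℕ) : Subalgebra ℂ (ALG q M N ext lvl) :=
  Algebra.adjoin ℂ {x | (∃ i : ℕ, x = KA q M N ext lvl i) ∨ (∃ i : ℕ, x = KiA q M N ext lvl i) ∨
    (∃ i : ℕ, ∃ s : ℤ, x = HA q M N ext lvl i s) ∨ x = K0A q M N ext lvl ∨
      x = K0iA q M N ext lvl}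

/-! ### The multiplication map on the triple tensor product -/

def triMul (q : ℂ) (M N : ℕ) (ext : Bool) (lvl : ℕ)
    (S T R : Subalgebra ℂ (ALG q M N ext lvl)) :
    (↥S ⊗[ℂ] (↥T ⊗[ℂ] ↥R)) →ₗ[ℂ] ALG q M N ext lvl :=
  TensorProduct.lift
    (((LinearMap.mul ℂ (ALG q M N ext lvl)).comp S.val.toLinearMap).compl₂
      (TensorProduct.lift
        (((LinearMap.mul ℂ (ALG q M N ext lvl)).comp T.val.toLinearMap).compl₂
          R.val.toLinearMap)))

/-! ### Root vectors and PBW monomials -/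

def Xroot (q : ℂ) (M N : ℕ) (ext : Bool) (lvl : ℕ) (i : ℕ) : ℕ → ℤ → ALG q M N ext lvl
  | 0, n => XpA q M N ext lvl i n
  | k + 1, n =>
      brF (qpar q M (i + k + 1)) (Xroot q M N ext lvl i k n) (XpA q M N ext lvl (i + k + 1) 0)

/-- the root vector `X_{α_i + ⋯ + α_j}(n)`. -/
def XrootIJ (q : ℂ) (M N : ℕ) (ext : Bool) (lvl : ℕ) (i j : ℕ) (n : ℤ) : ALG q M N ext lvl :=
  Xroot q M N ext lvl i (j - i) n

def rootLE (a b : ℕ × ℕ) : Prop := a.1 < b.1 ∨ (a.1 = b.1 ∧ a.2 ≤ b.2)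

/-- the set of PBW ordered monomials in the root vectors. -/
def pbwSet (q : ℂ) (M N : ℕ) (ext : Bool) (lvl : ℕ) : Set (ALG q M N ext lvl) :=
  {x | ∃ L : List ((ℕ × ℕ) × ℤ),
      (∀ p ∈ L, 1 ≤ p.1.1 ∧ p.1.1 ≤ p.1.2 ∧ p.1.2 ≤ M + N - 1) ∧
      L.Chain' (fun a b => rootLE a.1 b.1) ∧
      x = (L.map fun p => XrootIJ q M N ext lvl p.1.1 p.1.2 p.2).prod}

/-- PBW ordered monomials of total degree `d` (`d i` counts the multiplicity of `α_i`). -/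
def pbwDegSet (q : ℂ) (M N : ℕ) (ext : Bool) (lvl : ℕ) (d : ℕ → ℕ) : Set (ALG q M N ext lvl) :=
  {x | ∃ L : List ((ℕ × ℕ) × ℤ),
      (∀ p ∈ L, 1 ≤ p.1.1 ∧ p.1.1 ≤ p.1.2 ∧ p.1.2 ≤ M + N - 1) ∧
      L.Chain' (fun a b => rootLE a.1 b.1) ∧
      (∀ i : ℕ, ((L.map fun p => if p.1.1 ≤ i ∧ i ≤ p.1.2 then 1 else 0).sum) = d i) ∧
      x = (L.map fun p => XrootIJ q M N ext lvl p.1.1 p.1.2 p.2).prod}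

/-- words in the generators `X⁺_{i,n}` of degree `d`. -/
def wordDegSet (q : ℂ) (M N : ℕ) (ext : Bool) (lvl : ℕ) (d : ℕ → ℕ) :
    Set (ALG q M N ext lvl) :=
  {x | ∃ w : List (ℕ × ℤ), (∀ p ∈ w, 1 ≤ p.1 ∧ p.1 ≤ M + N - 1) ∧
      (∀ i : ℕ, (w.map Prod.fst).count i = d i) ∧
      x = (w.map fun p => XpA q M N ext lvl p.1 p.2).prod}

/-! ### The subspaces `I^±_{i,j}` and `O^±` -/

def IElt (q : ℂ) (M N : ℕ) (ext : Bool) (lvl : ℕ) (pl : Bool) (i j : ℕ) (m n : ℤ) :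
    ALG q M N ext lvl :=
  let X : ℕ → ℤ → ALG q M N ext lvl := if pl then XpA q M N ext lvl else XmA q M N ext lvl
  let e : ℤ := if pl then cc M i j else -cc M i j
  if cc M i j = 0 then X i m * X j n - sgn M i j • (X j n * X i m)
  else
    X i (m + 1) * X j n - (q ^ e) • (X j n * X i (m + 1)) -
      (q ^ e) • (X i m * X j (n + 1)) + X j (n + 1) * X i m

def Isub (q : ℂ) (M N : ℕ) (ext : Bool) (lvl : ℕ) (pl : Bool) (i j : ℕ) :
    Submodule ℂ (ALG q M N ext lvl) :=
  Submodule.span ℂ (Set.range fun p : ℤ × ℤ => IElt q M N ext lvl pl i j p.1 p.2)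

def IsubAll (q : ℂ) (M N : ℕ) (ext : Bool) (lvl : ℕ) (pl : Bool) :
    Submodule ℂ (ALG q M N ext lvl) :=
  ⨆ p : ℕ × ℕ, ⨆ _ : 1 ≤ p.1 ∧ p.1 ≤ p.2 ∧ p.2 ≤ M + N - 1,
    Isub q M N ext lvl pl p.1 p.2

def OscElt (q : ℂ) (M N : ℕ) (ext : Bool) (lvl : ℕ) (pl : Bool) (m n k u : ℤ) :
    ALG q M N ext lvl :=
  let X : ℕ → ℤ → ALG q M N ext lvl := if pl then XpA q M N ext lvl else XmA q M N ext lvl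
  oscOf q M X m n k u + oscOf q M X m u k n

def Osub (q : ℂ) (M N : ℕ) (ext : Bool) (lvl : ℕ) (pl : Bool) :
    Submodule ℂ (ALG q M N ext lvl) :=
  Submodule.span ℂ
    (Set.range fun p : ℤ × ℤ × ℤ × ℤ => OscElt q M N ext lvl pl p.1 p.2.1 p.2.2.1 p.2.2.2)

/-- the sign `(−1)^{(p(α_k)+p(α_u))·p(α_i)}`. -/
def gsgn (M : ℕ) (k u i : ℕ) : ℂ :=
  if ((k = M ∧ ¬u = M) ∨ (¬k = M ∧ u = M)) ∧ i = M then -1 else 1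

/-! ### Highest weights and the associated eigenvalue sequences -/

/-- `Q·f = 0` for a bilateral formal series `f`. -/
def annih (Q : Polynomial ℂ) (f : ℤ → ℂ) : Prop :=
  ∀ n : ℤ, ∑ s ∈ Finset.range (Q.natDegree + 1), Q.coeff s * f (n - s) = 0

/-- an element of `R_{M,N}`: a highest weight `(P̲, f, c)`. -/
structure HW (q : ℂ) (M N : ℕ) : Type where
  P : ℕ → Polynomial ℂ
  f : ℤ → ℂ
  c : ℂ
  P_const : ∀ i, (P i).coeff 0 = 1
  c_ne : c ≠ 0
  torsion : ∃ Q : Polynomial ℂ, Q ≠ 0 ∧ annih Q f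
  f_zero : f 0 = (c - c⁻¹) / (q - q⁻¹)

def toPS (p : Polynomial ℂ) : PowerSeries ℂ := PowerSeries.mk fun n => p.coeff n

/-- `P(z·u)`. -/
def pscale (u : ℂ) (P : Polynomial ℂ) : Polynomial ℂ := P.comp (Polynomial.C u * Polynomial.X)

/-- the coefficient of `z^n` (`n ≥ 0`) in `q_i^{deg P} P(z q_i⁻¹)/P(z q_i)`,
expanded at `z = 0`. -/
def gammaP (q : ℂ) (M : ℕ) (i : ℕ) (P : Polynomial ℂ) (n : ℤ) : ℂ :=
  if 0 ≤ n then
    qpar q M i ^ P.natDegree *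
      PowerSeries.coeff n.toNat
        (toPS (pscale (qpar q M i)⁻¹ P) * (toPS (pscale (qpar q M i) P))⁻¹)
  else 0

/-- the coefficient of `z^n` (`n ≤ 0`) in `q_i^{deg P} P(z q_i⁻¹)/P(z q_i)`,
expanded at `z = ∞`. -/
def gammaM (q : ℂ) (M : ℕ) (i : ℕ) (P : Polynomial ℂ) (n : ℤ) : ℂ :=
  if n ≤ 0 then
    qpar q M i ^ P.natDegree *
      PowerSeries.coeff (-n).toNat
        (toPS ((pscale (qpar q M i)⁻¹ P).reflect P.natDegree) *
          (toPS ((pscale (qpar q M i) P).reflect P.natDegree))⁻¹)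
  else 0

/-! ### Verma, Weyl and simple modules -/

def vermaRels (q : ℂ) (M N : ℕ) (ext : Bool) (Λ : HW q M N) : Set (ALG q M N ext 3) :=
  {x | ∃ i : ℕ, ∃ n : ℤ, x = XpA q M N ext 3 i n} ∪
  {x | ∃ i : ℕ, ∃ n : ℤ, 1 ≤ i ∧ i ≤ M + N - 1 ∧ i ≠ M ∧
      (x = phiPA q M N ext 3 i n - algebraMap ℂ _ (gammaP q M i (Λ.P i) n) ∨
       x = phiMA q M N ext 3 i n - algebraMap ℂ _ (gammaM q M i (Λ.P i) n))} ∪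
  {x | x = KA q M N ext 3 M - algebraMap ℂ _ Λ.c} ∪
  {x | ∃ n : ℤ, x = phiPA q M N ext 3 M n - phiMA q M N ext 3 M n -
      algebraMap ℂ _ ((q - q⁻¹) * Λ.f n)} ∪
  {x | ext = true ∧ x = K0A q M N ext 3 - 1}

def evenRels (q : ℂ) (M N : ℕ) (ext : Bool) (Λ : HW q M N) : Set (ALG q M N ext 3) :=
  {x | ∃ i : ℕ, 1 ≤ i ∧ i ≤ M + N - 1 ∧ i ≠ M ∧
      x = XmA q M N ext 3 i 0 ^ (1 + (Λ.P i).natDegree)}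

def oddElt (q : ℂ) (M N : ℕ) (ext : Bool) (Q : Polynomial ℂ) (n : ℤ) : ALG q M N ext 3 :=
  ∑ s ∈ Finset.range (Q.natDegree + 1),
    Q.coeff (Q.natDegree - s) • XmA q M N ext 3 M ((s : ℤ) + n)

def oddRels (q : ℂ) (M N : ℕ) (ext : Bool) (Q : Polynomial ℂ) : Set (ALG q M N ext 3) :=
  if M = 1 ∧ N = 1 then {x | ∃ n : ℤ, x = oddElt q M N ext Q n}
  else {oddElt q M N ext Q 0}

def vermaIdeal (q : ℂ) (M N : ℕ) (ext : Bool) (Λ : HW q M N) : Ideal (ALG q M N ext 3) :=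
  Ideal.span (vermaRels q M N ext Λ)

def weylIdeal (q : ℂ) (M N : ℕ) (ext : Bool) (Λ : HW q M N) (Q : Polynomial ℂ) :
    Ideal (ALG q M N ext 3) :=
  Ideal.span (vermaRels q M N ext Λ ∪ evenRels q M N ext Λ ∪ oddRels q M N ext Q)

def uweylIdeal (q : ℂ) (M N : ℕ) (ext : Bool) (Λ : HW q M N) : Ideal (ALG q M N ext 3) :=
  Ideal.span (vermaRels q M N ext Λ ∪ evenRels q M N ext Λ)

/-- the Verma module `M(Λ)`. -/
def VermaMod (q : ℂ) (M N : ℕ) (ext : Bool) (Λ : HW q M N) : Type :=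
  ALG q M N ext 3 ⧸ vermaIdeal q M N ext Λ

/-- the Weyl module `W(Λ; Q)`. -/
def WeylMod (q : ℂ) (M N : ℕ) (ext : Bool) (Λ : HW q M N) (Q : Polynomial ℂ) : Type :=
  ALG q M N ext 3 ⧸ weylIdeal q M N ext Λ Q

/-- the universal Weyl module `W(Λ)`. -/
def UWeylMod (q : ℂ) (M N : ℕ) (ext : Bool) (Λ : HW q M N) : Type :=
  ALG q M N ext 3 ⧸ uweylIdeal q M N ext Λ

instance (q : ℂ) (M N : ℕ) (ext : Bool) (Λ : HW q M N) : AddCommGroup (VermaMod q M N ext Λ) :=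
  inferInstanceAs (AddCommGroup (ALG q M N ext 3 ⧸ vermaIdeal q M N ext Λ))
instance (q : ℂ) (M N : ℕ) (ext : Bool) (Λ : HW q M N) :
    Module (ALG q M N ext 3) (VermaMod q M N ext Λ) :=
  inferInstanceAs (Module (ALG q M N ext 3) (ALG q M N ext 3 ⧸ vermaIdeal q M N ext Λ))
instance (q : ℂ) (M N : ℕ) (ext : Bool) (Λ : HW q M N) : Module ℂ (VermaMod q M N ext Λ) :=
  inferInstanceAs (Module ℂ (ALG q M N ext 3 ⧸ vermaIdeal q M N ext Λ))
instance (q : ℂ) (M N : ℕ) (ext : Bool) (Λ : HW q M N) :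
    IsScalarTower ℂ (ALG q M N ext 3) (VermaMod q M N ext Λ) :=
  inferInstanceAs (IsScalarTower ℂ (ALG q M N ext 3) (ALG q M N ext 3 ⧸ vermaIdeal q M N ext Λ))

instance (q : ℂ) (M N : ℕ) (ext : Bool) (Λ : HW q M N) (Q : Polynomial ℂ) :
    AddCommGroup (WeylMod q M N ext Λ Q) :=
  inferInstanceAs (AddCommGroup (ALG q M N ext 3 ⧸ weylIdeal q M N ext Λ Q))
instance (q : ℂ) (M N : ℕ) (ext : Bool) (Λ : HW q M N) (Q : Polynomial ℂ) :
    Module (ALG q M N ext 3) (WeylMod q M N ext Λ Q) :=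
  inferInstanceAs (Module (ALG q M N ext 3) (ALG q M N ext 3 ⧸ weylIdeal q M N ext Λ Q))
instance (q : ℂ) (M N : ℕ) (ext : Bool) (Λ : HW q M N) (Q : Polynomial ℂ) :
    Module ℂ (WeylMod q M N ext Λ Q) :=
  inferInstanceAs (Module ℂ (ALG q M N ext 3 ⧸ weylIdeal q M N ext Λ Q))
instance (q : ℂ) (M N : ℕ) (ext : Bool) (Λ : HW q M N) (Q : Polynomial ℂ) :
    IsScalarTower ℂ (ALG q M N ext 3) (WeylMod q M N ext Λ Q) :=
  inferInstanceAs
    (IsScalarTower ℂ (ALG q M N ext 3) (ALG q M N ext 3 ⧸ weylIdeal q M N ext Λ Q))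

instance (q : ℂ) (M N : ℕ) (ext : Bool) (Λ : HW q M N) : AddCommGroup (UWeylMod q M N ext Λ) :=
  inferInstanceAs (AddCommGroup (ALG q M N ext 3 ⧸ uweylIdeal q M N ext Λ))
instance (q : ℂ) (M N : ℕ) (ext : Bool) (Λ : HW q M N) :
    Module (ALG q M N ext 3) (UWeylMod q M N ext Λ) :=
  inferInstanceAs (Module (ALG q M N ext 3) (ALG q M N ext 3 ⧸ uweylIdeal q M N ext Λ))
instance (q : ℂ) (M N : ℕ) (ext : Bool) (Λ : HW q M N) : Module ℂ (UWeylMod q M N ext Λ) :=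
  inferInstanceAs (Module ℂ (ALG q M N ext 3 ⧸ uweylIdeal q M N ext Λ))
instance (q : ℂ) (M N : ℕ) (ext : Bool) (Λ : HW q M N) :
    IsScalarTower ℂ (ALG q M N ext 3) (UWeylMod q M N ext Λ) :=
  inferInstanceAs (IsScalarTower ℂ (ALG q M N ext 3) (ALG q M N ext 3 ⧸ uweylIdeal q M N ext Λ))

/-- the highest weight vector (image of `1`). -/
def vgen (q : ℂ) (M N : ℕ) (Λ : HW q M N) : VermaMod q M N true Λ :=
  Submodule.Quotient.mk 1

/-- the sum of all submodules not containing the highest weight vector (the unique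
maximal submodule of the Verma module). -/
def radV (q : ℂ) (M N : ℕ) (Λ : HW q M N) :
    Submodule (ALG q M N true 3) (VermaMod q M N true Λ) :=
  sSup {p | vgen q M N Λ ∉ p}

/-- the simple quotient `S'(Λ)`. -/
def SimpMod (q : ℂ) (M N : ℕ) (Λ : HW q M N) : Type :=
  VermaMod q M N true Λ ⧸ radV q M N Λ

instance (q : ℂ) (M N : ℕ) (Λ : HW q M N) : AddCommGroup (SimpMod q M N Λ) :=
  inferInstanceAs (AddCommGroup (VermaMod q M N true Λ ⧸ radV q M N Λ))
instance (q : ℂ) (M N : ℕ) (Λ : HW q M N) :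
    Module (ALG q M N true 3) (SimpMod q M N Λ) :=
  inferInstanceAs (Module (ALG q M N true 3) (VermaMod q M N true Λ ⧸ radV q M N Λ))
instance (q : ℂ) (M N : ℕ) (Λ : HW q M N) : Module ℂ (SimpMod q M N Λ) :=
  inferInstanceAs (Module ℂ (VermaMod q M N true Λ ⧸ radV q M N Λ))
instance (q : ℂ) (M N : ℕ) (Λ : HW q M N) :
    IsScalarTower ℂ (ALG q M N true 3) (SimpMod q M N Λ) :=
  inferInstanceAs (IsScalarTower ℂ (ALG q M N true 3) (VermaMod q M N true Λ ⧸ radV q M N Λ))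

/-! ### Weight spaces -/

/-- `K_i` for `0 ≤ i`, with `K₀` at `i = 0`. -/
def Kgen (q : ℂ) (M N : ℕ) (ext : Bool) (lvl : ℕ) (i : ℕ) : ALG q M N ext lvl :=
  if i = 0 then K0A q M N ext lvl else KA q M N ext lvl i

/-- the `μ`-weight space of a module. -/
def wtSp (q : ℂ) (M N : ℕ) (ext : Bool) {W : Type} [AddCommGroup W] [Module ℂ W]
    [Module (ALG q M N ext 3) W] [IsScalarTower ℂ (ALG q M N ext 3) W] (μ : ℕ → ℂ) :
    Submodule ℂ W where
  carrier := {w | ∀ i < M + N, Kgen q M N ext 3 i • w = μ i • w}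
  add_mem' := by
    intro a b ha hb i hi
    rw [smul_add, ha i hi, hb i hi, smul_add]
  zero_mem' := by
    intro i hi
    rw [smul_zero, smul_zero]
  smul_mem' := by
    intro c w hw i hi
    have h1 : Kgen q M N ext 3 i • (c • w) = c • (Kgen q M N ext 3 i • w) := by
      rw [← algebraMap_smul (ALG q M N ext 3) c w, ← mul_smul, ← Algebra.commutes, mul_smul,
        algebraMap_smul]
    rw [h1, hw i hi, smul_comm]

/-- the character `λ_Λ`. -/
def lamF (q : ℂ) (M N : ℕ) (Λ : HW q M N) : ℕ → ℂ :=
  fun i => if i = 0 then 1 else if i = M then Λ.c else qpar q M i ^ (Λ.P i).natDegree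

/-- the character `α_j`. -/
def alF (q : ℂ) (M : ℕ) (j : ℕ) : ℕ → ℂ :=
  fun i => if i = 0 then (if j = 1 then q else 1) else q ^ cc M j i

/-! ### The generators of `U` inside `U'` -/

def UGenSet (q : ℂ) (M N : ℕ) : Set (ALG q M N true 3) :=
  {x | (∃ i : ℕ, ∃ n : ℤ, x = XpA q M N true 3 i n) ∨
    (∃ i : ℕ, ∃ n : ℤ, x = XmA q M N true 3 i n) ∨
    (∃ i : ℕ, x = KA q M N true 3 i) ∨ (∃ i : ℕ, x = KiA q M N true 3 i) ∨
    ∃ i : ℕ, ∃ s : ℤ, x = HA q M N true 3 i s}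

/-! ### One-sided presentations (for `U^±`) -/

def XgF (M N : ℕ) (i : ℕ) (n : ℤ) : FreeAlgebra ℂ (Idx M N × ℤ) :=
  if h : 1 ≤ i ∧ i ≤ M + N - 1 then FreeAlgebra.ι ℂ ((⟨i, h⟩, n) : Idx M N × ℤ) else 0

inductive rel1 (q : ℂ) (M N : ℕ) (pl : Bool) :
    FreeAlgebra ℂ (Idx M N × ℤ) → FreeAlgebra ℂ (Idx M N × ℤ) → Prop
  | comm0 (i j : Idx M N) (m n : ℤ) (h : cc M i.1 j.1 = 0) :
      rel1 q M N pl
        (FreeAlgebra.ι ℂ ((i, m) : Idx M N × ℤ) * FreeAlgebra.ι ℂ ((j, n) : Idx M N × ℤ) -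
          sgn M i.1 j.1 •
            (FreeAlgebra.ι ℂ ((j, n) : Idx M N × ℤ) * FreeAlgebra.ι ℂ ((i, m) : Idx M N × ℤ))) 0
  | deg2 (i j : Idx M N) (m n : ℤ) (h : cc M i.1 j.1 ≠ 0) :
      rel1 q M N pl
        (FreeAlgebra.ι ℂ ((i, m + 1) : Idx M N × ℤ) * FreeAlgebra.ι ℂ ((j, n) : Idx M N × ℤ) -
          (q ^ (if pl then cc M i.1 j.1 else -cc M i.1 j.1)) •
            (FreeAlgebra.ι ℂ ((j, n) : Idx M N × ℤ) *
              FreeAlgebra.ι ℂ ((i, m + 1) : Idx M N × ℤ)))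
        ((q ^ (if pl then cc M i.1 j.1 else -cc M i.1 j.1)) •
            (FreeAlgebra.ι ℂ ((i, m) : Idx M N × ℤ) *
              FreeAlgebra.ι ℂ ((j, n + 1) : Idx M N × ℤ)) -
          FreeAlgebra.ι ℂ ((j, n + 1) : Idx M N × ℤ) * FreeAlgebra.ι ℂ ((i, m) : Idx M N × ℤ))
  | serre (i j : Idx M N) (m n k : ℤ) (h : cc M i.1 j.1 = 1 ∨ cc M i.1 j.1 = -1)
      (hi : i.1 ≠ M) :
      rel1 q M N pl
        (brF q (FreeAlgebra.ι ℂ ((i, m) : Idx M N × ℤ))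
            (brF q⁻¹ (FreeAlgebra.ι ℂ ((i, n) : Idx M N × ℤ))
              (FreeAlgebra.ι ℂ ((j, k) : Idx M N × ℤ))) +
          brF q (FreeAlgebra.ι ℂ ((i, n) : Idx M N × ℤ))
            (brF q⁻¹ (FreeAlgebra.ι ℂ ((i, m) : Idx M N × ℤ))
              (FreeAlgebra.ι ℂ ((j, k) : Idx M N × ℤ)))) 0
  | osc (m n k u : ℤ) (hM : 1 < M) (hN : 1 < N) :
      rel1 q M N pl (oscOf q M (XgF M N) m n k u + oscOf q M (XgF M N) m u k n) 0

end QAS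

noncomputable section
namespace QAS

/-! ### Insertion operators on functions of lists of particles -/

section Insertion

variable {P R : Type} [CommRing R]

/-- product of the exchange factors of `p` with the members of a list. -/
def PI (z1 : P → P → R) (p : P) (l : List P) : R := (l.map (z1 p)).prod

/-- one-particle insertion. -/
def U1 (z1 z2 : P → P → R) : (P → R) → (List P → R) → List P → R
  | _, _, [] => 0
  | g, F, p :: l => g p * PI z1 p l * F l +
      U1 z1 z2 (fun r => g r * z2 r p) (fun l' => F (p :: l')) l

/-- two-particle insertion. -/
def U2 (z1 z2 : P → P → R) : (P → P → R) → (List P → R) → List P → R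
  | _, _, [] => 0
  | K, F, p :: l => U1 z1 z2 (K p) (fun l' => PI z1 p l' * F l') l +
      U2 z1 z2 (fun r s => K r s * (z2 r p * z2 s p)) (fun l' => F (p :: l')) l

/-- three-particle insertion. -/
def U3 (z1 z2 : P → P → R) : (P → P → P → R) → (List P → R) → List P → R
  | _, _, [] => 0
  | K, F, p :: l => U2 z1 z2 (K p) (fun l' => PI z1 p l' * F l') l +
      U3 z1 z2 (fun r s t => K r s t * (z2 r p * z2 s p * z2 t p)) (fun l' => F (p :: l')) l

/-- four-particle insertion. -/
def U4 (z1 z2 : P → P → R) : (P → P → P → P → R) → (List P → R) → List P → R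
  | _, _, [] => 0
  | K, F, p :: l => U3 z1 z2 (K p) (fun l' => PI z1 p l' * F l') l +
      U4 z1 z2 (fun r s t u => K r s t u * (z2 r p * z2 s p * z2 t p * z2 u p))
        (fun l' => F (p :: l')) l

variable (z1 z2 : P → P → R)

lemma U1_addF (l : List P) : ∀ (g : P → R) (F G : List P → R),
    U1 z1 z2 g (fun l => F l + G l) l = U1 z1 z2 g F l + U1 z1 z2 g G l := by
  induction l with
  | nil => intros; simp [U1]
  | cons p l ih => intro g F G; simp only [U1]; rw [ih]; ring

lemma U1_mulF (c : R) (l : List P) : ∀ (g : P → R) (F : List P → R),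
    U1 z1 z2 g (fun l => c * F l) l = c * U1 z1 z2 g F l := by
  induction l with
  | nil => intros; simp [U1]
  | cons p l ih => intro g F; simp only [U1]; rw [ih]; ring

lemma U1_addg (l : List P) : ∀ (g h : P → R) (F : List P → R),
    U1 z1 z2 (fun r => g r + h r) F l = U1 z1 z2 g F l + U1 z1 z2 h F l := by
  induction l with
  | nil => intros; simp [U1]
  | cons p l ih =>
    intro g h F; simp only [U1, add_mul]; rw [ih]; ring

lemma U1_mulg (c : R) (l : List P) : ∀ (g : P → R) (F : List P → R),
    U1 z1 z2 (fun r => c * g r) F l = c * U1 z1 z2 g F l := by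
  induction l with
  | nil => intros; simp [U1]
  | cons p l ih => intro g F; simp only [U1, mul_assoc]; rw [ih]; ring

lemma U2_addg (l : List P) : ∀ (g h : P → P → R) (F : List P → R),
    U2 z1 z2 (fun r s => g r s + h r s) F l = U2 z1 z2 g F l + U2 z1 z2 h F l := by
  induction l with
  | nil => intros; simp [U2]
  | cons p l ih =>
    intro g h F; simp only [U2, add_mul]; rw [ih, U1_addg]; ring

lemma U2_mulg (c : R) (l : List P) : ∀ (g : P → P → R) (F : List P → R),
    U2 z1 z2 (fun r s => c * g r s) F l = c * U2 z1 z2 g F l := by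
  induction l with
  | nil => intros; simp [U2]
  | cons p l ih => intro g F; simp only [U2, mul_assoc]; rw [ih, U1_mulg]; ring

lemma U2_mulF (c : R) (l : List P) : ∀ (g : P → P → R) (F : List P → R),
    U2 z1 z2 g (fun l => c * F l) l = c * U2 z1 z2 g F l := by
  induction l with
  | nil => intros; simp [U2]
  | cons p l ih =>
    intro g F; simp only [U2]; rw [ih]
    simp only [mul_left_comm _ c]
    rw [U1_mulF]; ring

lemma U3_addg (l : List P) : ∀ (g h : P → P → P → R) (F : List P → R),
    U3 z1 z2 (fun r s t => g r s t + h r s t) F l = U3 z1 z2 g F l + U3 z1 z2 h F l := by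
  induction l with
  | nil => intros; simp [U3]
  | cons p l ih =>
    intro g h F; simp only [U3, add_mul]; rw [ih, U2_addg]; ring

lemma U3_mulg (c : R) (l : List P) : ∀ (g : P → P → P → R) (F : List P → R),
    U3 z1 z2 (fun r s t => c * g r s t) F l = c * U3 z1 z2 g F l := by
  induction l with
  | nil => intros; simp [U3]
  | cons p l ih => intro g F; simp only [U3, mul_assoc]; rw [ih, U2_mulg]; ring

lemma U3_mulF (c : R) (l : List P) : ∀ (g : P → P → P → R) (F : List P → R),
    U3 z1 z2 g (fun l => c * F l) l = c * U3 z1 z2 g F l := by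
  induction l with
  | nil => intros; simp [U3]
  | cons p l ih =>
    intro g F; simp only [U3]; rw [ih]
    simp only [mul_left_comm _ c]
    rw [U2_mulF]; ring

lemma U4_addg (l : List P) : ∀ (g h : P → P → P → P → R) (F : List P → R),
    U4 z1 z2 (fun r s t u => g r s t u + h r s t u) F l =
      U4 z1 z2 g F l + U4 z1 z2 h F l := by
  induction l with
  | nil => intros; simp [U4]
  | cons p l ih =>
    intro g h F; simp only [U4, add_mul]; rw [ih, U3_addg]; ring

lemma U4_mulg (c : R) (l : List P) : ∀ (g : P → P → P → P → R) (F : List P → R),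
    U4 z1 z2 (fun r s t u => c * g r s t u) F l = c * U4 z1 z2 g F l := by
  induction l with
  | nil => intros; simp [U4]
  | cons p l ih => intro g F; simp only [U4, mul_assoc]; rw [ih, U3_mulg]; ring

/-- absorbing a multiplicative function, one particle. -/
lemma U1_absorb (k : P → R) (l : List P) : ∀ (g : P → R) (F : List P → R),
    U1 z1 z2 (fun r => g r * k r) (fun l' => (l'.map k).prod * F l') l =
      (l.map k).prod * U1 z1 z2 g F l := by
  induction l with
  | nil => intros; simp [U1]
  | cons p l ih =>
    intro g F
    simp only [U1, List.map_cons, List.prod_cons, mul_assoc]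
    rw [U1_mulF]
    have := ih (fun r => g r * z2 r p) (fun l' => F (p :: l'))
    simp only [mul_right_comm, mul_assoc] at this
    simp only [mul_left_comm (k _) (z2 _ _), mul_comm (k _) (z2 _ _)] at this ⊢
    rw [this]; ring

lemma U2_absorb (k : P → R) (l : List P) : ∀ (g : P → P → R) (F : List P → R),
    U2 z1 z2 (fun r s => g r s * (k r * k s)) (fun l' => (l'.map k).prod * F l') l =
      (l.map k).prod * U2 z1 z2 g F l := by
  induction l with
  | nil => intros; simp [U2]
  | cons p l ih =>
    intro g F
    simp only [U2, List.map_cons, List.prod_cons]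
    have h1 := ih (fun r s => g r s * (z2 r p * z2 s p)) (fun l' => F (p :: l'))
    have h2 := U1_absorb z1 z2 k l (g p) (fun l' => PI z1 p l' * F l')
    have e1 : (fun r s => g r s * (k r * k s) * (z2 r p * z2 s p)) =
        fun r s => g r s * (z2 r p * z2 s p) * (k r * k s) := by
      funext r s; ring
    have e2 : (fun l' => k p * (List.map k l').prod * F (p :: l')) =
        fun l' => k p * ((List.map k l').prod * F (p :: l')) := by
      funext l'; ring
    have e3 : (fun s => g p s * (k p * k s)) = fun s => k p * (g p s * k s) := by
      funext s; ring
    have e4 : (fun l' => PI z1 p l' * ((List.map k l').prod * F l')) =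
        fun l' => (List.map k l').prod * (PI z1 p l' * F l') := by
      funext s; ring
    rw [e1, e2, e3, e4, U2_mulF, U1_mulg, h1, h2]; ring

lemma U3_absorb (k : P → R) (l : List P) : ∀ (g : P → P → P → R) (F : List P → R),
    U3 z1 z2 (fun r s t => g r s t * (k r * k s * k t)) (fun l' => (l'.map k).prod * F l') l =
      (l.map k).prod * U3 z1 z2 g F l := by
  induction l with
  | nil => intros; simp [U3]
  | cons p l ih =>
    intro g F
    simp only [U3, List.map_cons, List.prod_cons]
    have h1 := ih (fun r s t => g r s t * (z2 r p * z2 s p * z2 t p)) (fun l' => F (p :: l'))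
    have h2 := U2_absorb z1 z2 k l (g p) (fun l' => PI z1 p l' * F l')
    have e1 : (fun r s t => g r s t * (k r * k s * k t) * (z2 r p * z2 s p * z2 t p)) =
        fun r s t => g r s t * (z2 r p * z2 s p * z2 t p) * (k r * k s * k t) := by
      funext r s t; ring
    have e2 : (fun l' => k p * (List.map k l').prod * F (p :: l')) =
        fun l' => k p * ((List.map k l').prod * F (p :: l')) := by
      funext l'; ring
    have e3 : (fun s t => g p s t * (k p * k s * k t)) =
        fun s t => k p * (g p s t * (k s * k t)) := by
      funext s t; ring
    have e4 : (fun l' => PI z1 p l' * ((List.map k l').prod * F l')) =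
        fun l' => (List.map k l').prod * (PI z1 p l' * F l') := by
      funext s; ring
    rw [e1, e2, e3, e4, U3_mulF, U2_mulg, h1, h2]; ring

lemma U1_U1 (l : List P) : ∀ (g h : P → R) (F : List P → R),
    U1 z1 z2 g (U1 z1 z2 h F) l =
      U2 z1 z2 (fun r s => g r * h s * z1 r s + g s * h r * z2 s r) F l := by
  induction l with
  | nil => intros; simp [U1, U2]
  | cons p l ih =>
    intro g h F
    simp only [U1, U2]
    rw [U1_addF, ih]
    have h2 := U1_absorb z1 z2 (z1 p) l h F
    have e : U1 z1 z2 (fun s => g p * h s * z1 p s + g s * h p * z2 s p)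
        (fun l' => PI z1 p l' * F l') l =
        g p * (PI z1 p l * U1 z1 z2 h F l) +
        U1 z1 z2 (fun r => g r * z2 r p) (fun l' => h p * PI z1 p l' * F l') l := by
      rw [U1_addg]
      simp only [mul_assoc]
      rw [U1_mulF, U1_mulg]
      unfold PI
      rw [h2]
      congr 1
      rw [← U1_mulg]
      congr 1
      funext r; ring
    rw [e]
    have e5 : (fun r s => g r * z2 r p * (h s * z2 s p) * z1 r s +
        g s * z2 s p * (h r * z2 r p) * z2 s r) =
        fun r s => (g r * h s * z1 r s + g s * h r * z2 s r) * (z2 r p * z2 s p) := by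
      funext r s; ring
    rw [e5]; ring

lemma U1_U2 (l : List P) : ∀ (g : P → R) (K : P → P → R) (F : List P → R),
    U1 z1 z2 g (U2 z1 z2 K F) l =
      U3 z1 z2 (fun r s t => g r * K s t * (z1 r s * z1 r t) + g s * K r t * (z2 s r * z1 s t) +
        g t * K r s * (z2 t r * z2 t s)) F l := by
  induction l with
  | nil => intros; simp [U1, U3]
  | cons p l ih =>
    intro g K F
    simp only [U1, U2, U3]
    rw [U1_addF, ih, U1_U1]
    have h2 := U2_absorb z1 z2 (z1 p) l K F
    have e9 : ∀ G : List P → R, U2 z1 z2 (fun s t => g p * K s t * (z1 p s * z1 p t) +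
        g s * K p t * (z2 s p * z1 s t) + g t * K p s * (z2 t p * z2 t s)) G l =
        g p * U2 z1 z2 (fun r s => K r s * (z1 p r * z1 p s)) G l +
        (U2 z1 z2 (fun r s => g r * K p s * (z2 r p * z1 r s)) G l +
          U2 z1 z2 (fun r s => g s * K p r * (z2 s p * z2 s r)) G l) := by
      intro G
      rw [U2_addg, U2_addg]
      have e0 : (fun r s => g p * K r s * (z1 p r * z1 p s)) =
        fun r s => g p * (K r s * (z1 p r * z1 p s)) := by funext r s; ring
      rw [e0, U2_mulg]; ring
    rw [e9]
    unfold PI at *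
    rw [h2]
    have e1 : (fun r s => g r * z2 r p * K p s * z1 r s + g s * z2 s p * K p r * z2 s r) =
      fun r s => g r * K p s * (z2 r p * z1 r s) + g s * K p r * (z2 s p * z2 s r) := by
      funext r s; ring
    rw [e1, U2_addg]
    have e2 : (fun r s t =>
        g r * z2 r p * (K s t * (z2 s p * z2 t p)) * (z1 r s * z1 r t) +
            g s * z2 s p * (K r t * (z2 r p * z2 t p)) * (z2 s r * z1 s t) +
          g t * z2 t p * (K r s * (z2 r p * z2 s p)) * (z2 t r * z2 t s)) =
      fun r s t => (g r * K s t * (z1 r s * z1 r t) + g s * K r t * (z2 s r * z1 s t) +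
          g t * K r s * (z2 t r * z2 t s)) * (z2 r p * z2 s p * z2 t p) := by
      funext r s t; ring
    rw [e2]; ring

lemma U1_U3 (l : List P) : ∀ (g : P → R) (K : P → P → P → R) (F : List P → R),
    U1 z1 z2 g (U3 z1 z2 K F) l =
      U4 z1 z2 (fun r s t u => g r * K s t u * (z1 r s * z1 r t * z1 r u) +
        g s * K r t u * (z2 s r * z1 s t * z1 s u) +
        g t * K r s u * (z2 t r * z2 t s * z1 t u) +
        g u * K r s t * (z2 u r * z2 u s * z2 u t)) F l := by
  induction l with
  | nil => intros; simp [U1, U4]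
  | cons p l ih =>
    intro g K F
    simp only [U1, U3, U4]
    rw [U1_addF, ih, U1_U2]
    have h2 := U3_absorb z1 z2 (z1 p) l K F
    have e9 : ∀ G : List P → R, U3 z1 z2 (fun s t u => g p * K s t u * (z1 p s * z1 p t * z1 p u) +
        g s * K p t u * (z2 s p * z1 s t * z1 s u) +
        g t * K p s u * (z2 t p * z2 t s * z1 t u) +
        g u * K p s t * (z2 u p * z2 u s * z2 u t)) G l =
        g p * U3 z1 z2 (fun r s t => K r s t * (z1 p r * z1 p s * z1 p t)) G l +
        (U3 z1 z2 (fun r s t => g r * K p s t * (z2 r p * z1 r s * z1 r t)) G l +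
          U3 z1 z2 (fun r s t => g s * K p r t * (z2 s p * z2 s r * z1 s t)) G l +
          U3 z1 z2 (fun r s t => g t * K p r s * (z2 t p * z2 t r * z2 t s)) G l) := by
      intro G
      rw [U3_addg, U3_addg, U3_addg]
      have e0 : (fun r s t => g p * K r s t * (z1 p r * z1 p s * z1 p t)) =
        fun r s t => g p * (K r s t * (z1 p r * z1 p s * z1 p t)) := by funext r s t; ring
      rw [e0, U3_mulg]; ring
    rw [e9]
    unfold PI at *
    rw [h2]
    have e1 : (fun r s t => g r * z2 r p * K p s t * (z1 r s * z1 r t) +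
        g s * z2 s p * K p r t * (z2 s r * z1 s t) +
        g t * z2 t p * K p r s * (z2 t r * z2 t s)) =
      fun r s t => g r * K p s t * (z2 r p * z1 r s * z1 r t) +
        g s * K p r t * (z2 s p * z2 s r * z1 s t) +
        g t * K p r s * (z2 t p * z2 t r * z2 t s) := by
      funext r s t; ring
    rw [e1, U3_addg, U3_addg]
    have e2 : (fun r s t u =>
        g r * z2 r p * (K s t u * (z2 s p * z2 t p * z2 u p)) * (z1 r s * z1 r t * z1 r u) +
        g s * z2 s p * (K r t u * (z2 r p * z2 t p * z2 u p)) * (z2 s r * z1 s t * z1 s u) +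
        g t * z2 t p * (K r s u * (z2 r p * z2 s p * z2 u p)) * (z2 t r * z2 t s * z1 t u) +
        g u * z2 u p * (K r s t * (z2 r p * z2 s p * z2 t p)) * (z2 u r * z2 u s * z2 u t)) =
      fun r s t u => (g r * K s t u * (z1 r s * z1 r t * z1 r u) +
        g s * K r t u * (z2 s r * z1 s t * z1 s u) +
        g t * K r s u * (z2 t r * z2 t s * z1 t u) +
        g u * K r s t * (z2 u r * z2 u s * z2 u t)) * (z2 r p * z2 s p * z2 t p * z2 u p) := by
      funext r s t u; ring
    rw [e2]; ring

/-- an additive function. -/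
lemma U1_additive (h : P → R) (c : R) (l : List P) : ∀ (g : P → R) (F : List P → R),
    U1 z1 z2 g (fun l' => (c + (l'.map h).sum) * F l') l =
      (c + (l.map h).sum) * U1 z1 z2 g F l - U1 z1 z2 (fun r => h r * g r) F l := by
  induction l generalizing c with
  | nil => intros; simp [U1]
  | cons p l ih =>
    intro g F
    simp only [U1, List.map_cons, List.sum_cons]
    have := ih (c + h p) (fun r => g r * z2 r p) (fun l' => F (p :: l'))
    simp only [← add_assoc, ← mul_assoc] at this ⊢
    rw [this]; ring

/-- naturality. -/
lemma U1_map {P' R' : Type} [CommRing R'] (f : R →+* R') (m : P → P')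
    (z1' z2' : P' → P' → R') (h1 : ∀ r s, z1' (m r) (m s) = f (z1 r s))
    (h2 : ∀ r s, z2' (m r) (m s) = f (z2 r s)) (l : List P) :
    ∀ (g : P → R) (g' : P' → R') (F : List P → R) (F' : List P' → R'),
      (∀ r, g' (m r) = f (g r)) → (∀ l, F' (l.map m) = f (F l)) →
      U1 z1' z2' g' F' (l.map m) = f (U1 z1 z2 g F l) := by
  induction l with
  | nil => intros; simp [U1]
  | cons p l ih =>
    intro g g' F F' hg hF
    simp only [U1, List.map_cons, map_add, map_mul]
    rw [hg, hF]
    congr 1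
    · congr 2
      simp [PI, h1, map_list_prod, Function.comp_def]
    · apply ih
      · intro r; simp [hg, h2]
      · intro l; simpa using hF (p :: l)

end Insertion

end QAS
end

noncomputable section
namespace QAS

/-! ### The pairing of Laurent polynomials with bilateral sequences -/

section Pairing

open LaurentPolynomial

variable {A : Type} [CommRing A]

/-- pairing of a Laurent polynomial with a bilateral sequence. -/
def pr (e : ℤ → A) (p : LaurentPolynomial A) : A := p.coeff.sum fun k a => a * e k

lemma pr_add (e : ℤ → A) (p p' : LaurentPolynomial A) : pr e (p + p') = pr e p + pr e p' := by
  unfold pr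
  rw [AddMonoidAlgebra.coeff_add]
  exact Finsupp.sum_add_index' (by simp) (by intros; ring)

lemma pr_CT (e : ℤ → A) (a : A) (n : ℤ) : pr e (C a * T n) = a * e n := by
  unfold pr
  rw [← single_eq_C_mul_T, AddMonoidAlgebra.coeff_single]
  exact Finsupp.sum_single_index (by simp)

lemma pr_C_mul (e : ℤ → A) (a : A) (p : LaurentPolynomial A) : pr e (C a * p) = a * pr e p := by
  induction p using LaurentPolynomial.induction_on' with
  | add p r hp hr => rw [mul_add, pr_add, pr_add, hp, hr]; ring
  | C_mul_T n b => rw [← mul_assoc, ← map_mul, pr_CT, pr_CT]; ring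

lemma pr_lin (e : ℤ → A) (a b : A) (p : LaurentPolynomial A) :
    pr e ((C a * T 1 + C b) * p) = pr (fun n => a * e (n + 1) + b * e n) p := by
  induction p using LaurentPolynomial.induction_on' with
  | add p r hp hr => rw [mul_add, pr_add, pr_add, hp, hr]
  | C_mul_T n d =>
    have : (C a * T 1 + C b) * (C d * T n) = C (a * d) * T (n + 1) + C (b * d) * T n := by
      rw [T_add]; simp only [map_mul]; ring
    rw [this, pr_add, pr_CT, pr_CT, pr_CT]; ring

lemma pr_map {B : Type} [CommRing B] (f : A →+* B) (e : ℤ → A) (e' : ℤ → B)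
    (h : ∀ n, e' n = f (e n)) (p : LaurentPolynomial A) :
    pr e' (AddMonoidAlgebra.mapRingHom ℤ f p) = f (pr e p) := by
  induction p using LaurentPolynomial.induction_on' with
  | add p r hp hr => rw [map_add, pr_add, pr_add, hp, hr, map_add]
  | C_mul_T n d =>
    rw [pr_CT, ← single_eq_C_mul_T, AddMonoidAlgebra.mapRingHom_single, single_eq_C_mul_T,
      pr_CT, h, map_mul]

/-- the sequence attached to a power series at `0`. -/
def iop (p : PowerSeries A) : ℤ → A := fun n => if 0 ≤ n then PowerSeries.coeff n.toNat p else 0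
/-- the sequence attached to a power series at infinity. -/
def iom (p : PowerSeries A) : ℤ → A :=
  fun n => if n ≤ 0 then PowerSeries.coeff (-n).toNat p else 0

lemma iop_X (a b : A) (p : PowerSeries A) (n : ℤ) :
    a * iop (PowerSeries.X * p) (n + 1) + b * iop (PowerSeries.X * p) n =
      iop ((PowerSeries.C a + PowerSeries.C b * PowerSeries.X) * p) n := by
  unfold iop
  rw [add_mul, mul_assoc]
  rcases lt_trichotomy n (-1) with h | h | h
  · rw [if_neg (by omega), if_neg (by omega), if_neg (by omega)]; ring
  · subst h; simp
  · obtain ⟨k, rfl⟩ := Int.eq_ofNat_of_zero_le (show 0 ≤ n by omega)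
    rw [if_pos (by omega), if_pos (by omega), if_pos (by omega)]
    have : ((k : ℤ) + 1).toNat = k + 1 := by omega
    rw [this, PowerSeries.coeff_succ_X_mul, map_add, PowerSeries.coeff_C_mul,
      PowerSeries.coeff_C_mul]
    simp

lemma iom_X (a b : A) (p : PowerSeries A) (n : ℤ) :
    a * iom p (n + 1) + b * iom p n =
      iom ((PowerSeries.C a * PowerSeries.X + PowerSeries.C b) * p) n := by
  unfold iom
  rw [add_mul, mul_assoc]
  rcases lt_trichotomy n 0 with h | h | h
  · obtain ⟨k, hk⟩ := Int.eq_ofNat_of_zero_le (show 0 ≤ -n - 1 by omega)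
    rw [if_pos (by omega), if_pos (by omega), if_pos (by omega)]
    have h1 : (-n).toNat = k + 1 := by omega
    have h2 : (-(n + 1)).toNat = k := by omega
    rw [h1, h2, map_add, PowerSeries.coeff_C_mul, PowerSeries.coeff_C_mul,
      PowerSeries.coeff_succ_X_mul]
  · subst h; simp
  · rw [if_neg (by omega), if_neg (by omega), if_neg (by omega)]; ring

end Pairing

/-! ### Formal exponentials -/

section Exp

open PowerSeries

variable {A : Type} [CommRing A] [Algebra ℂ A]

lemma expC_map {A B : Type} [Ring A] [Algebra ℂ A] [Ring B] [Algebra ℂ B]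
    (f : A →ₐ[ℂ] B) (t : ℂ) (a : ℕ → A) (n : ℕ) :
    f (expC t a n) = expC t (fun s => f (a s)) n := by
  induction n using Nat.strong_induction_on with
  | _ n ih =>
    cases n with
    | zero => rw [expC, expC, map_one]
    | succ n =>
      rw [expC, expC, map_smul, map_smul, map_sum]
      congr 2
      refine Finset.sum_congr rfl fun s _ => ?_
      rw [map_smul, map_mul, ih _ (by omega)]

/-- the logarithmic derivative series. -/
def ldS (t : ℂ) (a : ℕ → A) : PowerSeries A := PowerSeries.mk fun s => (t * ((s : ℂ) + 1)) • a (s + 1)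

lemma expC_of_ode (t : ℂ) (a : ℕ → A) (G : PowerSeries A) (h0 : coeff 0 G = 1)
    (h : derivative A G = ldS t a * G) (n : ℕ) : coeff n G = expC t a n := by
  induction n using Nat.strong_induction_on with
  | _ n ih =>
    cases n with
    | zero => rw [h0, expC]
    | succ n =>
      have h1 := congrArg (coeff n) h
      rw [coeff_derivative, coeff_mul, Finset.Nat.sum_antidiagonal_eq_sum_range_succ_mk] at h1
      have h2 : ((n : ℂ) + 1) • coeff (n + 1) G = coeff (n + 1) G * ((n : A) + 1) := by
        rw [Algebra.smul_def]; simp [mul_comm]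
      have h3 : ((n : ℂ) + 1) ≠ 0 := by exact_mod_cast Nat.succ_ne_zero n
      rw [expC, eq_inv_smul_iff₀ h3, h2, h1, Finset.smul_sum]
      refine Finset.sum_congr rfl fun s hs => ?_
      rw [ih _ (by omega), ldS, coeff_mk, smul_smul, smul_mul_assoc]

lemma expC_ode (t : ℂ) (a : ℕ → A) :
    derivative A (PowerSeries.mk (expC t a)) = ldS t a * PowerSeries.mk (expC t a) := by
  ext n
  rw [coeff_derivative, coeff_mul, Finset.Nat.sum_antidiagonal_eq_sum_range_succ_mk, coeff_mk]
  have h2 : ((n : ℂ) + 1) • expC t a (n + 1) = expC t a (n + 1) * ((n : A) + 1) := by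
    rw [Algebra.smul_def]; simp [mul_comm]
  have h3 : ((n : ℂ) + 1) ≠ 0 := by exact_mod_cast Nat.succ_ne_zero n
  rw [← h2, expC, smul_inv_smul₀ h3, Finset.smul_sum]
  refine Finset.sum_congr rfl fun s hs => ?_
  rw [ldS, coeff_mk, coeff_mk, smul_smul, smul_mul_assoc]

/-- the geometric series `1/(1-uX)`. -/
def geo (u : A) : PowerSeries A := PowerSeries.mk fun n => u ^ n

lemma geo_mul (u : A) : geo u * (1 - PowerSeries.C u * X) = 1 := by
  ext n
  rw [mul_sub, mul_one, mul_comm (PowerSeries.C u), ← mul_assoc, map_sub, coeff_mul_C]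
  cases n with
  | zero => simp [geo]
  | succ n => simp [geo, coeff_succ_mul_X, pow_succ, coeff_one]

lemma geo_map {B : Type} [CommRing B] (f : A →+* B) (u : A) :
    PowerSeries.map f (geo u) = geo (f u) := by
  ext n; simp [geo]

lemma geo_deriv (u : A) : derivative A (geo u) = (PowerSeries.C u * geo u) * geo u := by
  have h1 := geo_mul u
  have h2 := congrArg (derivative A) h1
  rw [Derivation.leibniz] at h2
  simp only [smul_eq_mul, map_sub, Derivation.map_one_eq_zero, Derivation.leibniz,
    derivative_X, derivative_C] at h2
  have : derivative A (geo u) = derivative A (geo u) * (geo u * (1 - PowerSeries.C u * X)) := by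
    rw [h1, mul_one]
  rw [this]
  linear_combination (geo u) * h2

/-- The ODE for one rational factor. -/
lemma factor_ode (u w : A) (hu : u * w = w * u) :
    derivative A ((1 - PowerSeries.C w * X) * geo u) =
      (PowerSeries.C u * geo u - PowerSeries.C w * geo w) * ((1 - PowerSeries.C w * X) * geo u) := by
  have h1 := geo_mul w
  rw [Derivation.leibniz, geo_deriv]
  simp only [smul_eq_mul, map_sub, Derivation.map_one_eq_zero, Derivation.leibniz,
    derivative_X, derivative_C]
  linear_combination (PowerSeries.C w * geo u) * h1

end Exp

end QAS
end

noncomputable section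
namespace QAS

/-! ### Particles and exchange factors -/

/-- bundled commutative `ℂ`-algebras. -/
structure CAlg : Type 1 where
  carrier : Type
  [ring : CommRing carrier]
  [alg : Algebra ℂ carrier]

attribute [instance] CAlg.ring CAlg.alg

/-- the exchange parameter. -/
def aq (q : ℂ) (M i j : ℕ) : ℂ := q ^ (-cc M i j)

/-- particles: a colour and an invertible spectral parameter. -/
abbrev Pt (M N : ℕ) (A : Type) [CommRing A] := Idx M N × Aˣ

section

variable {A : Type} [CommRing A] [Algebra ℂ A]

abbrev al (x : ℂ) : A := algebraMap ℂ A x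

def zz1 (q : ℂ) (M N : ℕ) (r s : Pt M N A) : A :=
  al (aq q M r.1.1 s.1.1) * (r.2 : A) - (s.2 : A)

def zz2 (q : ℂ) (M N : ℕ) (r s : Pt M N A) : A :=
  al (sgn M r.1.1 s.1.1) * ((s.2 : A) - al (aq q M r.1.1 s.1.1) * (r.2 : A))

def gX {M N : ℕ} (i : Idx M N) (n : ℤ) (r : Pt M N A) : A :=
  if r.1 = i then ((r.2 ^ n : Aˣ) : A) else 0

def K2 (q : ℂ) (M N : ℕ) (g h : Pt M N A → A) (r s : Pt M N A) : A :=
  g r * h s * zz1 q M N r s + g s * h r * zz2 q M N s r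

def K3 (q : ℂ) (M N : ℕ) (g : Pt M N A → A) (K : Pt M N A → Pt M N A → A) (r s t : Pt M N A) : A :=
  g r * K s t * (zz1 q M N r s * zz1 q M N r t) + g s * K r t * (zz2 q M N s r * zz1 q M N s t) +
        g t * K r s * (zz2 q M N t r * zz2 q M N t s)

def K4 (q : ℂ) (M N : ℕ) (g : Pt M N A → A) (K : Pt M N A → Pt M N A → Pt M N A → A)
    (r s t u : Pt M N A) : A :=
  g r * K s t u * (zz1 q M N r s * zz1 q M N r t * zz1 q M N r u) +
        g s * K r t u * (zz2 q M N s r * zz1 q M N s t * zz1 q M N s u) +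
        g t * K r s u * (zz2 q M N t r * zz2 q M N t s * zz1 q M N t u) +
        g u * K r s t * (zz2 q M N u r * zz2 q M N u s * zz2 q M N u t)

lemma innerE_symm (M i j : ℕ) : innerE M i j = innerE M j i := by
  unfold innerE
  by_cases h : i = j
  · subst h; rfl
  · rw [if_neg h, if_neg (Ne.symm h)]

lemma cc_symm (M i j : ℕ) : cc M i j = cc M j i := by
  unfold cc form4
  rw [innerE_symm M i j, innerE_symm M i (j + 1), innerE_symm M (i + 1) j,
    innerE_symm M (i + 1) (j + 1)]
  ring

lemma cc_serre (M i j : ℕ) (h : cc M i j = 1 ∨ cc M i j = -1) (hi : i ≠ M) :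
    i ≠ j ∧ cc M i i = -2 * cc M i j := by
  revert h
  unfold cc form4 innerE lof
  split_ifs <;> omega

lemma sgn_symm (M i j : ℕ) : sgn M i j = sgn M j i := by
  unfold sgn; simp only [and_comm]

lemma sgn_sq (M i j : ℕ) : sgn M i j * sgn M i j = 1 := by
  unfold sgn; split_ifs <;> norm_num

lemma sgn_of_cc (M i j : ℕ) (h : cc M i j ≠ 0) : sgn M i j = 1 := by
  unfold sgn
  rw [if_neg]
  rintro ⟨rfl, rfl⟩
  apply h
  unfold cc form4 innerE lof
  split_ifs <;> omega

variable (q : ℂ) (M N : ℕ)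

lemma aq_symm (i j : ℕ) : aq q M i j = aq q M j i := by
  unfold aq; rw [cc_symm]

lemma ker_XX0 (i j : Idx M N) (m n : ℤ) (h : cc M i.1 j.1 = 0) (r s : Pt M N A) :
    K2 q M N (gX i m) (gX j n) r s - al (sgn M i.1 j.1) * K2 q M N (gX j n) (gX i m) r s = 0 := by
  obtain ⟨r1, r⟩ := r
  obtain ⟨s1, s⟩ := s
  have hσ := congrArg (algebraMap ℂ A) (sgn_sq M i.1 j.1)
  rw [map_mul, map_one] at hσ
  have h1 := sgn_symm M j.1 i.1
  have h3 := aq_symm q M j.1 i.1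
  have h4 : aq q M i.1 j.1 = 1 := by simp [aq, h]
  simp only [K2, gX, zz1, zz2]
  by_cases hr : r1 = i
  · by_cases hs : s1 = j
    · subst hr hs
      by_cases hrs : r1 = s1
      · subst hrs; simp [h4]; linear_combination (-((r ^ m : Aˣ) : A) * ((s ^ n : Aˣ) : A) * (r - s)) * hσ
      · simp [hrs, Ne.symm hrs, h1, h3, h4]
        linear_combination (-((r ^ m : Aˣ) : A) * ((s ^ n : Aˣ) : A) * (r - s)) * hσ
    · by_cases hs' : s1 = i
      · subst hr hs'; simp [hs]
      · simp [hs, hs']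
  · by_cases hr' : r1 = j
    · subst hr'
      by_cases hs : s1 = i
      · subst hs; simp [hr, Ne.symm hr, h1, h3, h4]; ring
      · simp [hr, hs]
    · simp [hr, hr']

lemma ker_XX (i j : Idx M N) (m n : ℤ) (h : cc M i.1 j.1 ≠ 0) (r s : Pt M N A) :
    K2 q M N (gX i (m + 1)) (gX j n) r s -
      al (aq q M i.1 j.1) * K2 q M N (gX j n) (gX i (m + 1)) r s -
    (al (aq q M i.1 j.1) * K2 q M N (gX i m) (gX j (n + 1)) r s -
      K2 q M N (gX j (n + 1)) (gX i m) r s) = 0 := by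
  obtain ⟨r1, r⟩ := r
  obtain ⟨s1, s⟩ := s
  have h1 := sgn_of_cc M _ _ h
  have h2 := h1
  rw [sgn_symm] at h2
  have h3 := aq_symm q M j.1 i.1
  simp only [K2, gX, zz1, zz2]
  simp only [zpow_add_one, Units.val_mul]
  by_cases hr : r1 = i
  · by_cases hs : s1 = j
    · subst hr hs
      by_cases hrs : r1 = s1
      · subst hrs; simp [h1]; ring
      · simp [hrs, Ne.symm hrs, h1, h2, h3]; ring
    · by_cases hs' : s1 = i
      · subst hr hs'; simp [hs]
      · simp [hs, hs']
  · by_cases hr' : r1 = j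
    · subst hr'
      by_cases hs : s1 = i
      · subst hs; simp [hr, Ne.symm hr, h1, h2, h3]; ring
      · simp [hr, hs]
    · simp [hr, hr']

end
end QAS
end

noncomputable section
namespace QAS

section

variable {A : Type} [CommRing A] [Algebra ℂ A]

variable (q : ℂ) (M N : ℕ)

def serK (i j : Idx M N) (m n k : ℤ) (r s t : Pt M N A) : A :=
  K3 q M N (gX i m) (K2 q M N (gX i n) (gX j k)) r s t
  - al q⁻¹ * K3 q M N (gX i m) (K2 q M N (gX j k) (gX i n)) r s t
  - al q * (K3 q M N (gX i n) (K2 q M N (gX j k) (gX i m)) r s t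
   - al q⁻¹ * K3 q M N (gX j k) (K2 q M N (gX i n) (gX i m)) r s t)

lemma ker_serre (hq : q ≠ 0) (i j : Idx M N) (m n k : ℤ)
    (h : cc M i.1 j.1 = 1 ∨ cc M i.1 j.1 = -1) (hi : i.1 ≠ M) (r s t : Pt M N A) :
    serK q M N i j m n k r s t + serK q M N i j n m k r s t = 0 := by
  obtain ⟨r1, r⟩ := r
  obtain ⟨s1, s⟩ := s
  obtain ⟨t1, t⟩ := t
  obtain ⟨hij, hii⟩ := cc_serre M _ _ h hi
  have hij' : i ≠ j := fun e => hij (congrArg _ e)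
  have huv : (al q : A) * al q⁻¹ = 1 := by
    rw [← map_mul, mul_inv_cancel₀ hq, map_one]
  have h3 := aq_symm q M j.1 i.1
  have hs1 : sgn M i.1 j.1 = 1 := sgn_of_cc M _ _ (by omega)
  have hs2 : sgn M j.1 i.1 = 1 := by rw [sgn_symm, hs1]
  have hs3 : sgn M i.1 i.1 = 1 := sgn_of_cc M _ _ (by omega)
  have hab : ((al (aq q M i.1 j.1) : A) = al q⁻¹ ∧ (al (aq q M i.1 i.1) : A) = al q * al q) ∨
      ((al (aq q M i.1 j.1) : A) = al q ∧ (al (aq q M i.1 i.1) : A) = al q⁻¹ * al q⁻¹) := by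
    rcases h with h | h
    · left; unfold aq
      rw [hii, h, ← map_mul, ← sq]; norm_num
    · right; unfold aq
      rw [hii, h, ← map_mul, ← sq]; norm_num
  simp only [serK, K3, K2, gX, zz1, zz2]
  rcases hab with ⟨hb, ha⟩ | ⟨hb, ha⟩
  all_goals
    by_cases hr : r1 = i
    · by_cases hs : s1 = i
      · by_cases ht : t1 = i
        · simp [hr, hs, ht, hij']
        · by_cases ht' : t1 = j
          · simp only [hr, hs, ht', hij'.symm, hij', h3, hs1, hs2, hs3, ha, hb, if_true, if_false,
              map_one]
            generalize (al q : A) = u at *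
            generalize (al q⁻¹ : A) = v at *
            clear ha hb
            grind
          · simp [ht, ht']
      · by_cases hs' : s1 = j
        · by_cases ht : t1 = i
          · simp only [hr, hs', ht, hij'.symm, hij', h3, hs1, hs2, hs3, ha, hb, if_true, if_false,
              map_one]
            generalize (al q : A) = u at *
            generalize (al q⁻¹ : A) = v at *
            clear ha hb
            grind
          · simp [hr, hs, ht, hij']
        · simp [hs, hs']
    · by_cases hr' : r1 = j
      · by_cases hs : s1 = i
        · by_cases ht : t1 = i
          · simp only [hr', hs, ht, hij'.symm, hij', h3, hs1, hs2, hs3, ha, hb, if_true, if_false,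
              map_one]
            generalize (al q : A) = u at *
            generalize (al q⁻¹ : A) = v at *
            clear ha hb
            grind
          · simp [hr, ht]
        · simp [hr, hs]
      · simp [hr, hr']
end
end QAS
end

noncomputable section
namespace QAS

section

variable {A : Type} [CommRing A] [Algebra ℂ A]

variable (q : ℂ) (M N : ℕ)

/-- kernel of a word of length four. -/
def W4 (g1 g2 g3 g4 : Pt M N A → A) (r s t u : Pt M N A) : A :=
  K4 q M N g1 (K3 q M N g2 (K2 q M N g3 g4)) r s t u

def oscK (X Y Z W : Pt M N A → A) (r s t u : Pt M N A) : A :=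
  W4 q M N X Y Z W r s t u - al q⁻¹ * W4 q M N Y X Z W r s t u
   - al q * (W4 q M N Z X Y W r s t u - al q⁻¹ * W4 q M N Z Y X W r s t u) +
  (W4 q M N W X Y Z r s t u - al q⁻¹ * W4 q M N W Y X Z r s t u
   - al q * (W4 q M N W Z X Y r s t u - al q⁻¹ * W4 q M N W Z Y X r s t u))

/-- the reversed oscillation kernel. -/
def oscR (X Y Z W : Pt M N A → A) (r s t u : Pt M N A) : A :=
  W4 q M N W Z Y X r s t u - al q⁻¹ * W4 q M N W Z X Y r s t u
   - al q * (W4 q M N W Y X Z r s t u - al q⁻¹ * W4 q M N W X Y Z r s t u) +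
  (W4 q M N Z Y X W r s t u - al q⁻¹ * W4 q M N Z X Y W r s t u
   - al q * (W4 q M N Y X Z W r s t u - al q⁻¹ * W4 q M N X Y Z W r s t u))

lemma cc_osc (M : ℕ) (hM : 1 < M) : cc M (M - 1) M = -1 ∧ cc M M (M + 1) = 1 ∧
    cc M (M - 1) (M + 1) = 0 ∧ cc M M M = 0 := by
  obtain ⟨k, rfl⟩ : ∃ k, M = k + 1 := ⟨M - 1, by omega⟩
  unfold cc form4 innerE lof
  have h9 : ¬ k = k + 1 + 1 := by omega
  have h10 : ¬ k = k + 1 + 1 + 1 := by omega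
  simp [h9, h10]

/-- rescaled kernels, without inverse parameters. -/
def oscK' (X Y Z W : Pt M N A → A) (r s t u : Pt M N A) : A :=
  al q * W4 q M N X Y Z W r s t u - W4 q M N Y X Z W r s t u
   - al q * (al q * W4 q M N Z X Y W r s t u - W4 q M N Z Y X W r s t u) +
  (al q * W4 q M N W X Y Z r s t u - W4 q M N W Y X Z r s t u
   - al q * (al q * W4 q M N W Z X Y r s t u - W4 q M N W Z Y X r s t u))

def oscR' (X Y Z W : Pt M N A → A) (r s t u : Pt M N A) : A :=
  al q * W4 q M N W Z Y X r s t u - W4 q M N W Z X Y r s t u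
   - al q * (al q * W4 q M N W Y X Z r s t u - W4 q M N W X Y Z r s t u) +
  (al q * W4 q M N Z Y X W r s t u - W4 q M N Z X Y W r s t u
   - al q * (al q * W4 q M N Y X Z W r s t u - W4 q M N X Y Z W r s t u))

set_option maxHeartbeats 40000000 in
set_option linter.unusedSimpArgs false in
lemma ker_osc' (hq : q ≠ 0) (hM : 1 < M) (x y z : Idx M N) (hx : x.1 = M - 1) (hy : y.1 = M)
    (hz : z.1 = M + 1) (m n k p : ℤ) (r s t u : Pt M N A) :
    oscK' q M N (gX x m) (gX y n) (gX z k) (gX y p) r s t u +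
      oscK' q M N (gX x m) (gX y p) (gX z k) (gX y n) r s t u = 0 ∧
    oscR' q M N (gX x m) (gX y n) (gX z k) (gX y p) r s t u +
      oscR' q M N (gX x m) (gX y p) (gX z k) (gX y n) r s t u = 0 := by
  obtain ⟨r1, r⟩ := r
  obtain ⟨s1, s⟩ := s
  obtain ⟨t1, t⟩ := t
  obtain ⟨u1, u⟩ := u
  obtain ⟨c1, c2, c3, c4⟩ := cc_osc M hM
  have hxy : x ≠ y := fun e => by have := congrArg Subtype.val e; omega
  have hxz : x ≠ z := fun e => by have := congrArg Subtype.val e; omega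
  have hyz : y ≠ z := fun e => by have := congrArg Subtype.val e; omega
  have huv : (al q : A) * al q⁻¹ = 1 := by
    rw [← map_mul, mul_inv_cancel₀ hq, map_one]
  have a1 : aq q M x.1 y.1 = q := by rw [hx, hy, aq, c1]; simp
  have a1' : aq q M y.1 x.1 = q := by rw [aq_symm, a1]
  have a2 : aq q M y.1 z.1 = q⁻¹ := by rw [hz, hy, aq, c2]; simp
  have a2' : aq q M z.1 y.1 = q⁻¹ := by rw [aq_symm, a2]
  have a3 : aq q M x.1 z.1 = 1 := by rw [hz, hx, aq, c3]; simp
  have a3' : aq q M z.1 x.1 = 1 := by rw [aq_symm, a3]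
  have a4 : aq q M y.1 y.1 = 1 := by rw [hy, aq, c4]; simp
  have s1' : sgn M x.1 y.1 = 1 := by rw [sgn, if_neg (by omega)]
  have s1'' : sgn M y.1 x.1 = 1 := by rw [sgn, if_neg (by omega)]
  have s2' : sgn M z.1 y.1 = 1 := by rw [sgn, if_neg (by omega)]
  have s2'' : sgn M y.1 z.1 = 1 := by rw [sgn, if_neg (by omega)]
  have s3' : sgn M x.1 z.1 = 1 := by rw [sgn, if_neg (by omega)]
  have s3'' : sgn M z.1 x.1 = 1 := by rw [sgn, if_neg (by omega)]
  have s4' : sgn M y.1 y.1 = -1 := by rw [sgn, if_pos (by omega)]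
  have m1 : (al (-1) : A) = -1 := by simp [al]
  have e0 : ∀ (w : Idx M N) (W : Aˣ) (i : Idx M N) (n : ℤ), w ≠ i → gX i n (w, W) = 0 := by
    intro w W i n h; simp [gX, h]
  have e1 : ∀ (W : Aˣ) (i : Idx M N) (n : ℤ), gX i n (i, W) = ((W ^ n : Aˣ) : A) := by
    intro W i n; simp [gX]
  have key : ∀ w : Idx M N, w = x ∨ w = y ∨ w = z ∨ (w ≠ x ∧ w ≠ y ∧ w ≠ z) := by
    intro w; tauto
  have f1 : ∀ R S : Aˣ, zz1 q M N (x, R) (y, S) = al q * (R : A) - S := by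
    intro R S; simp only [zz1, a1]
  have f2 : ∀ R S : Aˣ, zz1 q M N (y, R) (x, S) = al q * (R : A) - S := by
    intro R S; simp only [zz1, a1']
  have f3 : ∀ R S : Aˣ, zz1 q M N (y, R) (z, S) = al q⁻¹ * (R - al q * (S : A)) := by
    intro R S; simp only [zz1, a2]; linear_combination (S : A) * huv
  have f4 : ∀ R S : Aˣ, zz1 q M N (z, R) (y, S) = al q⁻¹ * (R - al q * (S : A)) := by
    intro R S; simp only [zz1, a2']; linear_combination (S : A) * huv
  have f5 : ∀ R S : Aˣ, zz1 q M N (x, R) (z, S) = (R : A) - S := by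
    intro R S; simp only [zz1, a3, map_one, one_mul]
  have f6 : ∀ R S : Aˣ, zz1 q M N (z, R) (x, S) = (R : A) - S := by
    intro R S; simp only [zz1, a3', map_one, one_mul]
  have f7 : ∀ R S : Aˣ, zz1 q M N (y, R) (y, S) = (R : A) - S := by
    intro R S; simp only [zz1, a4, map_one, one_mul]
  have g1 : ∀ R S : Aˣ, zz2 q M N (x, R) (y, S) = S - al q * (R : A) := by
    intro R S; simp only [zz2, a1, s1', map_one, one_mul]
  have g2 : ∀ R S : Aˣ, zz2 q M N (y, R) (x, S) = S - al q * (R : A) := by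
    intro R S; simp only [zz2, a1', s1'', map_one, one_mul]
  have g3 : ∀ R S : Aˣ, zz2 q M N (y, R) (z, S) = al q⁻¹ * (al q * S - (R : A)) := by
    intro R S; simp only [zz2, a2, s2'', map_one, one_mul]; linear_combination -(S : A) * huv
  have g4 : ∀ R S : Aˣ, zz2 q M N (z, R) (y, S) = al q⁻¹ * (al q * S - (R : A)) := by
    intro R S; simp only [zz2, a2', s2', map_one, one_mul]; linear_combination -(S : A) * huv
  have g5 : ∀ R S : Aˣ, zz2 q M N (x, R) (z, S) = S - (R : A) := by
    intro R S; simp only [zz2, a3, s3', map_one, one_mul]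
  have g6 : ∀ R S : Aˣ, zz2 q M N (z, R) (x, S) = S - (R : A) := by
    intro R S; simp only [zz2, a3', s3'', map_one, one_mul]
  have g7 : ∀ R S : Aˣ, zz2 q M N (y, R) (y, S) = R - (S : A) := by
    intro R S; simp only [zz2, a4, s4', map_one, one_mul, m1]; ring
  simp only [oscK', oscR', W4, K4, K3, K2]
  all_goals rcases key r1 with hr | hr | hr | hr
  all_goals
    simp only [hr, e0, e1, hxy, hxz, hyz, hxy.symm, hxz.symm, hyz.symm,
      ne_eq, not_false_eq_true, zero_mul, mul_zero, add_zero, zero_add, sub_zero, zero_sub, sub_self, neg_zero, and_self]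
  all_goals rcases key s1 with hs | hs | hs | hs
  all_goals
    simp only [hs, e0, e1, hxy, hxz, hyz, hxy.symm, hxz.symm, hyz.symm,
      ne_eq, not_false_eq_true, zero_mul, mul_zero, add_zero, zero_add, sub_zero, zero_sub, sub_self, neg_zero, and_self]
  all_goals rcases key t1 with ht | ht | ht | ht
  all_goals
    simp only [ht, e0, e1, hxy, hxz, hyz, hxy.symm, hxz.symm, hyz.symm,
      ne_eq, not_false_eq_true, zero_mul, mul_zero, add_zero, zero_add, sub_zero, zero_sub, sub_self, neg_zero, and_self]
  all_goals rcases key u1 with hu | hu | hu | hu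
  all_goals
    simp only [hu, e0, e1, hxy, hxz, hyz, hxy.symm, hxz.symm, hyz.symm,
      ne_eq, not_false_eq_true, zero_mul, mul_zero, add_zero, zero_add, sub_zero, zero_sub, sub_self, neg_zero, and_self]
  all_goals
    simp only [f1, f2, f3, f4, f5, f6, f7, g1, g2, g3, g4, g5, g6, g7]
    clear f1 f2 f3 f4 f5 f6 f7 g1 g2 g3 g4 g5 g6 g7
  all_goals
    clear e0 e1 key a1 a1' a2 a2' a3 a3' a4 s1' s1'' s2' s2'' s3' s3'' s4' m1 c1 c2 c3 c4
    clear hr hs ht hu hxy hxz hyz hx hy hz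
    generalize (al q : A) = a at *
    generalize (al q⁻¹ : A) = b at *
    try generalize ((r ^ m : Aˣ) : A) = rm
    try generalize ((s ^ m : Aˣ) : A) = sm
    try generalize ((t ^ m : Aˣ) : A) = tm
    try generalize ((u ^ m : Aˣ) : A) = um
    try generalize ((r ^ n : Aˣ) : A) = rn
    try generalize ((s ^ n : Aˣ) : A) = sn
    try generalize ((t ^ n : Aˣ) : A) = tn
    try generalize ((u ^ n : Aˣ) : A) = un
    try generalize ((r ^ k : Aˣ) : A) = rk
    try generalize ((s ^ k : Aˣ) : A) = sk
    try generalize ((t ^ k : Aˣ) : A) = tk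
    try generalize ((u ^ k : Aˣ) : A) = uk
    try generalize ((r ^ p : Aˣ) : A) = rp
    try generalize ((s ^ p : Aˣ) : A) = sp
    try generalize ((t ^ p : Aˣ) : A) = tp
    try generalize ((u ^ p : Aˣ) : A) = up
    generalize (r : A) = r
    generalize (s : A) = s
    generalize (t : A) = t
    generalize (u : A) = u
  all_goals constructor
  all_goals ring

lemma ker_osc (hq : q ≠ 0) (hM : 1 < M) (x y z : Idx M N) (hx : x.1 = M - 1) (hy : y.1 = M)
    (hz : z.1 = M + 1) (m n k p : ℤ) (r s t u : Pt M N A) :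
    oscK q M N (gX x m) (gX y n) (gX z k) (gX y p) r s t u +
      oscK q M N (gX x m) (gX y p) (gX z k) (gX y n) r s t u = 0 ∧
    oscR q M N (gX x m) (gX y n) (gX z k) (gX y p) r s t u +
      oscR q M N (gX x m) (gX y p) (gX z k) (gX y n) r s t u = 0 := by
  have huv : (al q : A) * al q⁻¹ = 1 := by
    rw [← map_mul, mul_inv_cancel₀ hq, map_one]
  obtain ⟨h1, h2⟩ := ker_osc' q M N hq hM x y z hx hy hz m n k p r s t u
  have e1 : ∀ X Y Z W : Pt M N A → A, oscK q M N X Y Z W r s t u =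
      al q⁻¹ * oscK' q M N X Y Z W r s t u := by
    intro X Y Z W
    unfold oscK oscK'
    linear_combination (-W4 q M N X Y Z W r s t u + al q * W4 q M N Z X Y W r s t u
      - W4 q M N W X Y Z r s t u + al q * W4 q M N W Z X Y r s t u) * huv
  have e2 : ∀ X Y Z W : Pt M N A → A, oscR q M N X Y Z W r s t u =
      al q⁻¹ * oscR' q M N X Y Z W r s t u := by
    intro X Y Z W
    unfold oscR oscR'
    linear_combination (-W4 q M N W Z Y X r s t u + al q * W4 q M N W Y X Z r s t u
      - W4 q M N Z Y X W r s t u + al q * W4 q M N Y X Z W r s t u) * huv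
  rw [e1, e1, e2, e2, ← mul_add, ← mul_add, h1, h2]
  simp

end
end QAS
end

noncomputable section
namespace QAS

section PairingLemmas

open PowerSeries LaurentPolynomial

variable {A : Type} [CommRing A]

lemma pr_linE (c : A) (e1 e2 : ℤ → A) (p : LaurentPolynomial A) :
    pr (fun n => c * (e1 n - e2 n)) p = c * (pr e1 p - pr e2 p) := by
  induction p using LaurentPolynomial.induction_on' with
  | add p r hp hr => rw [pr_add, pr_add, pr_add, hp, hr]; ring
  | C_mul_T n b => rw [pr_CT, pr_CT, pr_CT]; ring

lemma pr_iop_prod {Y : Type} (a w u : Y → A) (p : LaurentPolynomial A) (l : List Y) :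
    ∀ R : PowerSeries A,
    pr (iop (R * (l.map fun y => X * geo (u y)).prod))
      ((l.map fun y => LaurentPolynomial.C (a y) * T 1 - LaurentPolynomial.C (w y)).prod * p) =
    pr (iop (R * (l.map fun y => (PowerSeries.C (a y) - PowerSeries.C (w y) * X) * geo (u y)).prod)) p := by
  induction l with
  | nil => intro R; simp
  | cons y l ih =>
    intro R
    simp only [List.map_cons, List.prod_cons]
    have e1 : R * (X * geo (u y) * (l.map fun y => X * geo (u y)).prod) =
      X * ((R * geo (u y)) * (l.map fun y => X * geo (u y)).prod) := by ring
    have e2 : (LaurentPolynomial.C (a y) * T 1 - LaurentPolynomial.C (w y)) *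
        (l.map fun y => LaurentPolynomial.C (a y) * T 1 - LaurentPolynomial.C (w y)).prod * p =
      (LaurentPolynomial.C (a y) * T 1 + LaurentPolynomial.C (-w y)) *
        ((l.map fun y => LaurentPolynomial.C (a y) * T 1 - LaurentPolynomial.C (w y)).prod * p) := by
      rw [map_neg]; ring
    rw [e1, e2, pr_lin]
    simp only [iop_X]
    have e3 : (PowerSeries.C (a y) + PowerSeries.C (-w y) * X) *
        (R * geo (u y) * (l.map fun y => X * geo (u y)).prod) =
      (R * ((PowerSeries.C (a y) - PowerSeries.C (w y) * X) * geo (u y))) *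
        (l.map fun y => X * geo (u y)).prod := by
      rw [map_neg]; ring
    rw [e3]
    refine (ih _).trans ?_
    rw [mul_assoc]

lemma pr_iom_prod {Y : Type} (a w : Y → A) (u : Y → PowerSeries A) (p : LaurentPolynomial A)
    (l : List Y) : ∀ R : PowerSeries A,
    pr (iom (R * (l.map u).prod))
      ((l.map fun y => LaurentPolynomial.C (a y) * T 1 - LaurentPolynomial.C (w y)).prod * p) =
    pr (iom (R * (l.map fun y => (PowerSeries.C (a y) * X - PowerSeries.C (w y)) * u y).prod)) p := by
  induction l with
  | nil => intro R; simp
  | cons y l ih =>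
    intro R
    simp only [List.map_cons, List.prod_cons]
    have e2 : (LaurentPolynomial.C (a y) * T 1 - LaurentPolynomial.C (w y)) *
        (l.map fun y => LaurentPolynomial.C (a y) * T 1 - LaurentPolynomial.C (w y)).prod * p =
      (LaurentPolynomial.C (a y) * T 1 + LaurentPolynomial.C (-w y)) *
        ((l.map fun y => LaurentPolynomial.C (a y) * T 1 - LaurentPolynomial.C (w y)).prod * p) := by
      rw [map_neg]; ring
    rw [e2, pr_lin]
    simp only [iom_X]
    have e3 : (PowerSeries.C (a y) * X + PowerSeries.C (-w y)) *
        (R * (u y * (l.map u).prod)) =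
      (R * ((PowerSeries.C (a y) * X - PowerSeries.C (w y)) * u y)) * (l.map u).prod := by
      rw [map_neg]; ring
    rw [e3]
    refine (ih _).trans ?_
    rw [mul_assoc]

/-- moving an operator `E` through an insertion. -/
lemma E_U1 {P P' : Type} (m : P → P') (z1 z2 : P → P → A)
    (z1' z2' : P' → P' → LaurentPolynomial A)
    (h1 : ∀ r s, z1' (m r) (m s) = LaurentPolynomial.C (z1 r s))
    (h2 : ∀ r s, z2' (m r) (m s) = LaurentPolynomial.C (z2 r s)) (a : P → A)
    (E : List P → LaurentPolynomial A → A)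
    (E_add : ∀ l p p', E l (p + p') = E l p + E l p')
    (E_C : ∀ l x p, E l (LaurentPolynomial.C x * p) = x * E l p)
    (E_ins : ∀ l1 y l2 p, E (l1 ++ y :: l2) ((T 1 - LaurentPolynomial.C (a y)) * p) = E (l1 ++ l2) p)
    (l : List P) : ∀ (pre : List P) (g : P → A) (g' : P' → LaurentPolynomial A)
      (_ : ∀ r, g' (m r) = LaurentPolynomial.C (g r) * (T 1 - LaurentPolynomial.C (a r)))
      (G : List P' → LaurentPolynomial A),
      E (pre ++ l) (U1 z1' z2' g' G (l.map m)) =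
        U1 z1 z2 g (fun l' => E (pre ++ l') (G (l'.map m))) l := by
  have E0 : ∀ l, E l 0 = 0 := fun l => by
    have := E_C l 0 0; simpa using this
  induction l with
  | nil => intro pre g g' hg G; simp [U1, E0]
  | cons y l ih =>
    intro pre g g' hg G
    simp only [U1, List.map_cons]
    rw [E_add]
    congr 1
    · have hPI : PI z1' (m y) (l.map m) = LaurentPolynomial.C (PI z1 y l) := by
        unfold PI
        rw [map_list_prod, List.map_map, List.map_map]
        congr 1
        apply List.map_congr_left
        intro s _; exact h1 y s
      rw [hPI, hg]
      have : LaurentPolynomial.C (g y) * (T 1 - LaurentPolynomial.C (a y)) *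
          LaurentPolynomial.C (PI z1 y l) * G (l.map m) =
        LaurentPolynomial.C (g y * PI z1 y l) *
          ((T 1 - LaurentPolynomial.C (a y)) * G (l.map m)) := by
        rw [map_mul]; ring
      rw [this, E_C, E_ins]
    · have := ih (pre ++ [y]) (fun r => g r * z2 r y) (fun r => g' r * z2' r (m y)) (by
        intro r; rw [hg, h2, map_mul]; ring) (fun l' => G (m y :: l'))
      simp only [List.append_assoc, List.singleton_append] at this
      exact this

end PairingLemmas

/-! ### weight data and the structure functions -/

/-- weight data -/
structure WD (M N : ℕ) : Type where
  kap : Idx M N → ℂ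
  eta : Idx M N → ℤ → ℂ
  kap_ne : ∀ i, kap i ≠ 0

section Structure

variable (q : ℂ) {M N : ℕ} (w : WD M N)

def tt (M : ℕ) (i : ℕ) : ℂ := qpar q M i - (qpar q M i)⁻¹

def chiP (i : Idx M N) : PowerSeries ℂ :=
  PowerSeries.C (w.kap i) * PowerSeries.mk (expC (tt q M i.1) (fun s => w.eta i (s : ℤ)))
def chiM (i : Idx M N) : PowerSeries ℂ :=
  PowerSeries.C (w.kap i)⁻¹ * PowerSeries.mk (expC (-tt q M i.1) (fun s => w.eta i (-(s : ℤ))))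

variable {A : Type} [CommRing A] [Algebra ℂ A]

def up (i : Idx M N) (y : Pt M N A) : A := al (aq q M i.1 y.1.1) * (y.2 : A)
def um (i : Idx M N) (y : Pt M N A) : A := al (aq q M i.1 y.1.1)⁻¹ * ((y.2⁻¹ : Aˣ) : A)

def PPp (i : Idx M N) (l : List (Pt M N A)) : PowerSeries A :=
  PowerSeries.map (algebraMap ℂ A) (chiP q w i) * (l.map fun y => PowerSeries.X * geo (up q i y)).prod
def PPm (i : Idx M N) (l : List (Pt M N A)) : PowerSeries A :=
  PowerSeries.map (algebraMap ℂ A) (chiM q w i) *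
    (l.map fun y => PowerSeries.C (-um q i y) * geo (um q i y)).prod

def ee (i : Idx M N) (l : List (Pt M N A)) (n : ℤ) : A :=
  al (tt q M i.1)⁻¹ * (iop (PPp q w i l) n - iom (PPm q w i l) n)

/-- coefficient of `h_{i,s}` on a particle -/
def hc (M : ℕ) (i j : ℕ) (s : ℤ) : ℂ := qint (qpar q M i) (s * lof M i * cc M i j) / (s : ℂ)

def hev (i : Idx M N) (s : ℤ) (l : List (Pt M N A)) : A :=
  al (w.eta i s) + (l.map fun y => - al (hc q M i.1 y.1.1 s) * ((y.2 ^ s : Aˣ) : A)).sum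

def kev (i : Idx M N) (l : List (Pt M N A)) : A :=
  al (w.kap i) * (l.map fun y => (al (aq q M i.1 y.1.1) : A)).prod
def kiev (i : Idx M N) (l : List (Pt M N A)) : A :=
  al (w.kap i)⁻¹ * (l.map fun y => (al (aq q M i.1 y.1.1)⁻¹ : A)).prod

lemma aq_ne (hq : q ≠ 0) (i j : ℕ) : aq q M i j ≠ 0 := zpow_ne_zero _ hq

lemma up_um (hq : q ≠ 0) (i : Idx M N) (y : Pt M N A) : up q i y * um q i y = 1 := by
  unfold up um
  have : (al (aq q M i.1 y.1.1) : A) * al (aq q M i.1 y.1.1)⁻¹ = 1 := by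
    rw [← map_mul, mul_inv_cancel₀ (aq_ne q hq _ _), map_one]
  calc _ = ((al (aq q M i.1 y.1.1) : A) * al (aq q M i.1 y.1.1)⁻¹) *
      ((y.2 : A) * ((y.2⁻¹ : Aˣ) : A)) := by ring
    _ = 1 := by rw [this, Units.mul_inv, mul_one]

lemma ee_ins (hq : q ≠ 0) (i : Idx M N) (l1 l2 : List (Pt M N A)) (y : Pt M N A) (n : ℤ) :
    ee q w i (l1 ++ y :: l2) (n + 1) - up q i y * ee q w i (l1 ++ y :: l2) n =
      ee q w i (l1 ++ l2) n := by
  have e1 : PPp q w i (l1 ++ y :: l2) = PowerSeries.X * (geo (up q i y) * PPp q w i (l1 ++ l2)) := by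
    unfold PPp; simp only [List.map_append, List.map_cons, List.prod_append, List.prod_cons]; ring
  have e2 : PPm q w i (l1 ++ y :: l2) =
      PowerSeries.C (-um q i y) * geo (um q i y) * PPm q w i (l1 ++ l2) := by
    unfold PPm; simp only [List.map_append, List.map_cons, List.prod_append, List.prod_cons]; ring
  have h1 := iop_X 1 (-up q i y) (geo (up q i y) * PPp q w i (l1 ++ l2)) n
  have h2 := iom_X 1 (-up q i y) (PPm q w i (l1 ++ y :: l2)) n
  rw [← e1] at h1
  have f1 : (PowerSeries.C (1 : A) + PowerSeries.C (-up q i y) * PowerSeries.X) *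
      (geo (up q i y) * PPp q w i (l1 ++ l2)) = PPp q w i (l1 ++ l2) := by
    rw [← mul_assoc, map_one, map_neg]
    have := geo_mul (up q i y)
    rw [show (1 + -PowerSeries.C (up q i y) * PowerSeries.X) * geo (up q i y) =
      geo (up q i y) * (1 - PowerSeries.C (up q i y) * PowerSeries.X) by ring, this, one_mul]
  have f2 : (PowerSeries.C (1 : A) * PowerSeries.X + PowerSeries.C (-up q i y)) *
      PPm q w i (l1 ++ y :: l2) = PPm q w i (l1 ++ l2) := by
    rw [e2, map_one, map_neg, map_neg]
    have h3 := geo_mul (um q i y)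
    have h4 : PowerSeries.C (up q i y) * PowerSeries.C (um q i y) = 1 := by
      rw [← map_mul, up_um q hq, map_one]
    linear_combination (geo (um q i y) * PPm q w i (l1 ++ l2)) * h4 + PPm q w i (l1 ++ l2) * h3
  rw [f1] at h1; rw [f2] at h2
  unfold ee
  rw [← h1, ← h2]; ring

lemma ee_map {B : Type} [CommRing B] [Algebra ℂ B] (f : A →ₐ[ℂ] B) (i : Idx M N)
    (l : List (Pt M N A)) (n : ℤ) :
    ee q w i (l.map fun y => (y.1, Units.map (f : A →* B) y.2)) n = f (ee q w i l n) := by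
  have hal : ∀ x, f (al x) = al x := fun x => f.commutes x
  have hup : ∀ y : Pt M N A, up q i ((y.1, Units.map (f : A →* B) y.2) : Pt M N B) = f (up q i y) := by
    intro y; simp [up, hal]
  have hum : ∀ y : Pt M N A, um q i ((y.1, Units.map (f : A →* B) y.2) : Pt M N B) = f (um q i y) := by
    intro y; simp only [um, map_mul, hal, ← map_inv]; rfl
  have hcm : ∀ p : PowerSeries ℂ, PowerSeries.map (f : A →+* B) (PowerSeries.map (algebraMap ℂ A) p) =
      PowerSeries.map (algebraMap ℂ B) p := by
    intro p; ext n; simp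
  have e1 : PPp q w i (l.map fun y => (y.1, Units.map (f : A →* B) y.2)) =
      PowerSeries.map (f : A →+* B) (PPp q w i l) := by
    unfold PPp
    rw [map_mul, hcm, map_list_prod, List.map_map, List.map_map]
    congr 2
    apply List.map_congr_left
    intro y _
    simp only [Function.comp, map_mul, PowerSeries.map_X, geo_map, hup]; rfl
  have e2 : PPm q w i (l.map fun y => (y.1, Units.map (f : A →* B) y.2)) =
      PowerSeries.map (f : A →+* B) (PPm q w i l) := by
    unfold PPm
    rw [map_mul, hcm, map_list_prod, List.map_map, List.map_map]
    congr 2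
    apply List.map_congr_left
    intro y _
    simp only [Function.comp, map_mul, PowerSeries.map_C, geo_map, hum, map_neg]; rfl
  unfold ee
  rw [e1, e2, map_mul, map_sub, hal]
  congr 2
  · unfold iop; split_ifs <;> simp
  · unfold iom; split_ifs <;> simp

end Structure

end QAS
end

noncomputable section
namespace QAS

section PhiSeries

variable (q : ℂ) {M N : ℕ} (w : WD M N) {A : Type} [CommRing A] [Algebra ℂ A]

lemma ldS_add (t : ℂ) (a b : ℕ → A) : ldS t (fun s => a s + b s) = ldS t a + ldS t b := by
  ext n; simp [ldS]

open PowerSeries in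
/-- products of solutions of the logarithmic equation -/
lemma ode_prod (t : ℂ) {Y : Type} (b : ℕ → A) (hb : Y → ℕ → A) (B : PowerSeries A)
    (HB : Y → PowerSeries A) (h : derivative A B = ldS t b * B)
    (hH : ∀ y, derivative A (HB y) = ldS t (hb y) * HB y) (l : List Y) :
    derivative A (B * (l.map HB).prod) =
      ldS t (fun s => b s + (l.map fun y => hb y s).sum) * (B * (l.map HB).prod) := by
  have aux : derivative A ((l.map HB).prod) =
      ldS t (fun s => (l.map fun y => hb y s).sum) * (l.map HB).prod := by
    induction l with
    | nil =>
      have : ldS t (fun _ => (0 : A)) = 0 := by ext n; simp [ldS]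
      simp [this]
    | cons y l ih =>
      simp only [List.map_cons, List.prod_cons, List.sum_cons]
      rw [ldS_add, Derivation.leibniz, ih, hH]
      simp only [smul_eq_mul]; ring
  rw [Derivation.leibniz, aux, h, ldS_add]
  simp only [smul_eq_mul]; ring

lemma hc_tt (hq : q ≠ 0) (hq2 : q ^ 2 ≠ 1) (i j : ℕ) (s : ℤ) (hs : s ≠ 0) :
    tt q M i * (s : ℂ) * hc q M i j s = q ^ (s * cc M i j) - q ^ (-(s * cc M i j)) := by
  have hs' : (s : ℂ) ≠ 0 := by exact_mod_cast hs
  have hq3 : q - q⁻¹ ≠ 0 := by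
    intro h; apply hq2
    have : q = q⁻¹ := sub_eq_zero.mp h
    rw [sq]; nth_rewrite 2 [this]; exact mul_inv_cancel₀ hq
  have hl : lof M i = 1 ∨ lof M i = -1 := by unfold lof; split_ifs <;> simp
  unfold hc qint tt qpar
  rcases hl with h | h <;> rw [h]
  · simp only [zpow_one, mul_one]
    field_simp
  · have : (q⁻¹ - q) ≠ 0 := by rw [← neg_sub]; exact neg_ne_zero.mpr hq3
    simp only [zpow_neg, zpow_one, inv_inv, mul_neg, mul_one, neg_mul, inv_zpow]
    field_simp

lemma tt_ne (hq : q ≠ 0) (hq2 : q ^ 2 ≠ 1) (i : ℕ) : tt q M i ≠ 0 := by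
  have hq3 : q - q⁻¹ ≠ 0 := by
    intro h; apply hq2
    have : q = q⁻¹ := sub_eq_zero.mp h
    rw [sq]; nth_rewrite 2 [this]; exact mul_inv_cancel₀ hq
  have hl : lof M i = 1 ∨ lof M i = -1 := by unfold lof; split_ifs <;> simp
  unfold tt qpar
  rcases hl with h | h <;> rw [h]
  · simpa using hq3
  · simp only [zpow_neg, zpow_one, inv_inv]
    rw [← neg_sub]; exact neg_ne_zero.mpr hq3

open PowerSeries in
lemma map_ode (t : ℂ) (a : ℕ → ℂ) :
    PowerSeries.map (algebraMap ℂ A) (PowerSeries.mk (expC t a)) =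
      PowerSeries.mk (expC t (fun s => (algebraMap ℂ A (a s)))) := by
  ext n
  rw [coeff_map, coeff_mk, coeff_mk]
  exact expC_map (Algebra.ofId ℂ A) t a n

open PowerSeries in
lemma phi_series_p (hq : q ≠ 0) (hq2 : q ^ 2 ≠ 1) (i : Idx M N) (l : List (Pt M N A)) (n : ℕ) :
    coeff n (PowerSeries.map (algebraMap ℂ A) (chiP q w i) *
      (l.map fun y => (PowerSeries.C (al (aq q M i.1 y.1.1)) - PowerSeries.C (y.2 : A) * X) *
        geo (up q i y)).prod) =
    kev q w i l * expC (tt q M i.1) (fun s => hev q w i (s : ℤ) l) n := by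
  set um' : Pt M N A → A := fun y => al (aq q M i.1 y.1.1)⁻¹ * (y.2 : A) with hum'
  have haa : ∀ j, (al (aq q M i.1 j) : A) * al (aq q M i.1 j)⁻¹ = 1 := by
    intro j; rw [← map_mul, mul_inv_cancel₀ (aq_ne q hq _ _), map_one]
  have e1 : (l.map fun y => (PowerSeries.C (al (aq q M i.1 y.1.1)) - PowerSeries.C (y.2 : A) * X) *
        geo (up q i y)).prod = PowerSeries.C ((l.map fun y => (al (aq q M i.1 y.1.1) : A)).prod) *
      (l.map fun y => (1 - PowerSeries.C (um' y) * X) * geo (up q i y)).prod := by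
    rw [map_list_prod, List.map_map, ← List.prod_map_mul]
    congr 1
    apply List.map_congr_left
    intro y _
    have : PowerSeries.C (y.2 : A) = PowerSeries.C (al (aq q M i.1 y.1.1)) * PowerSeries.C (um' y) := by
      rw [← map_mul, hum', ← mul_assoc, haa, one_mul]
    simp only [Function.comp]
    rw [this]; ring
  rw [e1]
  unfold chiP kev
  rw [(PowerSeries.map (algebraMap ℂ A)).map_mul, PowerSeries.map_C, map_ode]
  set B : PowerSeries A := PowerSeries.mk (expC (tt q M i.1) (fun s => algebraMap ℂ A (w.eta i (s : ℤ))))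
  set Q := (l.map fun y => (1 - PowerSeries.C (um' y) * X) * geo (up q i y)).prod with hQ
  rw [show PowerSeries.C ((algebraMap ℂ A) (w.kap i)) * B *
    (PowerSeries.C ((l.map fun y => (al (aq q M i.1 y.1.1) : A)).prod) * Q) =
    PowerSeries.C (al (w.kap i) * (l.map fun y => (al (aq q M i.1 y.1.1) : A)).prod) * (B * Q) by
      rw [map_mul]; ring, coeff_C_mul]
  congr 1
  apply expC_of_ode
  · rw [coeff_zero_eq_constantCoeff_apply, map_mul, hQ, map_list_prod, List.map_map]
    have : List.map (⇑constantCoeff ∘ fun y => (1 - PowerSeries.C (um' y) * X) * geo (up q i y)) l =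
        List.map (fun _ => (1 : A)) l := by
      apply List.map_congr_left; intro y _; simp [geo]
    rw [this, ← coeff_zero_eq_constantCoeff_apply, coeff_mk, expC]
    simp
  · unfold hev
    apply ode_prod
    · exact expC_ode _ _
    · intro y
      rw [factor_ode _ _ (mul_comm _ _)]
      congr 1
      ext n
      rw [map_sub, coeff_C_mul, coeff_C_mul, ldS, coeff_mk, geo, geo, coeff_mk, coeff_mk]
      have := hc_tt (M := M) q hq hq2 i.1 y.1.1 (((n + 1 : ℕ) : ℤ)) (by omega)
      have h3 := congrArg (algebraMap ℂ A) this
      push_cast at h3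
      rw [Algebra.smul_def, ← pow_succ', ← pow_succ']
      rw [hum']
      simp only [up, aq, mul_pow, ← map_pow]
      have e1 : (q ^ (-cc M i.1 y.1.1)) ^ (n + 1) = q ^ (-(((n : ℤ) + 1) * cc M i.1 y.1.1)) := by
        rw [← zpow_natCast, ← zpow_mul]; congr 1; push_cast; ring
      have e2 : ((q ^ (-cc M i.1 y.1.1))⁻¹) ^ (n + 1) = q ^ ((((n : ℤ) + 1) * cc M i.1 y.1.1)) := by
        rw [← zpow_neg, ← zpow_natCast, ← zpow_mul]; congr 1; push_cast; ring
      rw [e1, e2]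
      have e3 : ((y.2 ^ (((n + 1 : ℕ) : ℤ)) : Aˣ) : A) = (y.2 : A) ^ (n + 1) := by
        rw [zpow_natCast]; simp
      rw [e3]
      simp only [map_mul, map_add] at h3 ⊢
      push_cast
      linear_combination ((y.2 : A) ^ (n+1)) * h3

open PowerSeries in
lemma phi_series_m (hq : q ≠ 0) (hq2 : q ^ 2 ≠ 1) (i : Idx M N) (l : List (Pt M N A)) (n : ℕ) :
    coeff n (PowerSeries.map (algebraMap ℂ A) (chiM q w i) *
      (l.map fun y => (PowerSeries.C (al (aq q M i.1 y.1.1)) * X - PowerSeries.C (y.2 : A)) *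
        (PowerSeries.C (-um q i y) * geo (um q i y))).prod) =
    kiev q w i l * expC (-tt q M i.1) (fun s => hev q w i (-(s : ℤ)) l) n := by
  set um' : Pt M N A → A := fun y => al (aq q M i.1 y.1.1) * ((y.2⁻¹ : Aˣ) : A) with hum'
  have haa : ∀ j, (al (aq q M i.1 j) : A) * al (aq q M i.1 j)⁻¹ = 1 := by
    intro j; rw [← map_mul, mul_inv_cancel₀ (aq_ne q hq _ _), map_one]
  have e1 : (l.map fun y => (PowerSeries.C (al (aq q M i.1 y.1.1)) * X - PowerSeries.C (y.2 : A)) *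
        (PowerSeries.C (-um q i y) * geo (um q i y))).prod =
      PowerSeries.C ((l.map fun y => (al (aq q M i.1 y.1.1)⁻¹ : A)).prod) *
      (l.map fun y => (1 - PowerSeries.C (um' y) * X) * geo (um q i y)).prod := by
    rw [map_list_prod, List.map_map, ← List.prod_map_mul]
    congr 1
    apply List.map_congr_left
    intro y _
    simp only [Function.comp]
    have h1 : (PowerSeries.C (al (aq q M i.1 y.1.1)) : PowerSeries A) *
        PowerSeries.C (al (aq q M i.1 y.1.1)⁻¹) = 1 := by
      rw [← map_mul, haa, map_one]
    have h2 : (PowerSeries.C (y.2 : A)) * PowerSeries.C ((y.2⁻¹ : Aˣ) : A) = 1 := by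
      rw [← map_mul, Units.mul_inv, map_one]
    have h3 : PowerSeries.C (um' y) = PowerSeries.C (al (aq q M i.1 y.1.1)) *
        PowerSeries.C ((y.2⁻¹ : Aˣ) : A) := by rw [← map_mul]
    rw [h3]
    simp only [um, map_mul, map_neg]
    linear_combination (PowerSeries.C (al (aq q M i.1 y.1.1)⁻¹) *
      geo (al (aq q M i.1 y.1.1)⁻¹ * ((y.2⁻¹ : Aˣ) : A))) * h2
  rw [e1]
  unfold chiM kiev
  rw [(PowerSeries.map (algebraMap ℂ A)).map_mul, PowerSeries.map_C, map_ode]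
  set B : PowerSeries A := PowerSeries.mk (expC (-tt q M i.1) (fun s => algebraMap ℂ A (w.eta i (-(s : ℤ)))))
  set Q := (l.map fun y => (1 - PowerSeries.C (um' y) * X) * geo (um q i y)).prod with hQ
  rw [show PowerSeries.C ((algebraMap ℂ A) (w.kap i)⁻¹) * B *
    (PowerSeries.C ((l.map fun y => (al (aq q M i.1 y.1.1)⁻¹ : A)).prod) * Q) =
    PowerSeries.C (al (w.kap i)⁻¹ * (l.map fun y => (al (aq q M i.1 y.1.1)⁻¹ : A)).prod) * (B * Q) by
      rw [map_mul]; ring, coeff_C_mul]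
  congr 1
  apply expC_of_ode
  · rw [coeff_zero_eq_constantCoeff_apply, map_mul, hQ, map_list_prod, List.map_map]
    have : List.map (⇑constantCoeff ∘ fun y => (1 - PowerSeries.C (um' y) * X) * geo (um q i y)) l =
        List.map (fun _ => (1 : A)) l := by
      apply List.map_congr_left; intro y _; simp [geo]
    rw [this, ← coeff_zero_eq_constantCoeff_apply, coeff_mk, expC]
    simp
  · unfold hev
    apply ode_prod
    · exact expC_ode _ _
    · intro y
      rw [factor_ode _ _ (mul_comm _ _)]
      congr 1
      ext n
      rw [map_sub, coeff_C_mul, coeff_C_mul, ldS, coeff_mk, geo, geo, coeff_mk, coeff_mk]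
      have := hc_tt (M := M) q hq hq2 i.1 y.1.1 (-((n + 1 : ℕ) : ℤ)) (by omega)
      have h3 := congrArg (algebraMap ℂ A) this
      push_cast at h3
      rw [Algebra.smul_def, ← pow_succ', ← pow_succ']
      rw [hum']
      simp only [um, aq, mul_pow, ← map_pow]
      have e1 : (q ^ (-cc M i.1 y.1.1)) ^ (n + 1) = q ^ ((-1 + -(n : ℤ)) * cc M i.1 y.1.1) := by
        rw [← zpow_natCast, ← zpow_mul]; congr 1; push_cast; ring
      have e2 : ((q ^ (-cc M i.1 y.1.1))⁻¹) ^ (n + 1) = q ^ (-((-1 + -(n : ℤ)) * cc M i.1 y.1.1)) := by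
        rw [← zpow_neg, ← zpow_natCast, ← zpow_mul]; congr 1; push_cast; ring
      rw [e1, e2]
      have e3 : ((y.2 ^ (-((n + 1 : ℕ) : ℤ)) : Aˣ) : A) = ((y.2⁻¹ : Aˣ) : A) ^ (n + 1) := by
        rw [zpow_neg, zpow_natCast, ← inv_pow]; simp
      rw [e3]
      simp only [neg_add_rev] at h3
      simp only [map_mul, map_add, map_neg] at h3 ⊢
      push_cast
      simp only [neg_add_rev]
      linear_combination ((((y.2⁻¹ : Aˣ) : A) ^ (n+1))) * h3

/-- eigenvalues of `φ⁺` -/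
def phiPev (i : Idx M N) (l : List (Pt M N A)) (n : ℤ) : A :=
  if 0 ≤ n then kev q w i l * expC (tt q M i.1) (fun s => hev q w i (s : ℤ) l) n.toNat else 0
def phiMev (i : Idx M N) (l : List (Pt M N A)) (n : ℤ) : A :=
  if n ≤ 0 then kiev q w i l * expC (-tt q M i.1) (fun s => hev q w i (-(s : ℤ)) l) (-n).toNat else 0

open LaurentPolynomial in
lemma ee_phi (hq : q ≠ 0) (hq2 : q ^ 2 ≠ 1) (i : Idx M N) (l : List (Pt M N A)) (n : ℤ) :
    pr (ee q w i l) ((l.map fun y => LaurentPolynomial.C (al (aq q M i.1 y.1.1)) * T 1 -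
        LaurentPolynomial.C (y.2 : A)).prod * T n) =
      al (tt q M i.1)⁻¹ * (phiPev q w i l n - phiMev q w i l n) := by
  unfold ee
  rw [pr_linE]
  congr 2
  · unfold PPp
    rw [pr_iop_prod]
    have := pr_CT (iop (PowerSeries.map (algebraMap ℂ A) (chiP q w i) *
      (l.map fun y => (PowerSeries.C (al (aq q M i.1 y.1.1)) - PowerSeries.C (y.2 : A) * PowerSeries.X) *
        geo (up q i y)).prod)) 1 n
    rw [map_one, one_mul, one_mul] at this
    rw [this]
    unfold iop phiPev
    split_ifs
    · exact phi_series_p q w hq hq2 i l _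
    · rfl
  · unfold PPm
    rw [pr_iom_prod]
    have := pr_CT (iom (PowerSeries.map (algebraMap ℂ A) (chiM q w i) *
      (l.map fun y => (PowerSeries.C (al (aq q M i.1 y.1.1)) * PowerSeries.X - PowerSeries.C (y.2 : A)) *
        (PowerSeries.C (-um q i y) * geo (um q i y))).prod)) 1 n
    rw [map_one, one_mul, one_mul] at this
    rw [this]
    unfold iom phiMev
    split_ifs
    · exact phi_series_m q w hq hq2 i l _
    · rfl

end PhiSeries
end QAS
end

noncomputable section
namespace QAS

/-! ### the shuffle type module -/

abbrev Fam (M N : ℕ) := ∀ A : CAlg, List (Pt M N A.carrier) → A.carrier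

/-- transport of particles along an algebra map -/
def pm {M N : ℕ} {A B : Type} [CommRing A] [CommRing B] [Algebra ℂ A] [Algebra ℂ B]
    (f : A →ₐ[ℂ] B) (y : Pt M N A) : Pt M N B := (y.1, Units.map (f : A →* B) y.2)

/-- natural families -/
def Smod (M N : ℕ) : Submodule ℂ (Fam M N) where
  carrier := {F | ∀ (A B : CAlg) (f : A.carrier →ₐ[ℂ] B.carrier) (l : List (Pt M N A.carrier)),
    F B (l.map (pm f)) = f (F A l)}
  add_mem' := by
    intro F G hF hG A B f l
    simp only [Pi.add_apply, hF A B f l, hG A B f l, map_add]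
  zero_mem' := by intro A B f l; simp
  smul_mem' := by
    intro c F hF A B f l
    simp only [Pi.smul_apply, hF A B f l, map_smul]

section Operators

variable (q : ℂ) {M N : ℕ} (w : WD M N)

/-- diagonal operators -/
def diagL (d : Fam M N) (hd : d ∈ Smod M N) : Module.End ℂ (Smod M N) where
  toFun F := ⟨fun A l => d A l * F.1 A l, by
    intro A B f l
    simp only [hd A B f l, F.2 A B f l, map_mul]⟩
  map_add' F G := by
    apply Subtype.ext; funext A l; exact mul_add _ _ _
  map_smul' c F := by
    apply Subtype.ext; funext A l; exact mul_smul_comm _ _ _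

lemma hev_mem (i : Idx M N) (s : ℤ) : (fun A l => hev q w i s l : Fam M N) ∈ Smod M N := by
  intro A B f l
  simp only [hev, List.map_map, map_add, map_list_sum, AlgHom.commutes]
  congr 2
  apply List.map_congr_left
  intro y _
  simp only [Function.comp, pm, map_mul, map_neg, AlgHom.commutes, ← map_zpow]
  rfl

lemma prodfam_mem (c : ℂ) (k : Idx M N → ℂ) :
    (fun A l => al c * (l.map fun y => (al (k y.1) : A.carrier)).prod : Fam M N) ∈ Smod M N := by
  intro A B f l
  simp only [List.map_map, map_mul, map_list_prod, AlgHom.commutes]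
  congr 2
  apply List.map_congr_left
  intro y _
  simp only [Function.comp, pm, AlgHom.commutes]

lemma kev_mem (i : Idx M N) : (fun A l => kev q w i l : Fam M N) ∈ Smod M N :=
  prodfam_mem (w.kap i) (fun j => aq q M i.1 j.1)
lemma kiev_mem (i : Idx M N) : (fun A l => kiev q w i l : Fam M N) ∈ Smod M N :=
  prodfam_mem (w.kap i)⁻¹ (fun j => (aq q M i.1 j.1)⁻¹)

def k0e (j : Idx M N) : ℂ := q ^ (if j.1 = 1 then (-1 : ℤ) else 0)

def k0ev : Fam M N := fun _ l => al 1 * (l.map fun y => al (k0e q y.1)).prod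
def k0iev : Fam M N := fun _ l => al 1 * (l.map fun y => al (k0e q y.1)⁻¹).prod

lemma zz1_pm {A B : Type} [CommRing A] [CommRing B] [Algebra ℂ A] [Algebra ℂ B]
    (f : A →ₐ[ℂ] B) (r s : Pt M N A) : zz1 q M N (pm f r) (pm f s) = f (zz1 q M N r s) := by
  simp [zz1, pm]
lemma zz2_pm {A B : Type} [CommRing A] [CommRing B] [Algebra ℂ A] [Algebra ℂ B]
    (f : A →ₐ[ℂ] B) (r s : Pt M N A) : zz2 q M N (pm f r) (pm f s) = f (zz2 q M N r s) := by
  simp [zz2, pm]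
lemma gX_pm {A B : Type} [CommRing A] [CommRing B] [Algebra ℂ A] [Algebra ℂ B]
    (f : A →ₐ[ℂ] B) (i : Idx M N) (n : ℤ) (r : Pt M N A) : gX i n (pm f r) = f (gX i n r) := by
  simp only [gX, pm, ← map_zpow]
  split_ifs
  · rfl
  · simp

def XmL (j : Idx M N) (n : ℤ) : Module.End ℂ (Smod M N) where
  toFun F := ⟨fun A l => U1 (zz1 q M N) (zz2 q M N) (gX j n) (F.1 A) l, by
    intro A B f l
    exact U1_map _ _ (f : A.carrier →+* B.carrier) (pm f) _ _ (zz1_pm q f) (zz2_pm q f) l _ _ _ _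
      (gX_pm f j n) (fun l => F.2 A B f l)⟩
  map_add' F G := by
    apply Subtype.ext; funext A l; exact U1_addF _ _ _ _ _ _
  map_smul' c F := by
    apply Subtype.ext; funext A l
    simp only [RingHom.id_apply, Submodule.coe_smul, Pi.smul_apply, Algebra.smul_def]
    exact U1_mulF _ _ _ _ _ _

/-- Laurent polynomials over `A` -/
abbrev LPA (A : CAlg) : CAlg := ⟨LaurentPolynomial A.carrier⟩

def LC (A : CAlg) : A.carrier →ₐ[ℂ] (LPA A).carrier where
  toRingHom := LaurentPolynomial.C
  commutes' := by intro r; rfl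

def LT (A : CAlg) : ((LPA A).carrier)ˣ where
  val := (LaurentPolynomial.T 1 : LaurentPolynomial A.carrier)
  inv := (LaurentPolynomial.T (-1) : LaurentPolynomial A.carrier)
  val_inv := by
    have : (LaurentPolynomial.T 1 * LaurentPolynomial.T (-1) : LaurentPolynomial A.carrier) = 1 := by
      rw [← LaurentPolynomial.T_add]; simp
    exact this
  inv_val := by
    have : (LaurentPolynomial.T (-1) * LaurentPolynomial.T 1 : LaurentPolynomial A.carrier) = 1 := by
      rw [← LaurentPolynomial.T_add]; simp
    exact this

lemma LT_zpow (A : CAlg) (n : ℤ) :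
    ((LT A ^ n : ((LPA A).carrier)ˣ) : (LPA A).carrier) =
      (LaurentPolynomial.T n : LaurentPolynomial A.carrier) := by
  induction n using Int.induction_on with
  | zero => simp
  | succ n ih =>
    rw [zpow_add_one, Units.val_mul, ih, LaurentPolynomial.T_add]; rfl
  | pred n ih =>
    rw [zpow_sub_one, Units.val_mul, ih, sub_eq_add_neg, LaurentPolynomial.T_add]; rfl

/-- functoriality of Laurent polynomials -/
def LMap {A B : CAlg} (f : A.carrier →ₐ[ℂ] B.carrier) : (LPA A).carrier →ₐ[ℂ] (LPA B).carrier where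
  toRingHom := AddMonoidAlgebra.mapRingHom ℤ (f : A.carrier →+* B.carrier)
  commutes' := by
    intro r
    have : (AddMonoidAlgebra.mapRingHom ℤ (f : A.carrier →+* B.carrier))
        (LaurentPolynomial.C (algebraMap ℂ A.carrier r)) =
        LaurentPolynomial.C (algebraMap ℂ B.carrier r) := by
      rw [← f.commutes]
      simp [LaurentPolynomial.C, -LaurentPolynomial.single_eq_C_mul_T]
    exact this

lemma LMap_LC {A B : CAlg} (f : A.carrier →ₐ[ℂ] B.carrier) (a : A.carrier) :
    LMap f (LC A a) = LC B (f a) := by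
  have : (AddMonoidAlgebra.mapRingHom ℤ (f : A.carrier →+* B.carrier))
        (LaurentPolynomial.C a) = LaurentPolynomial.C (f a) := by
    simp [LaurentPolynomial.C, -LaurentPolynomial.single_eq_C_mul_T]
  exact this

lemma LMap_T {A B : CAlg} (f : A.carrier →ₐ[ℂ] B.carrier) (n : ℤ) :
    LMap f (LaurentPolynomial.T n : LaurentPolynomial A.carrier) =
      (LaurentPolynomial.T n : LaurentPolynomial B.carrier) := by
  have : (AddMonoidAlgebra.mapRingHom ℤ (f : A.carrier →+* B.carrier))
        (LaurentPolynomial.T n) = LaurentPolynomial.T n := by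
    simp [LaurentPolynomial.T, -LaurentPolynomial.single_eq_C_mul_T]
  exact this

lemma LMap_LT {A B : CAlg} (f : A.carrier →ₐ[ℂ] B.carrier) :
    Units.map ((LMap f : (LPA A).carrier →ₐ[ℂ] (LPA B).carrier) :
      (LPA A).carrier →* (LPA B).carrier) (LT A) = LT B := by
  apply Units.ext
  exact LMap_T f 1

/-- multiplication by `T^m` and evaluation -/
def xpv (i : Idx M N) (m : ℤ) (F : Fam M N) (A : CAlg) (l : List (Pt M N A.carrier)) : A.carrier :=
  pr (ee q w i l) ((LaurentPolynomial.T m : LaurentPolynomial A.carrier) *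
    (F (LPA A) ((i, LT A) :: l.map (pm (LC A)))))

def XpL (i : Idx M N) (m : ℤ) : Module.End ℂ (Smod M N) where
  toFun F := ⟨xpv q w i m F.1, by
    intro A B f l
    unfold xpv
    rw [show (f (pr (ee q w i l) ((LaurentPolynomial.T m : LaurentPolynomial A.carrier) *
        (F.1 (LPA A) ((i, LT A) :: l.map (pm (LC A))))))) =
      (f : A.carrier →+* B.carrier) (pr (ee q w i l) ((LaurentPolynomial.T m : LaurentPolynomial A.carrier) *
        (F.1 (LPA A) ((i, LT A) :: l.map (pm (LC A)))))) from rfl]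
    rw [← pr_map (f : A.carrier →+* B.carrier) (ee q w i l) (ee q w i (l.map (pm f)))
      (fun n => ee_map q w f i l n)]
    congr 1
    have h1 := map_mul (LMap f) (LaurentPolynomial.T m : LaurentPolynomial A.carrier)
        (F.1 (LPA A) ((i, LT A) :: l.map (pm (LC A))))
    refine Eq.trans ?_ h1.symm
    rw [LMap_T, ← F.2 (LPA A) (LPA B) (LMap f)]
    congr 1
    simp only [List.map_cons, List.map_map]
    have hh : pm (LMap f) ((i, LT A) : Pt M N (LPA A).carrier) = (i, LT B) := by
      simp only [pm]; rw [LMap_LT]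
    rw [hh]
    have h3 : List.map (pm (LC B) ∘ pm f) l = List.map (pm (LMap f) ∘ pm (LC A)) l := by
      apply List.map_congr_left
      intro y _
      simp only [Function.comp, pm]
      congr 1
      apply Units.ext
      exact (LMap_LC f _).symm
    rw [h3]⟩
  map_add' F G := by
    apply Subtype.ext; funext A l
    show xpv q w i m (F.1 + G.1) A l = xpv q w i m F.1 A l + xpv q w i m G.1 A l
    unfold xpv
    rw [← pr_add]
    congr 1
    exact mul_add _ _ _
  map_smul' c F := by
    apply Subtype.ext; funext A l
    show xpv q w i m (c • F.1) A l = c • xpv q w i m F.1 A l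
    unfold xpv
    rw [Algebra.smul_def (A := A.carrier), ← pr_C_mul]
    congr 1
    have h2 : (c • F.1) (LPA A) ((i, LT A) :: l.map (pm (LC A))) =
      (LaurentPolynomial.C (algebraMap ℂ A.carrier c) : LaurentPolynomial A.carrier) *
        (F.1 (LPA A) ((i, LT A) :: l.map (pm (LC A)))) :=
      Algebra.smul_def (A := (LPA A).carrier) c (F.1 (LPA A) ((i, LT A) :: l.map (pm (LC A))))
    rw [h2]
    exact mul_left_comm (G := LaurentPolynomial A.carrier) _ _ _

/-- the operator attached to a generator -/
def genOp : Gen M N true → Module.End ℂ (Smod M N)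
  | .Xp i n => XpL q w i n
  | .Xm i n => XmL q i n
  | .K i => diagL _ (kev_mem q w i)
  | .Ki i => diagL _ (kiev_mem q w i)
  | .H i s => diagL _ (hev_mem q w i s.1)
  | .K0 _ => diagL (k0ev q) (prodfam_mem 1 (k0e q))
  | .K0i _ => diagL (k0iev q) (prodfam_mem 1 (fun j => (k0e q j)⁻¹))

def rhoS : FA M N true →ₐ[ℂ] Module.End ℂ (Smod M N) := FreeAlgebra.lift ℂ (genOp q w)

lemma rhoS_gi (g : Gen M N true) : rhoS q w (gi g) = genOp q w g :=
  FreeAlgebra.lift_ι_apply _ _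

/-- the anti-automorphism on generators -/
def tauG : Gen M N true → Gen M N true
  | .Xp i n => .Xm i n
  | .Xm i n => .Xp i n
  | .K i => .K i
  | .Ki i => .Ki i
  | .H i s => .H i s
  | .K0 h => .K0 h
  | .K0i h => .K0i h

def tauH (M N : ℕ) : FA M N true →ₐ[ℂ] (FA M N true)ᵐᵒᵖ :=
  FreeAlgebra.lift ℂ (fun g => MulOpposite.op (gi (tauG g)))

def tau (x : FA M N true) : FA M N true := MulOpposite.unop (tauH M N x)

lemma tau_gi (g : Gen M N true) : tau (gi g) = gi (tauG g) := by
  unfold tau tauH gi; rw [FreeAlgebra.lift_ι_apply]; rfl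
lemma tau_mul (x y : FA M N true) : tau (x * y) = tau y * tau x := by
  unfold tau; rw [map_mul]; rfl
lemma tau_add (x y : FA M N true) : tau (x + y) = tau x + tau y := by
  unfold tau; rw [map_add]; rfl
lemma tau_sub (x y : FA M N true) : tau (x - y) = tau x - tau y := by
  unfold tau; rw [map_sub]; rfl
lemma tau_smul (c : ℂ) (y : FA M N true) : tau (c • y) = c • tau y := by
  unfold tau; rw [map_smul]; rfl
lemma tau_neg (y : FA M N true) : tau (-y) = - tau y := by
  unfold tau; rw [map_neg]; rfl
lemma tau_one : tau (1 : FA M N true) = 1 := by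
  unfold tau; rw [map_one]; rfl
lemma tau_zero : tau (0 : FA M N true) = 0 := by
  unfold tau; rw [map_zero]; rfl

end Operators
end QAS
end

noncomputable section
namespace QAS

section Sub
variable {P R : Type} [CommRing R] (z1 z2 : P → P → R)

lemma U2_subg (l : List P) (g h : P → P → R) (F : List P → R) :
    U2 z1 z2 (fun r s => g r s - h r s) F l = U2 z1 z2 g F l - U2 z1 z2 h F l := by
  have := U2_addg z1 z2 l (fun r s => g r s - h r s) h F
  simp only [sub_add_cancel] at this
  exact eq_sub_of_add_eq this.symm
lemma U3_subg (l : List P) (g h : P → P → P → R) (F : List P → R) :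
    U3 z1 z2 (fun r s t => g r s t - h r s t) F l = U3 z1 z2 g F l - U3 z1 z2 h F l := by
  have := U3_addg z1 z2 l (fun r s t => g r s t - h r s t) h F
  simp only [sub_add_cancel] at this
  exact eq_sub_of_add_eq this.symm
lemma U4_subg (l : List P) (g h : P → P → P → P → R) (F : List P → R) :
    U4 z1 z2 (fun r s t u => g r s t u - h r s t u) F l = U4 z1 z2 g F l - U4 z1 z2 h F l := by
  have := U4_addg z1 z2 l (fun r s t u => g r s t u - h r s t u) h F
  simp only [sub_add_cancel] at this
  exact eq_sub_of_add_eq this.symm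
lemma U2_zero (l : List P) (K : P → P → R) (hK : ∀ r s, K r s = 0) (F : List P → R) :
    U2 z1 z2 K F l = 0 := by
  have := U2_mulg z1 z2 0 l K F
  have e : (fun r s => 0 * K r s) = K := by funext r s; rw [hK, mul_zero]
  rw [e, zero_mul] at this; exact this
lemma U3_zero (l : List P) (K : P → P → P → R) (hK : ∀ r s t, K r s t = 0) (F : List P → R) :
    U3 z1 z2 K F l = 0 := by
  have := U3_mulg z1 z2 0 l K F
  have e : (fun r s t => 0 * K r s t) = K := by funext r s t; rw [hK, mul_zero]
  rw [e, zero_mul] at this; exact this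
lemma U4_zero (l : List P) (K : P → P → P → P → R) (hK : ∀ r s t u, K r s t u = 0)
    (F : List P → R) : U4 z1 z2 K F l = 0 := by
  have := U4_mulg z1 z2 0 l K F
  have e : (fun r s t u => 0 * K r s t u) = K := by funext r s t u; rw [hK, mul_zero]
  rw [e, zero_mul] at this; exact this
end Sub

section Ev
variable (q : ℂ) {M N : ℕ} (w : WD M N)

/-- values of the action -/
def ev (x : FA M N true) (F : Smod M N) (A : CAlg) (l : List (Pt M N A.carrier)) : A.carrier :=
  (rhoS q w x F).1 A l

lemma rho_ext {x y : FA M N true} (h : ∀ F A l, ev q w x F A l = ev q w y F A l) :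
    rhoS q w x = rhoS q w y := by
  apply LinearMap.ext; intro F
  apply Subtype.ext; funext A l; exact h F A l

lemma ev_mul (x y : FA M N true) (F A l) : ev q w (x * y) F A l = ev q w x (rhoS q w y F) A l := by
  unfold ev; rw [map_mul]; rfl
lemma ev_add (x y : FA M N true) (F A l) :
    ev q w (x + y) F A l = ev q w x F A l + ev q w y F A l := by
  unfold ev; rw [map_add]; rfl
lemma ev_sub (x y : FA M N true) (F A l) :
    ev q w (x - y) F A l = ev q w x F A l - ev q w y F A l := by
  unfold ev; rw [map_sub]; rfl
lemma ev_neg (x : FA M N true) (F A l) :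
    ev q w (-x) F A l = - ev q w x F A l := by
  unfold ev; rw [map_neg]; rfl
lemma ev_smul (c : ℂ) (x : FA M N true) (F A l) :
    ev q w (c • x) F A l = al c * ev q w x F A l := by
  unfold ev; rw [map_smul, ← Algebra.smul_def]; rfl
lemma ev_one (F A l) : ev q w (1 : FA M N true) F A l = F.1 A l := by
  unfold ev; rw [map_one]; rfl
lemma ev_zero (F A l) : ev q w (0 : FA M N true) F A l = 0 := by
  unfold ev; rw [map_zero]; rfl

lemma ev_Xm (j n F A l) : ev q w (gi (Gen.Xm j n)) F A l =
    U1 (zz1 q M N) (zz2 q M N) (gX j n) (F.1 A) l := by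
  unfold ev; rw [rhoS_gi]; rfl
lemma ev_Xp (j n F A l) : ev q w (gi (Gen.Xp j n)) F A l = xpv q w j n F.1 A l := by
  unfold ev; rw [rhoS_gi]; rfl
lemma ev_K (j F A l) : ev q w (gi (Gen.K j)) F A l = kev q w j l * F.1 A l := by
  unfold ev; rw [rhoS_gi]; rfl
lemma ev_Ki (j F A l) : ev q w (gi (Gen.Ki j)) F A l = kiev q w j l * F.1 A l := by
  unfold ev; rw [rhoS_gi]; rfl
lemma ev_H (j s F A l) : ev q w (gi (Gen.H j s)) F A l = hev q w j s.1 l * F.1 A l := by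
  unfold ev; rw [rhoS_gi]; rfl
lemma ev_K0 (h F A l) : ev q w (gi (Gen.K0 h)) F A l = k0ev q A l * F.1 A l := by
  unfold ev; rw [rhoS_gi]; rfl
lemma ev_K0i (h F A l) : ev q w (gi (Gen.K0i h)) F A l = k0iev q A l * F.1 A l := by
  unfold ev; rw [rhoS_gi]; rfl

lemma ev_def (x F A l) : (rhoS q w x F).1 A l = ev q w x F A l := rfl

lemma ev2 (i j : Idx M N) (m n F A l) : ev q w (gi (Gen.Xm i m) * gi (Gen.Xm j n)) F A l =
    U2 (zz1 q M N) (zz2 q M N) (K2 q M N (gX i m) (gX j n)) (F.1 A) l := by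
  rw [ev_mul, ev_Xm]
  have : (rhoS q w (gi (Gen.Xm j n)) F).1 A = U1 (zz1 q M N) (zz2 q M N) (gX j n) (F.1 A) := by
    funext l; exact ev_Xm q w j n F A l
  rw [this, U1_U1]; rfl
lemma ev3 (i j k : Idx M N) (m n p F A l) :
    ev q w (gi (Gen.Xm i m) * (gi (Gen.Xm j n) * gi (Gen.Xm k p))) F A l =
    U3 (zz1 q M N) (zz2 q M N) (K3 q M N (gX i m) (K2 q M N (gX j n) (gX k p))) (F.1 A) l := by
  rw [ev_mul, ev_Xm]
  have : (rhoS q w (gi (Gen.Xm j n) * gi (Gen.Xm k p)) F).1 A =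
    U2 (zz1 q M N) (zz2 q M N) (K2 q M N (gX j n) (gX k p)) (F.1 A) := by
    funext l; exact ev2 q w j k n p F A l
  rw [this, U1_U2]; rfl
lemma ev4 (i j k h : Idx M N) (m n p o F A l) :
    ev q w (gi (Gen.Xm i m) * (gi (Gen.Xm j n) * (gi (Gen.Xm k p) * gi (Gen.Xm h o)))) F A l =
    U4 (zz1 q M N) (zz2 q M N) (W4 q M N (gX i m) (gX j n) (gX k p) (gX h o)) (F.1 A) l := by
  rw [ev_mul, ev_Xm]
  have : (rhoS q w (gi (Gen.Xm j n) * (gi (Gen.Xm k p) * gi (Gen.Xm h o))) F).1 A =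
    U3 (zz1 q M N) (zz2 q M N) (K3 q M N (gX j n) (K2 q M N (gX k p) (gX h o))) (F.1 A) := by
    funext l; exact ev3 q w j k h n p o F A l
  rw [this, U1_U3]; rfl

/-! X⁻ relations -/

lemma rho_XX0m (i j : Idx M N) (m n : ℤ) (h : cc M i.1 j.1 = 0) :
    rhoS q w (gi (Gen.Xm i m) * gi (Gen.Xm j n) -
          sgn M i.1 j.1 • (gi (Gen.Xm j n) * gi (Gen.Xm i m))) = rhoS q w 0 := by
  apply rho_ext; intro F A l
  rw [ev_zero, ev_sub, ev_smul, ev2, ev2, ← U2_mulg, ← U2_subg]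
  exact U2_zero _ _ _ _ (fun r s => ker_XX0 q M N i j m n h r s) _

lemma rho_XXm (i j : Idx M N) (m n : ℤ) (h : cc M i.1 j.1 ≠ 0) :
    rhoS q w (gi (Gen.Xm i (m + 1)) * gi (Gen.Xm j n) -
          (q ^ (-cc M i.1 j.1)) • (gi (Gen.Xm j n) * gi (Gen.Xm i (m + 1)))) =
    rhoS q w ((q ^ (-cc M i.1 j.1)) • (gi (Gen.Xm i m) * gi (Gen.Xm j (n + 1))) -
          gi (Gen.Xm j (n + 1)) * gi (Gen.Xm i m)) := by
  apply rho_ext; intro F A l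
  simp only [ev_sub, ev_smul, ev2]
  rw [← sub_eq_zero]
  simp only [← U2_mulg, ← U2_subg]
  apply U2_zero
  intro r s
  have := ker_XX q M N i j m n h r s
  exact this

end Ev
end QAS
end

noncomputable section
namespace QAS

section Ev
variable (q : ℂ) {M N : ℕ} (w : WD M N)

lemma rho_serreM (hq : q ≠ 0) (i j : Idx M N) (m n k : ℤ)
    (h : cc M i.1 j.1 = 1 ∨ cc M i.1 j.1 = -1) (hi : i.1 ≠ M) :
    rhoS q w (brF q (gi (Gen.Xm i m)) (brF q⁻¹ (gi (Gen.Xm i n)) (gi (Gen.Xm j k))) +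
          brF q (gi (Gen.Xm i n)) (brF q⁻¹ (gi (Gen.Xm i m)) (gi (Gen.Xm j k)))) = rhoS q w 0 := by
  apply rho_ext; intro F A l
  simp only [brF, mul_sub, sub_mul, mul_smul_comm, smul_mul_assoc, mul_assoc, ev_add, ev_sub,
    ev_smul, ev3, ev_zero]
  have := U3_zero (zz1 q M N) (zz2 q M N) l _ (ker_serre q M N hq i j m n k h hi) (F.1 A)
  simp only [serK, U3_addg, U3_subg, U3_mulg] at this
  linear_combination this

lemma tau_serre (hq : q ≠ 0) (i j : Idx M N) (m n k : ℤ) :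
    tau (brF q (gi (Gen.Xp i m)) (brF q⁻¹ (gi (Gen.Xp i n)) (gi (Gen.Xp j k))) +
          brF q (gi (Gen.Xp i n)) (brF q⁻¹ (gi (Gen.Xp i m)) (gi (Gen.Xp j k)))) =
    brF q (gi (Gen.Xm i m)) (brF q⁻¹ (gi (Gen.Xm i n)) (gi (Gen.Xm j k))) +
          brF q (gi (Gen.Xm i n)) (brF q⁻¹ (gi (Gen.Xm i m)) (gi (Gen.Xm j k))) := by
  simp only [brF, tau_add, tau_sub, tau_mul, tau_smul, tau_gi, tauG, mul_sub, sub_mul,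
    mul_smul_comm, smul_mul_assoc, mul_assoc, smul_sub, smul_inv_smul₀ hq]
  abel

lemma XmF_of (i : Idx M N) (n : ℤ) : XmF M N true i.1 n = gi (Gen.Xm i n) := by
  unfold XmF; rw [dif_pos i.2]
lemma XpF_of (i : Idx M N) (n : ℤ) : XpF M N true i.1 n = gi (Gen.Xp i n) := by
  unfold XpF; rw [dif_pos i.2]

lemma rho_oscM (hq : q ≠ 0) (m n k u : ℤ) (hM : 1 < M) (hN : 1 < N) :
    rhoS q w (oscOf q M (XmF M N true) m n k u + oscOf q M (XmF M N true) m u k n) =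
      rhoS q w 0 := by
  obtain ⟨x, hx⟩ : ∃ x : Idx M N, x.1 = M - 1 := ⟨⟨M - 1, by omega⟩, rfl⟩
  obtain ⟨y, hy⟩ : ∃ x : Idx M N, x.1 = M := ⟨⟨M, by omega⟩, rfl⟩
  obtain ⟨z, hz⟩ : ∃ x : Idx M N, x.1 = M + 1 := ⟨⟨M + 1, by omega⟩, rfl⟩
  have e1 : ∀ n, XmF M N true (M - 1) n = gi (Gen.Xm x n) := by
    intro n; rw [← hx, XmF_of]
  have e2 : ∀ n, XmF M N true M n = gi (Gen.Xm y n) := by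
    intro n
    have := XmF_of y n
    rwa [hy] at this
  have e3 : ∀ n, XmF M N true (M + 1) n = gi (Gen.Xm z n) := by
    intro n; rw [← hz, XmF_of]
  unfold oscOf
  rw [e1, e2, e3, e2]
  apply rho_ext; intro F A l
  simp only [brF, mul_sub, sub_mul, mul_smul_comm, smul_mul_assoc, mul_assoc, ev_add, ev_sub,
    ev_smul, ev4, ev_zero]
  have := U4_zero (zz1 q M N) (zz2 q M N) l _ 
    (fun r s t v => (ker_osc q M N hq hM x y z hx hy hz m n k u r s t v).1) (F.1 A)
  simp only [oscK, U4_addg, U4_subg, U4_mulg] at this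
  linear_combination this

lemma rho_tau_oscP (hq : q ≠ 0) (m n k u : ℤ) (hM : 1 < M) (hN : 1 < N) :
    rhoS q w (tau (oscOf q M (XpF M N true) m n k u + oscOf q M (XpF M N true) m u k n)) =
      rhoS q w 0 := by
  obtain ⟨x, hx⟩ : ∃ x : Idx M N, x.1 = M - 1 := ⟨⟨M - 1, by omega⟩, rfl⟩
  obtain ⟨y, hy⟩ : ∃ x : Idx M N, x.1 = M := ⟨⟨M, by omega⟩, rfl⟩
  obtain ⟨z, hz⟩ : ∃ x : Idx M N, x.1 = M + 1 := ⟨⟨M + 1, by omega⟩, rfl⟩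
  have e1 : ∀ n, XpF M N true (M - 1) n = gi (Gen.Xp x n) := by
    intro n; rw [← hx, XpF_of]
  have e2 : ∀ n, XpF M N true M n = gi (Gen.Xp y n) := by
    intro n
    have := XpF_of y n
    rwa [hy] at this
  have e3 : ∀ n, XpF M N true (M + 1) n = gi (Gen.Xp z n) := by
    intro n; rw [← hz, XpF_of]
  unfold oscOf
  rw [e1, e2, e3, e2]
  apply rho_ext; intro F A l
  simp only [brF, tau_add, tau_sub, tau_mul, tau_smul, tau_gi, tauG, mul_sub, sub_mul,
    mul_smul_comm, smul_mul_assoc, mul_assoc, ev_add, ev_sub, ev_smul, ev4, ev_zero]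
  have := U4_zero (zz1 q M N) (zz2 q M N) l _ 
    (fun r s t v => (ker_osc q M N hq hM x y z hx hy hz m n k u r s t v).2) (F.1 A)
  simp only [oscR, U4_addg, U4_subg, U4_mulg] at this
  linear_combination this

lemma rho_tau_XX0p (i j : Idx M N) (m n : ℤ) (h : cc M i.1 j.1 = 0) :
    rhoS q w (tau (gi (Gen.Xp i m) * gi (Gen.Xp j n) -
          sgn M i.1 j.1 • (gi (Gen.Xp j n) * gi (Gen.Xp i m)))) = rhoS q w (tau 0) := by
  have h1 := rho_XX0m q w j i n m (by rw [cc_symm]; exact h)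
  rw [sgn_symm] at h1
  simp only [tau_sub, tau_smul, tau_mul, tau_gi, tauG, tau_zero]
  exact h1

lemma rho_tau_XXp (hq : q ≠ 0) (i j : Idx M N) (m n : ℤ) (h : cc M i.1 j.1 ≠ 0) :
    rhoS q w (tau (gi (Gen.Xp i (m + 1)) * gi (Gen.Xp j n) -
          (q ^ cc M i.1 j.1) • (gi (Gen.Xp j n) * gi (Gen.Xp i (m + 1))))) =
    rhoS q w (tau ((q ^ cc M i.1 j.1) • (gi (Gen.Xp i m) * gi (Gen.Xp j (n + 1))) -
          gi (Gen.Xp j (n + 1)) * gi (Gen.Xp i m))) := by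
  simp only [tau_sub, tau_smul, tau_mul, tau_gi, tauG]
  apply rho_ext; intro F A l
  have h1 : ev q w _ F A l = ev q w _ F A l :=
    congrArg (fun T : Module.End ℂ (Smod M N) => (T F).1 A l) (rho_XXm q w i j m n h)
  have e : (al (q ^ cc M i.1 j.1) : A.carrier) * al (q ^ (-cc M i.1 j.1)) = 1 := by
    rw [← map_mul, ← zpow_add₀ hq]; simp
  simp only [ev_sub, ev_smul] at h1 ⊢
  linear_combination (-(al (q ^ cc M i.1 j.1) : A.carrier)) * h1 -
    (ev q w (gi (Gen.Xm j n) * gi (Gen.Xm i (m + 1))) F A l +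
      ev q w (gi (Gen.Xm i m) * gi (Gen.Xm j (n + 1))) F A l) * e

end Ev
end QAS
end

noncomputable section
namespace QAS

section Ev
variable (q : ℂ) {M N : ℕ} (w : WD M N)

/-- diagonal action of `x` and of `tau x`. -/
def Dg (x : FA M N true) (d : Fam M N) : Prop :=
  (∀ F A l, ev q w x F A l = d A l * F.1 A l) ∧ (∀ F A l, ev q w (tau x) F A l = d A l * F.1 A l)

variable {q w}

lemma Dg_mul {x y : FA M N true} {d e : Fam M N} (hx : Dg q w x d) (hy : Dg q w y e) :
    Dg q w (x * y) (fun A l => d A l * e A l) := by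
  constructor
  · intro F A l
    rw [ev_mul, hx.1, ev_def, hy.1]; ring
  · intro F A l
    rw [tau_mul, ev_mul, hy.2, ev_def, hx.2]; ring
lemma Dg_add {x y : FA M N true} {d e : Fam M N} (hx : Dg q w x d) (hy : Dg q w y e) :
    Dg q w (x + y) (fun A l => d A l + e A l) := by
  constructor
  · intro F A l; rw [ev_add, hx.1, hy.1]; ring
  · intro F A l; rw [tau_add, ev_add, hx.2, hy.2]; ring
lemma Dg_sub {x y : FA M N true} {d e : Fam M N} (hx : Dg q w x d) (hy : Dg q w y e) :
    Dg q w (x - y) (fun A l => d A l - e A l) := by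
  constructor
  · intro F A l; rw [ev_sub, hx.1, hy.1]; ring
  · intro F A l; rw [tau_sub, ev_sub, hx.2, hy.2]; ring
lemma Dg_smul (c : ℂ) {x : FA M N true} {d : Fam M N} (hx : Dg q w x d) :
    Dg q w (c • x) (fun A l => c • d A l) := by
  constructor
  · intro F A l; rw [ev_smul, hx.1]; show _ = (c • d A l) * F.1 A l; rw [Algebra.smul_def]; ring
  · intro F A l; rw [tau_smul, ev_smul, hx.2]; show _ = (c • d A l) * F.1 A l; rw [Algebra.smul_def]; ring
lemma Dg_one : Dg q w (1 : FA M N true) (fun _ _ => 1) := by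
  constructor
  · intro F A l; rw [ev_one, one_mul]
  · intro F A l; rw [tau_one, ev_one, one_mul]
lemma Dg_zero : Dg q w (0 : FA M N true) (fun _ _ => 0) := by
  constructor
  · intro F A l; rw [ev_zero, zero_mul]
  · intro F A l; rw [tau_zero, ev_zero, zero_mul]
lemma Dg_sum {ι : Type} (s : Finset ι) (x : ι → FA M N true) (d : ι → Fam M N)
    (h : ∀ i ∈ s, Dg q w (x i) (d i)) : Dg q w (∑ i ∈ s, x i) (fun A l => ∑ i ∈ s, d i A l) := by
  classical
  induction s using Finset.induction_on with
  | empty => simpa using Dg_zero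
  | insert a s ha ih =>
    simp only [Finset.sum_insert ha]
    exact Dg_add (h a (Finset.mem_insert_self _ _))
      (ih fun i hi => h i (Finset.mem_insert_of_mem hi))

lemma Dg_K (i : Idx M N) : Dg q w (gi (Gen.K i)) (fun _ l => kev q w i l) :=
  ⟨fun F A l => ev_K q w i F A l, fun F A l => by rw [tau_gi]; exact ev_K q w i F A l⟩
lemma Dg_Ki (i : Idx M N) : Dg q w (gi (Gen.Ki i)) (fun _ l => kiev q w i l) :=
  ⟨fun F A l => ev_Ki q w i F A l, fun F A l => by rw [tau_gi]; exact ev_Ki q w i F A l⟩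
lemma Dg_H (i : Idx M N) (s) : Dg q w (gi (Gen.H i s)) (fun _ l => hev q w i s.1 l) :=
  ⟨fun F A l => ev_H q w i s F A l, fun F A l => by rw [tau_gi]; exact ev_H q w i s F A l⟩
lemma Dg_K0 (h) : Dg q w (gi (Gen.K0 h)) (k0ev q) :=
  ⟨fun F A l => ev_K0 q w h F A l, fun F A l => by rw [tau_gi]; exact ev_K0 q w h F A l⟩
lemma Dg_K0i (h) : Dg q w (gi (Gen.K0i h)) (k0iev q) :=
  ⟨fun F A l => ev_K0i q w h F A l, fun F A l => by rw [tau_gi]; exact ev_K0i q w h F A l⟩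

lemma Dg_expC (t : ℂ) (a : ℕ → FA M N true) (d : ℕ → Fam M N)
    (h : ∀ s, s ≠ 0 → Dg q w (a s) (d s)) (n : ℕ) :
    Dg q w (expC t a n) (fun A l => expC t (fun s => d s A l) n) := by
  induction n using Nat.strong_induction_on with
  | _ n ih =>
    rcases n with _ | n
    · simp only [expC]; exact Dg_one
    · simp only [expC]
      apply Dg_smul
      apply Dg_smul
      apply Dg_sum
      intro s hs
      apply Dg_smul
      exact Dg_mul (h _ (by omega)) (ih _ (by omega))

lemma KF_of (i : Idx M N) : KF M N true i.1 = gi (Gen.K i) := by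
  unfold KF; rw [dif_pos i.2]
lemma KiF_of (i : Idx M N) : KiF M N true i.1 = gi (Gen.Ki i) := by
  unfold KiF; rw [dif_pos i.2]
lemma HF_of (i : Idx M N) (s : ℤ) (hs : s ≠ 0) : HF M N true i.1 s = gi (Gen.H i ⟨s, hs⟩) := by
  unfold HF; rw [dif_pos ⟨i.2, hs⟩]

lemma Dg_phiP (i : Idx M N) (n : ℤ) :
    Dg q w (phiPF q M N true i.1 n) (fun _ l => phiPev q w i l n) := by
  unfold phiPF phiPev
  split_ifs
  · rw [KF_of]
    apply Dg_mul (Dg_K i)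
    refine Dg_expC _ _ (fun s A l => hev q w i (s : ℤ) l) ?_ _
    intro s hs
    rw [HF_of i s (by exact_mod_cast hs)]
    exact Dg_H i _
  · exact Dg_zero
lemma Dg_phiM (i : Idx M N) (n : ℤ) :
    Dg q w (phiMF q M N true i.1 n) (fun _ l => phiMev q w i l n) := by
  unfold phiMF phiMev
  split_ifs
  · rw [KiF_of]
    apply Dg_mul (Dg_Ki i)
    refine Dg_expC _ _ (fun s A l => hev q w i (-(s : ℤ)) l) ?_ _
    intro s hs
    rw [HF_of i (-(s : ℤ)) (by omega)]
    exact Dg_H i _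
  · exact Dg_zero

lemma Dg_eq {x y : FA M N true} {d e : Fam M N} (hx : Dg q w x d) (hy : Dg q w y e)
    (h : ∀ A l, d A l = e A l) : rhoS q w x = rhoS q w y ∧ rhoS q w (tau x) = rhoS q w (tau y) := by
  constructor
  · apply rho_ext; intro F A l; rw [hx.1, hy.1, h]
  · apply rho_ext; intro F A l; rw [hx.2, hy.2, h]

lemma Dg_comm {x y : FA M N true} {d e : Fam M N} (hx : Dg q w x d) (hy : Dg q w y e) :
    rhoS q w (x * y) = rhoS q w (y * x) ∧ rhoS q w (tau (x * y)) = rhoS q w (tau (y * x)) :=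
  Dg_eq (Dg_mul hx hy) (Dg_mul hy hx) (fun _ _ => mul_comm _ _)

/-! multiplicative diagonal operators against `X` -/

lemma Dprod_Xm {x : FA M N true} (c : ℂ) (k : Idx M N → ℂ)
    (hx : Dg q w x (fun A l => al c * (l.map fun y => (al (k y.1) : A.carrier)).prod))
    (j : Idx M N) (n : ℤ) :
    rhoS q w (x * gi (Gen.Xm j n)) = rhoS q w (k j • (gi (Gen.Xm j n) * x)) := by
  apply rho_ext; intro F A l
  rw [ev_mul, hx.1, ev_def, ev_Xm, ev_smul, ev_mul, ev_Xm]
  have e1 : (rhoS q w x F).1 A = fun l => al c *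
      ((l.map fun y => (al (k y.1) : A.carrier)).prod * F.1 A l) := by
    funext l; rw [ev_def, hx.1, mul_assoc]
  rw [e1, U1_mulF]
  have h1 := U1_absorb (zz1 q M N) (zz2 q M N) (fun y : Pt M N A.carrier => (al (k y.1) : A.carrier))
    l (gX j n) (F.1 A)
  have e2 : (fun r : Pt M N A.carrier => gX j n r * (al (k r.1) : A.carrier)) =
      fun r => al (k j) * gX j n r := by
    funext r
    unfold gX
    split_ifs with h
    · rw [h, mul_comm]
    · simp
  rw [e2, U1_mulg] at h1
  linear_combination (-(al c : A.carrier)) * h1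

lemma Dprod_Xp {x : FA M N true} (c : ℂ) (k : Idx M N → ℂ)
    (hx : Dg q w x (fun A l => al c * (l.map fun y => (al (k y.1) : A.carrier)).prod))
    (j : Idx M N) (n : ℤ) :
    rhoS q w (gi (Gen.Xp j n) * x) = rhoS q w (k j • (x * gi (Gen.Xp j n))) := by
  apply rho_ext; intro F A l
  rw [ev_mul, ev_smul, ev_mul, hx.1, ev_def, ev_Xp, ev_Xp]
  unfold xpv
  rw [← pr_C_mul, ← pr_C_mul]
  congr 1
  rw [ev_def, hx.1]
  simp only [List.map_cons, List.prod_cons, List.map_map]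
  have e : (List.map ((fun y : Pt M N (LPA A).carrier => (al (k y.1) : (LPA A).carrier)) ∘ pm (LC A)) l).prod
      = LaurentPolynomial.C (l.map fun y => (al (k y.1) : A.carrier)).prod := by
    rw [map_list_prod, List.map_map]; rfl
  rw [e]
  have e3 : ∀ z : ℂ, (al z : (LPA A).carrier) = LaurentPolynomial.C (al z : A.carrier) := fun z => rfl
  rw [e3, e3, map_mul]
  ring

lemma rho_KXm (i j : Idx M N) (n : ℤ) :
    rhoS q w (gi (Gen.K i) * gi (Gen.Xm j n)) =
      rhoS q w ((q ^ (-cc M i.1 j.1)) • (gi (Gen.Xm j n) * gi (Gen.K i))) :=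
  Dprod_Xm _ (fun j => aq q M i.1 j.1) (Dg_K i) j n

lemma rho_KXp (hq : q ≠ 0) (i j : Idx M N) (n : ℤ) :
    rhoS q w (gi (Gen.K i) * gi (Gen.Xp j n)) =
      rhoS q w ((q ^ (cc M i.1 j.1)) • (gi (Gen.Xp j n) * gi (Gen.K i))) := by
  have h := Dprod_Xp (q := q) (w := w) _ (fun j => aq q M i.1 j.1) (Dg_K i) j n
  rw [map_smul, h, map_smul, smul_smul, aq, ← zpow_add₀ hq]; simp

lemma rho_K0Xm (he) (i : Idx M N) (n : ℤ) :
    rhoS q w (gi (Gen.K0 he) * gi (Gen.Xm i n)) =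
      rhoS q w ((q ^ (if i.1 = 1 then (-1 : ℤ) else 0)) • (gi (Gen.Xm i n) * gi (Gen.K0 he))) :=
  Dprod_Xm _ _ (Dg_K0 he) i n
lemma rho_K0Xp (hq : q ≠ 0) (he) (i : Idx M N) (n : ℤ) :
    rhoS q w (gi (Gen.K0 he) * gi (Gen.Xp i n)) =
      rhoS q w ((q ^ (if i.1 = 1 then (1 : ℤ) else 0)) • (gi (Gen.Xp i n) * gi (Gen.K0 he))) := by
  have h := Dprod_Xp (q := q) (w := w) _ _ (Dg_K0 he) i n
  rw [map_smul, h, map_smul, smul_smul, k0e, ← zpow_add₀ hq]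
  split_ifs <;> simp

/-! `h` against `X` -/

lemma rho_HXm (i j : Idx M N) (s : {s : ℤ // s ≠ 0}) (n : ℤ) :
    rhoS q w (gi (Gen.H i s) * gi (Gen.Xm j n) - gi (Gen.Xm j n) * gi (Gen.H i s)) =
      rhoS q w (-((qint (qpar q M i.1) (s.1 * lof M i.1 * cc M i.1 j.1) / (s.1 : ℂ)) •
          gi (Gen.Xm j (n + s.1)))) := by
  apply rho_ext; intro F A l
  rw [ev_sub, ev_mul, ev_H, ev_def, ev_Xm, ev_mul, ev_Xm, ev_neg, ev_smul, ev_Xm]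
  have e1 : (rhoS q w (gi (Gen.H i s)) F).1 A = fun l => hev q w i s.1 l * F.1 A l := by
    funext l; rw [ev_def, ev_H]
  rw [e1]
  unfold hev
  rw [U1_additive]
  have e2 : (fun r : Pt M N A.carrier => -al (hc q M i.1 r.1.1 s.1) * ((r.2 ^ s.1 : A.carrierˣ) : A.carrier) * gX j n r)
      = fun r => (-al (hc q M i.1 j.1 s.1) : A.carrier) * gX j (n + s.1) r := by
    funext r
    unfold gX
    split_ifs with h
    · rw [h, zpow_add, Units.val_mul]; ring
    · simp
  rw [e2, U1_mulg]
  unfold hc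
  ring

lemma rho_HXp (i j : Idx M N) (s : {s : ℤ // s ≠ 0}) (n : ℤ) :
    rhoS q w (gi (Gen.H i s) * gi (Gen.Xp j n) - gi (Gen.Xp j n) * gi (Gen.H i s)) =
      rhoS q w ((qint (qpar q M i.1) (s.1 * lof M i.1 * cc M i.1 j.1) / (s.1 : ℂ)) •
          gi (Gen.Xp j (n + s.1))) := by
  apply rho_ext; intro F A l
  rw [ev_sub, ev_mul, ev_H, ev_def, ev_Xp, ev_mul, ev_Xp, ev_smul, ev_Xp]
  unfold xpv
  rw [sub_eq_iff_eq_add, ← pr_C_mul, ← pr_C_mul, ← pr_add]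
  congr 1
  rw [ev_def, ev_H]
  have e : hev q w i s.1 ((j, LT A) :: l.map (pm (LC A))) =
      LaurentPolynomial.C (hev q w i s.1 l) -
        LaurentPolynomial.C (al (hc q M i.1 j.1 s.1)) * LaurentPolynomial.T s.1 := by
    have h := hev_mem q w i s.1 A (LPA A) (LC A) l
    unfold hev at *
    rw [List.map_cons, List.sum_cons, LT_zpow]
    have h' : (LC A) (al (w.eta i s.1) + (l.map fun y => - al (hc q M i.1 y.1.1 s.1) * ((y.2 ^ s.1 : A.carrierˣ) : A.carrier)).sum) = LaurentPolynomial.C (al (w.eta i s.1) + (l.map fun y => - al (hc q M i.1 y.1.1 s.1) * ((y.2 ^ s.1 : A.carrierˣ) : A.carrier)).sum) := rfl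
    rw [← h', ← h]
    have e3 : ∀ z : ℂ, (al z : (LPA A).carrier) = LaurentPolynomial.C (al z : A.carrier) := fun z => rfl
    rw [← e3]
    ring
  rw [e, LaurentPolynomial.T_add]
  unfold hc
  ring

end Ev
end QAS
end

noncomputable section
namespace QAS

section Ev
variable {q : ℂ} {M N : ℕ} {w : WD M N}

lemma pr_ee_ins (hq : q ≠ 0) (A : CAlg) (i : Idx M N) (m : ℤ) (l1 l2 : List (Pt M N A.carrier))
    (y : Pt M N A.carrier) (p : LaurentPolynomial A.carrier) :
    pr (ee q w i (l1 ++ y :: l2)) (LaurentPolynomial.T m *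
      ((LaurentPolynomial.T 1 - LaurentPolynomial.C (up q i y)) * p)) =
    pr (ee q w i (l1 ++ l2)) (LaurentPolynomial.T m * p) := by
  have h := pr_lin (ee q w i (l1 ++ y :: l2)) 1 (-up q i y) (LaurentPolynomial.T m * p)
  have e : (fun n => 1 * ee q w i (l1 ++ y :: l2) (n + 1) + -up q i y * ee q w i (l1 ++ y :: l2) n) =
      ee q w i (l1 ++ l2) := by
    funext n; have := ee_ins q w hq i l1 l2 y n; rw [← this]; ring
  rw [e] at h
  rw [← h]
  congr 1
  rw [map_one, map_neg]; ring

lemma rho_XpXm (hq : q ≠ 0) (hq2 : q ^ 2 ≠ 1) (i j : Idx M N) (m n : ℤ) :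
    rhoS q w (gi (Gen.Xp i m) * gi (Gen.Xm j n) -
          sgn M i.1 j.1 • (gi (Gen.Xm j n) * gi (Gen.Xp i m))) =
    rhoS q w (if i = j then
            (qpar q M i.1 - (qpar q M i.1)⁻¹)⁻¹ •
              (phiPF q M N true i.1 (m + n) - phiMF q M N true i.1 (m + n))
          else 0) := by
  apply rho_ext; intro F A l
  rw [ev_sub, ev_smul, ev_mul, ev_Xp, ev_mul, ev_Xm, sub_eq_iff_eq_add]
  have e1 : (rhoS q w (gi (Gen.Xp i m)) F).1 A = fun l => xpv q w i m F.1 A l := by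
    funext l; rw [ev_def, ev_Xp]
  rw [e1]
  unfold xpv
  rw [ev_def, ev_Xm]
  simp only [U1]
  rw [mul_add, pr_add]
  congr 1
  · have hF : F.1 (LPA A) (l.map (pm (LC A))) = LaurentPolynomial.C (F.1 A l) := F.2 A (LPA A) (LC A) l
    rw [hF]
    by_cases hij : i = j
    · subst hij
      rw [if_pos rfl]
      have hD := (Dg_smul ((qpar q M i.1 - (qpar q M i.1)⁻¹)⁻¹)
        (Dg_sub (Dg_phiP (q := q) (w := w) i (m + n)) (Dg_phiM i (m + n)))).1 F A l
      rw [hD]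
      have h2 := ee_phi q w hq hq2 i l (m + n)
      have e2 : PI (zz1 q M N) ((i, LT A) : Pt M N (LPA A).carrier) (l.map (pm (LC A))) =
          (l.map fun y => LaurentPolynomial.C (al (aq q M i.1 y.1.1)) * LaurentPolynomial.T 1 -
            LaurentPolynomial.C (y.2 : A.carrier)).prod := by
        unfold PI
        rw [List.map_map]
        rfl
      have e3 : gX i n ((i, LT A) : Pt M N (LPA A).carrier) = LaurentPolynomial.T n := by
        unfold gX; rw [if_pos rfl]; exact LT_zpow A n
      rw [e2, e3]
      show _ = ((qpar q M i.1 - (qpar q M i.1)⁻¹)⁻¹ • (phiPev q w i l (m + n) - phiMev q w i l (m + n))) * F.1 A l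
      rw [Algebra.smul_def]
      change _ = al (tt q M i.1)⁻¹ * _ * _
      rw [← h2, mul_comm _ (F.1 A l), ← pr_C_mul]
      congr 1
      rw [LaurentPolynomial.T_add]
      ring
    · rw [if_neg hij, ev_zero]
      have e3 : gX j n ((i, LT A) : Pt M N (LPA A).carrier) = 0 := by
        unfold gX; rw [if_neg hij]
      rw [e3, zero_mul, zero_mul, mul_zero]
      simp [pr]
  · have h := E_U1 (A := A.carrier) (pm (LC A)) (zz1 q M N) (zz2 q M N) (zz1 q M N) (zz2 q M N)
      (fun r s => zz1_pm q (LC A) r s) (fun r s => zz2_pm q (LC A) r s) (up q i)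
      (fun l p => pr (ee q w i l) (LaurentPolynomial.T m * p))
      (fun l p p' => by rw [mul_add, pr_add])
      (fun l x p => by rw [← pr_C_mul]; congr 1; ring)
      (fun l1 y l2 p => pr_ee_ins hq A i m l1 l2 y p)
      l [] (fun r => al (sgn M i.1 j.1) * gX j n r)
      (fun r => gX j n r * zz2 q M N r (i, LT A)) (by
        intro r
        have hg : gX j n (pm (LC A) r) = LaurentPolynomial.C (gX j n r) := gX_pm (LC A) j n r
        rw [hg]
        have hz : zz2 q M N (pm (LC A) r) ((i, LT A) : Pt M N (LPA A).carrier) =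
          LaurentPolynomial.C (al (sgn M r.1.1 i.1)) * (LaurentPolynomial.T 1 -
            LaurentPolynomial.C (up q i r)) := by
          unfold up
          rw [map_mul, aq_symm q M i.1]
          rfl
        rw [hz]
        by_cases hr : r.1 = j
        · rw [hr, sgn_symm M j.1, map_mul]; ring
        · have : gX j n r = 0 := by unfold gX; rw [if_neg hr]
          rw [this]; simp)
      (fun l' => F.1 (LPA A) ((i, LT A) :: l'))
    simp only [List.nil_append] at h
    rw [U1_mulg] at h
    exact h

/-- the level one relations. -/
theorem rel1_both (hq : q ≠ 0) (hq2 : q ^ 2 ≠ 1) {a b : FA M N true} (h : rel q M N true 1 a b) :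
    rhoS q w a = rhoS q w b ∧ rhoS q w (tau a) = rhoS q w (tau b) := by
  have hKKi : ∀ (i : Idx M N) (A : CAlg) (l : List (Pt M N A.carrier)),
      kev q w i l * kiev q w i l = 1 := by
    intro i A l
    unfold kev kiev
    have h1 : (l.map fun y => (al (aq q M i.1 y.1.1) : A.carrier)).prod *
      (l.map fun y => (al (aq q M i.1 y.1.1)⁻¹ : A.carrier)).prod = 1 := by
      rw [← List.prod_map_mul]
      apply List.prod_eq_one
      intro x hx
      obtain ⟨y, _, rfl⟩ := List.mem_map.1 hx
      rw [← map_mul, mul_inv_cancel₀ (aq_ne q hq _ _), map_one]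
    have h2 : (al (w.kap i) : A.carrier) * al (w.kap i)⁻¹ = 1 := by
      rw [← map_mul, mul_inv_cancel₀ (w.kap_ne i), map_one]
    linear_combination h2 + (al (w.kap i) : A.carrier) * al (w.kap i)⁻¹ * h1
  have hK0 : ∀ (A : CAlg) (l : List (Pt M N A.carrier)), k0ev q A l * k0iev q A l = 1 := by
    intro A l
    unfold k0ev k0iev
    have h1 : (l.map fun y => (al (k0e q y.1) : A.carrier)).prod *
      (l.map fun y => (al (k0e q y.1)⁻¹ : A.carrier)).prod = 1 := by
      rw [← List.prod_map_mul]
      apply List.prod_eq_one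
      intro x hx
      obtain ⟨y, _, rfl⟩ := List.mem_map.1 hx
      have hk : k0e q y.1 ≠ 0 := zpow_ne_zero _ hq
      rw [← map_mul, mul_inv_cancel₀ hk, map_one]
    have e1 : (al 1 : A.carrier) = 1 := map_one _
    rw [e1, one_mul, one_mul, h1]
  cases h with
  | KKi i => exact Dg_eq (Dg_mul (Dg_K i) (Dg_Ki i)) Dg_one (fun A l => hKKi i A l)
  | KiK i => exact Dg_eq (Dg_mul (Dg_Ki i) (Dg_K i)) Dg_one (fun A l => by
      rw [mul_comm]; exact hKKi i A l)
  | KK i j => exact Dg_comm (Dg_K i) (Dg_K j)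
  | KKi2 i j => exact Dg_comm (Dg_K i) (Dg_Ki j)
  | KiKi i j => exact Dg_comm (Dg_Ki i) (Dg_Ki j)
  | KH i j s => exact Dg_comm (Dg_K i) (Dg_H j s)
  | KiH i j s => exact Dg_comm (Dg_Ki i) (Dg_H j s)
  | HH i j s t => exact Dg_comm (Dg_H i s) (Dg_H j t)
  | K0K0i he => exact Dg_eq (Dg_mul (Dg_K0 he) (Dg_K0i he)) Dg_one (fun A l => hK0 A l)
  | K0iK0 he => exact Dg_eq (Dg_mul (Dg_K0i he) (Dg_K0 he)) Dg_one (fun A l => by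
      rw [mul_comm]; exact hK0 A l)
  | K0K he i => exact Dg_comm (Dg_K0 he) (Dg_K i)
  | K0Ki he i => exact Dg_comm (Dg_K0 he) (Dg_Ki i)
  | K0H he i s => exact Dg_comm (Dg_K0 he) (Dg_H i s)
  | KXp i j n =>
    refine ⟨rho_KXp hq i j n, ?_⟩
    simp only [tau_smul, tau_mul, tau_gi, tauG]
    rw [map_smul, rho_KXm, map_smul, smul_smul, ← zpow_add₀ hq]; simp
  | KXm i j n =>
    refine ⟨rho_KXm i j n, ?_⟩
    simp only [tau_smul, tau_mul, tau_gi, tauG]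
    rw [map_smul, rho_KXp hq, map_smul, smul_smul, ← zpow_add₀ hq]; simp
  | K0Xp he i n =>
    refine ⟨rho_K0Xp hq he i n, ?_⟩
    simp only [tau_smul, tau_mul, tau_gi, tauG]
    rw [map_smul, rho_K0Xm, map_smul, smul_smul, ← zpow_add₀ hq]; split_ifs <;> simp
  | K0Xm he i n =>
    refine ⟨rho_K0Xm he i n, ?_⟩
    simp only [tau_smul, tau_mul, tau_gi, tauG]
    rw [map_smul, rho_K0Xp hq, map_smul, smul_smul, ← zpow_add₀ hq]; split_ifs <;> simp
  | HXp i j s n =>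
    refine ⟨rho_HXp i j s n, ?_⟩
    have h := rho_HXm (q := q) (w := w) i j s n
    simp only [tau_smul, tau_mul, tau_gi, tauG, tau_sub]
    apply rho_ext; intro F A l
    have h1 : ev q w _ F A l = ev q w _ F A l :=
      congrArg (fun T : Module.End ℂ (Smod M N) => (T F).1 A l) h
    simp only [ev_sub, ev_smul, ev_neg] at h1 ⊢
    linear_combination -h1
  | HXm i j s n =>
    refine ⟨rho_HXm i j s n, ?_⟩
    have h := rho_HXp (q := q) (w := w) i j s n
    simp only [tau_smul, tau_mul, tau_gi, tauG, tau_sub, tau_neg]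
    apply rho_ext; intro F A l
    have h1 : ev q w _ F A l = ev q w _ F A l :=
      congrArg (fun T : Module.End ℂ (Smod M N) => (T F).1 A l) h
    simp only [ev_sub, ev_smul, ev_neg] at h1 ⊢
    linear_combination -h1
  | XpXm i j m n =>
    refine ⟨rho_XpXm hq hq2 i j m n, ?_⟩
    have h := rho_XpXm (w := w) hq hq2 j i n m
    simp only [tau_smul, tau_mul, tau_gi, tauG, tau_sub]
    rw [sgn_symm, h]
    by_cases hij : i = j
    · subst hij
      rw [if_pos rfl, if_pos rfl, add_comm n m]
      have hD := (Dg_smul ((qpar q M i.1 - (qpar q M i.1)⁻¹)⁻¹)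
        (Dg_sub (Dg_phiP (q := q) (w := w) i (m + n)) (Dg_phiM i (m + n))))
      apply rho_ext; intro F A l
      rw [hD.1, hD.2]
    · rw [if_neg hij, if_neg (Ne.symm hij), tau_zero]
  | XX0p i j m n h2 => omega
  | XX0m i j m n h2 => omega
  | XXp i j m n h2 => omega
  | XXm i j m n h2 => omega
  | serreP i j m n k h3 => omega
  | serreM i j m n k h3 => omega
  | oscP m n k u h3 => omega
  | oscM m n k u h3 => omega

/-- all relations: each of them holds on one of the two sides. -/
theorem rel3_or (hq : q ≠ 0) (hq2 : q ^ 2 ≠ 1) {a b : FA M N true} (h : rel q M N true 3 a b) :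
    rhoS q w a = rhoS q w b ∨ rhoS q w (tau a) = rhoS q w (tau b) := by
  cases h with
  | XX0p i j m n h2 h => exact Or.inr (rho_tau_XX0p q w i j m n h)
  | XX0m i j m n h2 h => exact Or.inl (rho_XX0m q w i j m n h)
  | XXp i j m n h2 h => exact Or.inr (rho_tau_XXp q w hq i j m n h)
  | XXm i j m n h2 h => exact Or.inl (rho_XXm q w i j m n h)
  | serreP i j m n k h3 h hi =>
    right; rw [tau_serre q hq, tau_zero]; exact rho_serreM q w hq i j m n k h hi
  | serreM i j m n k h3 h hi => exact Or.inl (rho_serreM q w hq i j m n k h hi)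
  | oscP m n k u h3 hM hN => right; rw [tau_zero]; exact rho_tau_oscP q w hq m n k u hM hN
  | oscM m n k u h3 hM hN => exact Or.inl (rho_oscM q w hq m n k u hM hN)
  | KKi i => exact Or.inl (rel1_both hq hq2 (rel.KKi i)).1
  | KiK i => exact Or.inl (rel1_both hq hq2 (rel.KiK i)).1
  | KK i j => exact Or.inl (rel1_both hq hq2 (rel.KK i j)).1
  | KKi2 i j => exact Or.inl (rel1_both hq hq2 (rel.KKi2 i j)).1
  | KiKi i j => exact Or.inl (rel1_both hq hq2 (rel.KiKi i j)).1
  | KH i j s => exact Or.inl (rel1_both hq hq2 (rel.KH i j s)).1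
  | KiH i j s => exact Or.inl (rel1_both hq hq2 (rel.KiH i j s)).1
  | HH i j s t => exact Or.inl (rel1_both hq hq2 (rel.HH i j s t)).1
  | K0K0i he => exact Or.inl (rel1_both hq hq2 (rel.K0K0i he)).1
  | K0iK0 he => exact Or.inl (rel1_both hq hq2 (rel.K0iK0 he)).1
  | K0K he i => exact Or.inl (rel1_both hq hq2 (rel.K0K he i)).1
  | K0Ki he i => exact Or.inl (rel1_both hq hq2 (rel.K0Ki he i)).1
  | K0H he i s => exact Or.inl (rel1_both hq hq2 (rel.K0H he i s)).1
  | KXp i j n => exact Or.inl (rel1_both hq hq2 (rel.KXp i j n)).1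
  | KXm i j n => exact Or.inl (rel1_both hq hq2 (rel.KXm i j n)).1
  | HXp i j s n => exact Or.inl (rel1_both hq hq2 (rel.HXp i j s n)).1
  | HXm i j s n => exact Or.inl (rel1_both hq hq2 (rel.HXm i j s n)).1
  | K0Xp he i n => exact Or.inl (rel1_both hq hq2 (rel.K0Xp he i n)).1
  | K0Xm he i n => exact Or.inl (rel1_both hq hq2 (rel.K0Xm he i n)).1
  | XpXm i j m n => exact Or.inl (rel1_both hq hq2 (rel.XpXm i j m n)).1

end Ev
end QAS
end

noncomputable section
namespace QAS

section Tri
variable {q : ℂ} {M N : ℕ} {W : Type} [AddCommGroup W] [Module ℂ W]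
  (ρ : FA M N true →ₐ[ℂ] Module.End ℂ W) (W0 : Submodule ℂ W)

/-- the height filtration pieces. -/
def Lf : ℕ → Submodule ℂ W
  | 0 => W0
  | d + 1 => Submodule.span ℂ {x | ∃ (j : Idx M N) (n : ℤ) (w : W), w ∈ Lf d ∧ x = ρ (gi (Gen.Xm j n)) w}

/-- the elements that preserve all the pieces. -/
def Ls : Subalgebra ℂ (FA M N true) where
  carrier := {t | ∀ d, ∀ w ∈ Lf ρ W0 d, ρ t w ∈ Lf ρ W0 d}
  mul_mem' := by
    intro a b ha hb d w hw
    rw [map_mul]; exact ha d _ (hb d w hw)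
  add_mem' := by
    intro a b ha hb d w hw
    rw [map_add]; exact add_mem (ha d _ hw) (hb d w hw)
  algebraMap_mem' := by
    intro r d w hw
    rw [AlgHom.commutes, Module.algebraMap_end_apply]
    exact Submodule.smul_mem _ _ hw

lemma mem_Ls {t : FA M N true} : t ∈ Ls ρ W0 ↔ ∀ d, ∀ w ∈ Lf ρ W0 d, ρ t w ∈ Lf ρ W0 d := Iff.rfl

lemma Lf_Xm (j : Idx M N) (n : ℤ) (d : ℕ) (w : W) (hw : w ∈ Lf ρ W0 d) :
    ρ (gi (Gen.Xm j n)) w ∈ Lf ρ W0 (d + 1) :=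
  Submodule.subset_span ⟨j, n, w, hw, rfl⟩

lemma Lf_succ_le (T : Module.End ℂ W) (d : ℕ) (p : Submodule ℂ W)
    (h : ∀ j n, ∀ w ∈ Lf ρ W0 d, T (ρ (gi (Gen.Xm j n)) w) ∈ p) :
    ∀ w ∈ Lf ρ W0 (d + 1), T w ∈ p := by
  intro w hw
  have : Lf ρ W0 (d + 1) ≤ p.comap T := by
    apply Submodule.span_le.2
    rintro x ⟨j, n, w, hw, rfl⟩
    exact h j n w hw
  exact this hw

variable {ρ W0}

lemma Ls_q (g : Gen M N true) (h0 : ∀ w ∈ W0, ρ (gi g) w ∈ W0)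
    (h : ∀ j n, ∃ (u : ℂ) (v : FA M N true), (∃ c : ℂ, ∃ m, v = c • gi (Gen.Xm j m)) ∧
      ρ (gi g * gi (Gen.Xm j n)) = u • ρ (gi (Gen.Xm j n) * gi g) + ρ v) :
    gi g ∈ Ls ρ W0 := by
  intro d
  induction d with
  | zero => exact h0
  | succ d ih =>
    apply Lf_succ_le
    intro j n w hw
    obtain ⟨u, v, ⟨c, m, rfl⟩, h⟩ := h j n
    have h1 := congrArg (fun T : Module.End ℂ W => T w) h
    simp only [map_mul, Module.End.mul_apply, LinearMap.add_apply, LinearMap.smul_apply, map_smul] at h1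
    rw [h1]
    exact add_mem (Submodule.smul_mem _ _ (Lf_Xm ρ W0 j n d _ (ih w hw)))
      (Submodule.smul_mem _ _ (Lf_Xm ρ W0 j m d _ hw))

lemma inv_q {R : Type} [Ring R] [Algebra ℂ R] (k ki x : R) (c : ℂ) (hc : c ≠ 0)
    (h1 : k * ki = 1) (h2 : ki * k = 1) (h : k * x = c • (x * k)) : ki * x = c⁻¹ • (x * ki) := by
  have h3 : ki * (k * x) * ki = ki * (c • (x * k)) * ki := by rw [h]
  rw [← mul_assoc ki k x, h2, one_mul, mul_smul_comm, smul_mul_assoc, ← mul_assoc ki x k,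
    mul_assoc (ki * x), h1, mul_one] at h3
  rw [h3, smul_smul, inv_mul_cancel₀ hc, one_smul]

/-- the Cartan type generators. -/
def isC : Gen M N true → Prop
  | .Xp _ _ => False
  | .Xm _ _ => False
  | _ => True

lemma Ls_gen (hq : q ≠ 0) (hρ : ∀ a b, rel q M N true 1 a b → ρ a = ρ b)
    (h0 : ∀ g, isC g → ∀ w ∈ W0, ρ (gi g) w ∈ W0) (g : Gen M N true) (hg : isC g) : gi g ∈ Ls ρ W0 := by
  apply Ls_q g (h0 g hg)
  intro j n
  cases g with
  | Xp i m => exact hg.elim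
  | Xm i m => exact hg.elim
  | K i =>
    refine ⟨q ^ (-cc M i.1 j.1), 0, ⟨0, 0, by rw [zero_smul]⟩, ?_⟩
    rw [hρ _ _ (rel.KXm i j n), map_zero, add_zero, map_smul]
  | K0 he =>
    refine ⟨q ^ (if j.1 = 1 then (-1 : ℤ) else 0), 0, ⟨0, 0, by rw [zero_smul]⟩, ?_⟩
    rw [hρ _ _ (rel.K0Xm he j n), map_zero, add_zero, map_smul]
  | Ki i =>
    refine ⟨(q ^ (-cc M i.1 j.1))⁻¹, 0, ⟨0, 0, by rw [zero_smul]⟩, ?_⟩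
    have h1 := hρ _ _ (rel.KKi i)
    have h2 := hρ _ _ (rel.KiK i)
    have h3 := hρ _ _ (rel.KXm i j n)
    rw [map_mul, map_one] at h1 h2
    rw [map_smul, map_mul, map_mul] at h3
    rw [map_mul, map_mul, map_zero, add_zero]
    exact inv_q _ _ _ _ (zpow_ne_zero _ hq) h1 h2 h3
  | K0i he =>
    refine ⟨(q ^ (if j.1 = 1 then (-1 : ℤ) else 0))⁻¹, 0, ⟨0, 0, by rw [zero_smul]⟩, ?_⟩
    have h1 := hρ _ _ (rel.K0K0i he)
    have h2 := hρ _ _ (rel.K0iK0 he)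
    have h3 := hρ _ _ (rel.K0Xm he j n)
    rw [map_mul, map_one] at h1 h2
    rw [map_smul, map_mul, map_mul] at h3
    rw [map_mul, map_mul, map_zero, add_zero]
    exact inv_q _ _ _ _ (zpow_ne_zero _ hq) h1 h2 h3
  | H i s =>
    refine ⟨1, _, ⟨-(qint (qpar q M i.1) (s.1 * lof M i.1 * cc M i.1 j.1) / (s.1 : ℂ)), n + s.1, rfl⟩, ?_⟩
    have h := hρ _ _ (rel.HXm i j s n)
    rw [map_sub, sub_eq_iff_eq_add] at h
    rw [h, one_smul, neg_smul, add_comm]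

lemma Ls_expC (S : Subalgebra ℂ (FA M N true)) (t : ℂ) (a : ℕ → FA M N true)
    (h : ∀ s, s ≠ 0 → a s ∈ S) (n : ℕ) : expC t a n ∈ S := by
  induction n using Nat.strong_induction_on with
  | _ n ih =>
    rcases n with _ | n
    · simp only [expC]; exact one_mem _
    · simp only [expC]
      apply S.smul_mem
      apply S.smul_mem
      apply sum_mem
      intro s hs
      apply S.smul_mem
      exact mul_mem (h _ (by omega)) (ih _ (by omega))

lemma phiP_mem (S : Subalgebra ℂ (FA M N true)) (hS : ∀ g, isC g → gi g ∈ S) (i : Idx M N) (n : ℤ) :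
    phiPF q M N true i.1 n ∈ S := by
  unfold phiPF
  split_ifs
  · rw [KF_of]
    refine mul_mem (hS _ trivial) (Ls_expC _ _ _ (fun s hs => ?_) _)
    rw [HF_of i _ (by exact_mod_cast hs)]
    exact hS _ trivial
  · exact zero_mem _

lemma phiM_mem (S : Subalgebra ℂ (FA M N true)) (hS : ∀ g, isC g → gi g ∈ S) (i : Idx M N) (n : ℤ) :
    phiMF q M N true i.1 n ∈ S := by
  unfold phiMF
  split_ifs
  · rw [KiF_of]
    refine mul_mem (hS _ trivial) (Ls_expC _ _ _ (fun s hs => ?_) _)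
    rw [HF_of i _ (by simpa using hs)]
    exact hS _ trivial
  · exact zero_mem _

lemma Lf_Xp (hq : q ≠ 0) (hρ : ∀ a b, rel q M N true 1 a b → ρ a = ρ b)
    (h0 : ∀ g, isC g → ∀ w ∈ W0, ρ (gi g) w ∈ W0)
    (hX : ∀ i m, ∀ w ∈ W0, ρ (gi (Gen.Xp i m)) w = 0) (i : Idx M N) (m : ℤ) : ∀ d, ∀ w ∈ Lf ρ W0 (d + 1), ρ (gi (Gen.Xp i m)) w ∈ Lf ρ W0 d := by
  intro d
  induction d with
  | zero =>
    apply Lf_succ_le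
    intro j n w hw
    have h := congrArg (fun T : Module.End ℂ W => T w) (hρ _ _ (rel.XpXm i j m n))
    simp only [map_mul, Module.End.mul_apply, LinearMap.sub_apply, LinearMap.smul_apply, map_smul,
      map_sub, hX i m w hw, map_zero, smul_zero, sub_zero] at h
    rw [h]
    by_cases hij : i = j
    · rw [if_pos hij]
      have : ((qpar q M i.1 - (qpar q M i.1)⁻¹)⁻¹ •
              (phiPF q M N true i.1 (m + n) - phiMF q M N true i.1 (m + n))) ∈ Ls ρ W0 :=
        Subalgebra.smul_mem _ (sub_mem (phiP_mem _ (Ls_gen hq hρ h0) i _) (phiM_mem _ (Ls_gen hq hρ h0) i _)) _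
      exact this 0 w hw
    · rw [if_neg hij, map_zero]; exact zero_mem _
  | succ d ih =>
    apply Lf_succ_le
    intro j n w hw
    have h := congrArg (fun T : Module.End ℂ W => T w) (hρ _ _ (rel.XpXm i j m n))
    simp only [map_mul, Module.End.mul_apply, LinearMap.sub_apply, LinearMap.smul_apply, map_smul,
      map_sub] at h
    rw [sub_eq_iff_eq_add] at h
    rw [h]
    refine add_mem ?_ (Submodule.smul_mem _ _ (Lf_Xm ρ W0 j n d _ (ih w hw)))
    by_cases hij : i = j
    · rw [if_pos hij]
      have : ((qpar q M i.1 - (qpar q M i.1)⁻¹)⁻¹ •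
              (phiPF q M N true i.1 (m + n) - phiMF q M N true i.1 (m + n))) ∈ Ls ρ W0 :=
        Subalgebra.smul_mem _ (sub_mem (phiP_mem _ (Ls_gen hq hρ h0) i _) (phiM_mem _ (Ls_gen hq hρ h0) i _)) _
      exact this _ w hw
    · rw [if_neg hij, map_zero]; exact zero_mem _

/-- the sum of all pieces is stable. -/
theorem Lf_stable (hq : q ≠ 0) (hρ : ∀ a b, rel q M N true 1 a b → ρ a = ρ b)
    (h0 : ∀ g, isC g → ∀ w ∈ W0, ρ (gi g) w ∈ W0)
    (hX : ∀ i m, ∀ w ∈ W0, ρ (gi (Gen.Xp i m)) w = 0) (t : FA M N true) : ∀ w ∈ (⨆ d, Lf ρ W0 d), ρ t w ∈ (⨆ d, Lf ρ W0 d) := by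
  induction t using FreeAlgebra.induction with
  | grade0 r =>
    intro w hw
    rw [AlgHom.commutes, Module.algebraMap_end_apply]
    exact Submodule.smul_mem _ _ hw
  | grade1 g =>
    have hle : (⨆ d, Lf ρ W0 d) ≤ (⨆ d, Lf ρ W0 d).comap (ρ (gi g)) := by
      apply iSup_le
      intro d w hw
      have hC : isC g → ρ (gi g) w ∈ (⨆ d, Lf ρ W0 d) := fun h =>
        (le_iSup (Lf ρ W0) d) (Ls_gen hq hρ h0 g h d w hw)
      cases g with
      | Xm j n => exact (le_iSup (Lf ρ W0) (d+1)) (Lf_Xm ρ W0 j n d w hw)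
      | Xp j n =>
        rcases d with _ | d
        · rw [Submodule.mem_comap]; rw [hX j n w hw]; exact zero_mem _
        · exact (le_iSup (Lf ρ W0) d) (Lf_Xp hq hρ h0 hX j n d w hw)
      | K i => exact hC trivial
      | Ki i => exact hC trivial
      | H i s => exact hC trivial
      | K0 h => exact hC trivial
      | K0i h => exact hC trivial
    exact hle
  | mul a b ha hb => intro w hw; rw [map_mul]; exact ha _ (hb w hw)
  | add a b ha hb => intro w hw; rw [map_add]; exact add_mem (ha w hw) (hb w hw)

end Tri
end QAS
end

noncomputable section
namespace QAS

section Fun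
variable (q : ℂ) {M N : ℕ} (w : WD M N)

/-- the vacuum. -/
def vac (M N : ℕ) : Smod M N := ⟨fun _ l => match l with
  | [] => 1
  | _ :: _ => 0, by
    intro A B f l
    rcases l with _ | ⟨y, l⟩
    · exact (map_one f).symm
    · exact (map_zero f).symm⟩

/-- complex numbers as coefficient algebra. -/
abbrev CC : CAlg := ⟨ℂ⟩

/-- the vacuum expectation value. -/
def ell : FA M N true →ₗ[ℂ] ℂ where
  toFun t := ev q w t (vac M N) CC []
  map_add' x y := ev_add q w x y _ _ _
  map_smul' c x := ev_smul q w c x _ _ _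

lemma ell_def (t : FA M N true) : ell q w t = ev q w t (vac M N) CC [] := rfl

lemma ell_one : ell q w (1 : FA M N true) = 1 := by
  rw [ell_def, ev_one]; rfl

lemma ell_Xm (j : Idx M N) (n : ℤ) (t : FA M N true) : ell q w (gi (Gen.Xm j n) * t) = 0 := by
  rw [ell_def, ev_mul, ev_Xm]; rfl

lemma ell_kill (s t : FA M N true) (h : ∀ A l, ev q w t (vac M N) A l = 0) : ell q w (s * t) = 0 := by
  have : rhoS q w t (vac M N) = 0 := by
    apply Subtype.ext; funext A l; exact h A l
  rw [ell_def, ev_mul, this]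
  unfold ev; rw [map_zero]; rfl

lemma Xp_vac (i : Idx M N) (m : ℤ) (A l) : ev q w (gi (Gen.Xp i m)) (vac M N) A l = 0 := by
  rw [ev_Xp]
  unfold xpv
  have : (vac M N).1 (LPA A) ((i, LT A) :: l.map (pm (LC A))) = 0 := rfl
  rw [this, mul_zero]
  simp [pr]

lemma ell_Xp (i : Idx M N) (m : ℤ) (t : FA M N true) : ell q w (t * gi (Gen.Xp i m)) = 0 :=
  ell_kill q w _ _ (Xp_vac q w i m)

variable {q w}

lemma Dg_vac {t : FA M N true} {d : Fam M N} (h : Dg q w t d) (hd : ∀ A, d A [] = 0) (A l) :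
    ev q w t (vac M N) A l = 0 := by
  rw [h.1]
  rcases l with _ | ⟨y, l⟩
  · rw [hd, zero_mul]
  · exact mul_zero _

/-- the Cartan type subalgebra -/
def T0 (M N : ℕ) : Subalgebra ℂ (FA M N true) := Algebra.adjoin ℂ {x | ∃ g, isC g ∧ x = gi g}

lemma T0_Dg (t : FA M N true) (ht : t ∈ T0 M N) : ∃ d, Dg q w t d := by
  unfold T0 at ht
  induction ht using Algebra.adjoin_induction with
  | mem x hx =>
    obtain ⟨g, hg, rfl⟩ := hx
    cases g with
    | Xp i m => exact hg.elim
    | Xm i m => exact hg.elim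
    | K i => exact ⟨_, Dg_K i⟩
    | Ki i => exact ⟨_, Dg_Ki i⟩
    | H i s => exact ⟨_, Dg_H i s⟩
    | K0 h => exact ⟨_, Dg_K0 h⟩
    | K0i h => exact ⟨_, Dg_K0i h⟩
  | algebraMap r => rw [Algebra.algebraMap_eq_smul_one]; exact ⟨_, Dg_smul r Dg_one⟩
  | add x y _ _ hx hy =>
    obtain ⟨d, hd⟩ := hx; obtain ⟨e, he⟩ := hy; exact ⟨_, Dg_add hd he⟩
  | mul x y _ _ hx hy =>
    obtain ⟨d, hd⟩ := hx; obtain ⟨e, he⟩ := hy; exact ⟨_, Dg_mul hd he⟩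

/-- the largest left ideal in the kernel of a functional. -/
def lker (δ : FA M N true →ₗ[ℂ] ℂ) : Submodule (FA M N true) (FA M N true) where
  carrier := {t | ∀ s, δ (s * t) = 0}
  add_mem' := by intro a b ha hb s; rw [mul_add, map_add, ha, hb, add_zero]
  zero_mem' := by intro s; rw [mul_zero, map_zero]
  smul_mem' := by intro c a ha s; rw [smul_eq_mul, ← mul_assoc]; exact ha _

/-- the quotient representation. -/
def qrep (J : Submodule (FA M N true) (FA M N true)) :
    FA M N true →ₐ[ℂ] Module.End ℂ (FA M N true ⧸ J) := Algebra.lsmul ℂ ℂ _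

lemma qrep_mk (J : Submodule (FA M N true) (FA M N true)) (s t : FA M N true) :
    qrep J s (Submodule.Quotient.mk t) = Submodule.Quotient.mk (s * t) := rfl

lemma qrep_eq (δ : FA M N true →ₗ[ℂ] ℂ) (a b : FA M N true)
    (h : ∀ s t, δ (s * (a - b) * t) = 0) : qrep (lker δ) a = qrep (lker δ) b := by
  apply LinearMap.ext; intro x
  obtain ⟨t, rfl⟩ := Submodule.Quotient.mk_surjective _ x
  rw [qrep_mk, qrep_mk, Submodule.Quotient.eq]
  intro s
  rw [← sub_mul, ← mul_assoc]; exact h s t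

lemma ell_rel (s t a b : FA M N true) (h : rhoS q w a = rhoS q w b) :
    ell q w (s * (a - b) * t) = 0 := by
  rw [mul_assoc]
  rw [ell_def, ev_mul, ← ev_def, map_mul]
  have : rhoS q w (a - b) = 0 := by rw [map_sub, h, sub_self]
  rw [this, zero_mul]
  rw [LinearMap.zero_apply, map_zero]; rfl

lemma tau_tau (t : FA M N true) : tau (tau t) = t := by
  induction t using FreeAlgebra.induction with
  | grade0 r => rw [Algebra.algebraMap_eq_smul_one, tau_smul, tau_smul, tau_one, tau_one]
  | grade1 g => 
    change tau (tau (gi g)) = gi g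
    rw [tau_gi, tau_gi]; cases g <;> rfl
  | mul a b ha hb => rw [tau_mul, tau_mul, ha, hb]
  | add a b ha hb => rw [tau_add, tau_add, ha, hb]

lemma killC {W : Type} [AddCommGroup W] [Module ℂ W]
    (ρ : FA M N true →ₐ[ℂ] Module.End ℂ W) (hq : q ≠ 0)
    (hρ : ∀ a b, rel q M N true 1 a b → ρ a = ρ b) (t : FA M N true) (ht : t ∈ T0 M N) :
    ∀ x : W, (∀ i m, ρ (gi (Gen.Xp i m)) x = 0) → ∀ i m, ρ (gi (Gen.Xp i m)) (ρ t x) = 0 := by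
  have hap : ∀ a b, rel q M N true 1 a b → ∀ x, ρ a x = ρ b x := by
    intro a b h x; rw [hρ a b h]
  have kinv : ∀ (k ki y : FA M N true) (c : ℂ) (x : W), c ≠ 0 → (∀ x, ρ (ki * k) x = ρ 1 x) →
      (∀ x, ρ (k * y) x = ρ (c • (y * k)) x) → ρ y x = 0 → ρ y (ρ k x) = 0 := by
    intro k ki y c x hc h1 h2 h3
    have h := h2 x
    rw [map_smul, map_mul, map_mul, LinearMap.smul_apply, Module.End.mul_apply, Module.End.mul_apply,
      h3, map_zero] at h
    exact ((smul_eq_zero.1 h.symm).resolve_left hc)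
  have kinv2 : ∀ (k ki y : FA M N true) (c : ℂ) (x : W), c ≠ 0 → (∀ x, ρ (ki * k) x = ρ 1 x) →
      (∀ x, ρ (k * ki) x = ρ 1 x) →
      (∀ x, ρ (k * y) x = ρ (c • (y * k)) x) → ρ y x = 0 → ρ y (ρ ki x) = 0 := by
    intro k ki y c x hc h1 h1' h2 h3
    have h := h2 (ρ ki x)
    have h4 := h1' x
    have h5 := h1 (ρ y (ρ ki x))
    rw [map_mul, map_one, Module.End.mul_apply, Module.End.one_apply] at h4 h5
    rw [map_smul, map_mul, map_mul, LinearMap.smul_apply, Module.End.mul_apply, Module.End.mul_apply,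
      h4, h3, smul_zero] at h
    rw [← h5, h, map_zero]
  unfold T0 at ht
  induction ht using Algebra.adjoin_induction with
  | mem x hx =>
    obtain ⟨g, hg, rfl⟩ := hx
    intro x hx i m
    cases g with
    | Xp i m => exact hg.elim
    | Xm i m => exact hg.elim
    | K j => exact kinv _ (gi (Gen.Ki j)) _ _ x (zpow_ne_zero _ hq) (hap _ _ (rel.KiK j)) (hap _ _ (rel.KXp j i m)) (hx i m)
    | Ki j => exact kinv2 (gi (Gen.K j)) _ _ _ x (zpow_ne_zero _ hq) (hap _ _ (rel.KiK j)) (hap _ _ (rel.KKi j)) (hap _ _ (rel.KXp j i m)) (hx i m)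
    | H j s =>
      have h := hap _ _ (rel.HXp j i s m) x
      rw [map_smul, map_sub, map_mul, map_mul, LinearMap.smul_apply, LinearMap.sub_apply, Module.End.mul_apply, Module.End.mul_apply,
        hx, hx, map_zero, smul_zero, zero_sub, neg_eq_zero] at h
      exact h
    | K0 he => exact kinv _ (gi (Gen.K0i he)) _ _ x (zpow_ne_zero _ hq) (hap _ _ (rel.K0iK0 he)) (hap _ _ (rel.K0Xp he i m)) (hx i m)
    | K0i he => exact kinv2 (gi (Gen.K0 he)) _ _ _ x (zpow_ne_zero _ hq) (hap _ _ (rel.K0iK0 he)) (hap _ _ (rel.K0K0i he)) (hap _ _ (rel.K0Xp he i m)) (hx i m)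
  | algebraMap r =>
    intro x hx i m
    rw [AlgHom.commutes, Module.algebraMap_end_apply, map_smul, hx, smul_zero]
  | add a b _ _ ha hb =>
    intro x hx i m
    rw [map_add, LinearMap.add_apply, map_add, ha x hx, hb x hx, add_zero]
  | mul a b _ _ ha hb =>
    intro x hx i m
    rw [map_mul, Module.End.mul_apply]
    exact ha _ (fun i m => hb x hx i m) i m

def tauL : FA M N true →ₗ[ℂ] FA M N true where
  toFun := tau
  map_add' := tau_add
  map_smul' := tau_smul

variable (q w) in
def dell : FA M N true →ₗ[ℂ] ℂ := ell q w - (ell q w).comp tauL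

lemma dell_def (t : FA M N true) : dell q w t = ell q w t - ell q w (tau t) := rfl

theorem ell_tau (hq : q ≠ 0) (hq2 : q ^ 2 ≠ 1) (t : FA M N true) : ell q w (tau t) = ell q w t := by
  have hrel : ∀ a b, rel q M N true 1 a b → qrep (lker (dell q w)) a = qrep (lker (dell q w)) b := by
    intro a b h
    obtain ⟨h1, h2⟩ := rel1_both (w := w) hq hq2 h
    apply qrep_eq
    intro s t
    rw [dell_def, ell_rel _ _ _ _ h1, tau_mul, tau_mul, tau_sub, ← mul_assoc, ell_rel _ _ _ _ h2, sub_zero]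
  let π : FA M N true →ₗ[ℂ] (FA M N true ⧸ lker (dell q w)) :=
    ((lker (dell q w)).mkQ).restrictScalars ℂ
  let W0 : Submodule ℂ (FA M N true ⧸ lker (dell q w)) := (Subalgebra.toSubmodule (T0 M N)).map π
  have h0 : ∀ g : Gen M N true, isC g → ∀ x ∈ W0, qrep (lker (dell q w)) (gi g) x ∈ W0 := by
    rintro g hg x ⟨t, ht, rfl⟩
    exact ⟨gi g * t, (T0 M N).mul_mem (Algebra.subset_adjoin ⟨g, hg, rfl⟩) ht, rfl⟩
  have hX : ∀ i m, ∀ x ∈ W0, qrep (lker (dell q w)) (gi (Gen.Xp i m)) x = 0 := by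
    rintro i m x ⟨t, ht, rfl⟩
    have h := killC (qrep (lker (dell q w))) hq hrel t ht (Submodule.Quotient.mk 1) (by
      intro i m
      rw [qrep_mk, mul_one, Submodule.Quotient.mk_eq_zero]
      intro s
      rw [dell_def, ell_Xp, tau_mul, tau_gi, tauG, ell_Xm, sub_zero]) i m
    rw [qrep_mk, mul_one] at h
    exact h
  have hst := Lf_stable hq hrel h0 hX t (π 1) ((le_iSup (Lf (qrep (lker (dell q w))) W0) 0)
    ⟨1, (T0 M N).one_mem, rfl⟩)
  have hπ : qrep (lker (dell q w)) t (π 1) = π t := by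
    change qrep (lker (dell q w)) t (Submodule.Quotient.mk 1) = Submodule.Quotient.mk t
    rw [qrep_mk, mul_one]
  rw [hπ] at hst
  have hker : ∀ s, π s = 0 → dell q w s = 0 := by
    intro s hs
    have : s ∈ lker (dell q w) := (Submodule.Quotient.mk_eq_zero _).1 hs
    have h2 := this 1
    rwa [one_mul] at h2
  let Z : Submodule ℂ (FA M N true ⧸ lker (dell q w)) := (LinearMap.ker (dell q w)).map π
  have hZ : ∀ s, π s ∈ Z → dell q w s = 0 := by
    rintro s ⟨r, hr, h⟩
    have h1 : π (s - r) = 0 := by rw [map_sub, h, sub_self]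
    have h2 := hker _ h1
    rw [map_sub, LinearMap.mem_ker.1 hr, sub_zero] at h2
    exact h2
  have hle : (⨆ d, Lf (qrep (lker (dell q w))) W0 d) ≤ Z := by
    apply iSup_le
    intro d
    rcases d with _ | d
    · rintro x ⟨t, ht, rfl⟩
      refine ⟨t, ?_, rfl⟩
      obtain ⟨d, hd⟩ := T0_Dg (q := q) (w := w) t ht
      rw [SetLike.mem_coe, LinearMap.mem_ker, dell_def, ell_def, ell_def, hd.1, hd.2, sub_self]
    · apply Submodule.span_le.2
      rintro x ⟨j, n, y, hy, rfl⟩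
      obtain ⟨s, rfl⟩ := Submodule.Quotient.mk_surjective _ y
      refine ⟨gi (Gen.Xm j n) * s, ?_, rfl⟩
      rw [SetLike.mem_coe, LinearMap.mem_ker, dell_def, ell_Xm, tau_mul, tau_gi, tauG, ell_Xp, sub_zero]
  have := hZ t (hle hst)
  rw [dell_def, sub_eq_zero] at this
  exact this.symm

/-- every defining relation is in the radical. -/
theorem ell_rel3 (hq : q ≠ 0) (hq2 : q ^ 2 ≠ 1) (s t : FA M N true) {a b : FA M N true}
    (h : rel q M N true 3 a b) : ell q w (s * (a - b) * t) = 0 := by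
  rcases rel3_or (w := w) hq hq2 h with h | h
  · exact ell_rel _ _ _ _ h
  · rw [← ell_tau hq hq2, tau_mul, tau_mul, tau_sub, ← mul_assoc, ell_rel _ _ _ _ h]

variable (q w) in
/-- the resulting representation of the algebra. -/
def arep (hq : q ≠ 0) (hq2 : q ^ 2 ≠ 1) :
    ALG q M N true 3 →ₐ[ℂ] Module.End ℂ (FA M N true ⧸ lker (ell q w)) :=
  RingQuot.liftAlgHom ℂ ⟨qrep (lker (ell q w)), fun _ _ h =>
    qrep_eq _ _ _ (fun s t => ell_rel3 hq hq2 s t h)⟩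

lemma arep_mk (hq : q ≠ 0) (hq2 : q ^ 2 ≠ 1) (t : FA M N true) :
    arep q w hq hq2 (mkA q M N true 3 t) (Submodule.Quotient.mk 1) = Submodule.Quotient.mk t := by
  unfold arep mkA
  rw [RingQuot.liftAlgHom_mkAlgHom_apply, qrep_mk, mul_one]

theorem one_not_mem (hq : q ≠ 0) (hq2 : q ^ 2 ≠ 1) (I : Ideal (ALG q M N true 3))
    (S : Set (ALG q M N true 3)) (hI : I = Ideal.span S)
    (h : ∀ x ∈ S, ∃ t, x = mkA q M N true 3 t ∧ ∀ A l, ev q w t (vac M N) A l = 0) : 1 ∉ I := by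
  have key : ∀ x ∈ I, arep q w hq hq2 x (Submodule.Quotient.mk 1) = 0 := by
    intro x hx
    rw [hI] at hx
    induction hx using Submodule.span_induction with
    | mem x hx =>
      obtain ⟨t, rfl, ht⟩ := h x hx
      rw [arep_mk, Submodule.Quotient.mk_eq_zero]
      intro s
      exact ell_kill q w s t ht
    | zero => rw [map_zero]; rfl
    | add x y _ _ hx hy => rw [map_add, LinearMap.add_apply, hx, hy, add_zero]
    | smul a x _ hx => rw [smul_eq_mul, map_mul, Module.End.mul_apply, hx, map_zero]
  intro h1
  have h2 := key 1 h1
  rw [← map_one (mkA q M N true 3), arep_mk, Submodule.Quotient.mk_eq_zero] at h2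
  have h3 := h2 1
  rw [one_mul, ell_one] at h3
  exact one_ne_zero h3

end Fun
end QAS
end

noncomputable section
namespace QAS

/-- logarithmic coefficients. -/
def logC (t : ℂ) (γ : ℕ → ℂ) : ℕ → ℂ
  | 0 => 0
  | n + 1 => ((n : ℂ) + 1)⁻¹ * (t⁻¹ * ((n : ℂ) + 1) * γ (n + 1) -
      ∑ s : Fin n, ((s.1 : ℂ) + 1) * (logC t γ (s.1 + 1) * γ (n - s.1)))
termination_by n => n
decreasing_by omega

lemma expC_logC (t : ℂ) (ht : t ≠ 0) (γ : ℕ → ℂ) (h0 : γ 0 = 1) (n : ℕ) :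
    expC t (logC t γ) n = γ n := by
  induction n using Nat.strong_induction_on with
  | _ n ih =>
    rcases n with _ | n
    · rw [expC, h0]
    · have hn : (n : ℂ) + 1 ≠ 0 := by exact_mod_cast Nat.succ_ne_zero n
      rw [expC, Finset.sum_range_succ, Nat.sub_self, expC, mul_one]
      have e : ∑ s ∈ Finset.range n, ((s : ℂ) + 1) • (logC t γ (s + 1) * expC t (logC t γ) (n - s)) =
          ∑ s : Fin n, ((s.1 : ℂ) + 1) * (logC t γ (s.1 + 1) * γ (n - s.1)) := by
        rw [Finset.sum_range]
        apply Finset.sum_congr rfl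
        intro s _
        rw [ih (n - s.1) (by omega), smul_eq_mul]
      rw [e]
      conv_lhs => rw [logC]
      simp only [smul_eq_mul]
      field_simp
      ring

lemma expC_congr {A : Type} [Ring A] [Algebra ℂ A] (t : ℂ) (a b : ℕ → A) (h : ∀ s, s ≠ 0 → a s = b s)
    (n : ℕ) : expC t a n = expC t b n := by
  induction n using Nat.strong_induction_on with
  | _ n ih =>
    rcases n with _ | n
    · rw [expC, expC]
    · rw [expC, expC]
      congr 2
      apply Finset.sum_congr rfl
      intro s _
      rw [h _ (Nat.succ_ne_zero s), ih _ (by omega)]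

section W
variable {q : ℂ} {M N : ℕ}

/-- the weight data with prescribed eigenvalues. -/
def mkWD (q : ℂ) (κ : Idx M N → ℂ) (hκ : ∀ i, κ i ≠ 0) (GP GM : Idx M N → ℕ → ℂ) : WD M N where
  kap := κ
  kap_ne := hκ
  eta i z := if 0 < z then logC (tt q M i.1) (fun n => GP i n / κ i) z.toNat
    else logC (-tt q M i.1) (fun n => GM i n * κ i) (-z).toNat

lemma mkWD_P (hq : q ≠ 0) (hq2 : q ^ 2 ≠ 1) (κ : Idx M N → ℂ) (hκ : ∀ i, κ i ≠ 0)
    (GP GM : Idx M N → ℕ → ℂ) (hP : ∀ i, GP i 0 = κ i) (i : Idx M N) (n : ℤ) (hn : 0 ≤ n) (A : CAlg) :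
    phiPev q (mkWD q κ hκ GP GM) i ([] : List (Pt M N A.carrier)) n = al (GP i n.toNat) := by
  unfold phiPev
  rw [if_pos hn]
  simp only [kev, hev, List.map_nil, List.prod_nil, List.sum_nil, mul_one, add_zero]
  have h2 := expC_map (Algebra.ofId ℂ A.carrier) (tt q M i.1) (fun s => (mkWD q κ hκ GP GM).eta i (s : ℤ)) n.toNat
  have h3 : expC (tt q M i.1) (fun s : ℕ => (mkWD q κ hκ GP GM).eta i (s : ℤ)) n.toNat = GP i n.toNat / κ i := by
    rw [expC_congr _ _ (logC (tt q M i.1) (fun n => GP i n / κ i)), expC_logC _ (tt_ne q hq hq2 _)]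
    · rw [hP, div_self (hκ i)]
    · intro s hs
      unfold mkWD
      simp only
      rw [if_pos (by omega)]; rfl
  rw [h3] at h2
  refine (congrArg (fun z => al (κ i) * z) h2.symm).trans ?_
  change (algebraMap ℂ A.carrier) (κ i) * (algebraMap ℂ A.carrier) (GP i n.toNat / κ i) = _
  rw [← map_mul, mul_div_cancel₀ _ (hκ i)]

lemma mkWD_M (hq : q ≠ 0) (hq2 : q ^ 2 ≠ 1) (κ : Idx M N → ℂ) (hκ : ∀ i, κ i ≠ 0)
    (GP GM : Idx M N → ℕ → ℂ) (hM : ∀ i, GM i 0 = (κ i)⁻¹) (i : Idx M N) (n : ℤ) (hn : n ≤ 0) (A : CAlg) :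
    phiMev q (mkWD q κ hκ GP GM) i ([] : List (Pt M N A.carrier)) n = al (GM i (-n).toNat) := by
  unfold phiMev
  rw [if_pos hn]
  simp only [kiev, hev, List.map_nil, List.prod_nil, List.sum_nil, mul_one, add_zero]
  have h2 := expC_map (Algebra.ofId ℂ A.carrier) (-tt q M i.1) (fun s => (mkWD q κ hκ GP GM).eta i (-(s : ℤ))) (-n).toNat
  have h3 : expC (-tt q M i.1) (fun s : ℕ => (mkWD q κ hκ GP GM).eta i (-(s : ℤ))) (-n).toNat = GM i (-n).toNat * κ i := by
    rw [expC_congr _ _ (logC (-tt q M i.1) (fun n => GM i n * κ i)), expC_logC _ (neg_ne_zero.2 (tt_ne q hq hq2 _))]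
    · rw [hM, inv_mul_cancel₀ (hκ i)]
    · intro s hs
      unfold mkWD
      simp only
      rw [if_neg (by omega), neg_neg]; rfl
  rw [h3] at h2
  refine (congrArg (fun z => al (κ i)⁻¹ * z) h2.symm).trans ?_
  change (algebraMap ℂ A.carrier) (κ i)⁻¹ * (algebraMap ℂ A.carrier) (GM i (-n).toNat * κ i) = _
  rw [← map_mul, mul_comm, mul_assoc, mul_inv_cancel₀ (hκ i), mul_one]

lemma qpar_ne (hq : q ≠ 0) (i : ℕ) : qpar q M i ≠ 0 := zpow_ne_zero _ hq

lemma pscale_coeff (u : ℂ) (P : Polynomial ℂ) (n : ℕ) : (pscale u P).coeff n = P.coeff n * u ^ n := by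
  unfold pscale
  exact Polynomial.comp_C_mul_X_coeff

lemma gammaP_zero (i : ℕ) (P : Polynomial ℂ) (hP : P.coeff 0 = 1) :
    gammaP q M i P 0 = qpar q M i ^ P.natDegree := by
  unfold gammaP
  rw [if_pos le_rfl, Int.toNat_zero, PowerSeries.coeff_zero_eq_constantCoeff_apply, map_mul,
    PowerSeries.constantCoeff_inv]
  have h : ∀ u, PowerSeries.constantCoeff (toPS (pscale u P)) = 1 := by
    intro u
    rw [← PowerSeries.coeff_zero_eq_constantCoeff_apply, toPS, PowerSeries.coeff_mk, pscale_coeff, hP]; simp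
  rw [h, h]; simp

lemma gammaM_zero (hq : q ≠ 0) (i : ℕ) (P : Polynomial ℂ) (hP : P.coeff 0 = 1) :
    gammaM q M i P 0 = (qpar q M i ^ P.natDegree)⁻¹ := by
  unfold gammaM
  rw [if_pos le_rfl, neg_zero, Int.toNat_zero, PowerSeries.coeff_zero_eq_constantCoeff_apply, map_mul,
    PowerSeries.constantCoeff_inv]
  have h : ∀ u, PowerSeries.constantCoeff (toPS ((pscale u P).reflect P.natDegree)) =
      P.leadingCoeff * u ^ P.natDegree := by
    intro u
    rw [← PowerSeries.coeff_zero_eq_constantCoeff_apply, toPS, PowerSeries.coeff_mk, Polynomial.coeff_reflect,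
      Polynomial.revAt_le (Nat.zero_le _), Nat.sub_zero, pscale_coeff]; rfl
  rw [h, h]
  have hl : P.leadingCoeff ≠ 0 := by
    rw [Polynomial.leadingCoeff_ne_zero]
    rintro rfl
    simp at hP
  have hu : qpar q M i ^ P.natDegree ≠ 0 := pow_ne_zero _ (qpar_ne hq i)
  rw [inv_pow]
  field_simp

/-- the weight data of a highest weight. -/
def wdκ (Λ : HW q M N) (i : Idx M N) : ℂ :=
  if i.1 = M then Λ.c else qpar q M i.1 ^ (Λ.P i.1).natDegree

def wdP (Λ : HW q M N) (i : Idx M N) (n : ℕ) : ℂ :=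
  if i.1 = M then (if n = 0 then Λ.c else (q - q⁻¹) * Λ.f n) else gammaP q M i.1 (Λ.P i.1) n

def wdM (Λ : HW q M N) (i : Idx M N) (n : ℕ) : ℂ :=
  if i.1 = M then (if n = 0 then Λ.c⁻¹ else -((q - q⁻¹) * Λ.f (-(n : ℤ)))) else gammaM q M i.1 (Λ.P i.1) (-(n : ℤ))

lemma wdκ_ne (hq : q ≠ 0) (Λ : HW q M N) (i : Idx M N) : wdκ Λ i ≠ 0 := by
  unfold wdκ
  split_ifs
  · exact Λ.c_ne
  · exact pow_ne_zero _ (qpar_ne hq _)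

theorem verma_nt (hq : q ≠ 0) (hq2 : q ^ 2 ≠ 1) (hM : 1 ≤ M) (hN : 1 ≤ N) (Λ : HW q M N) :
    1 ∉ vermaIdeal q M N true Λ := by
  let w : WD M N := mkWD q (wdκ Λ) (wdκ_ne hq Λ) (wdP Λ) (wdM Λ)
  have hP0 : ∀ i, wdP Λ i 0 = wdκ Λ i := by
    intro i
    unfold wdP wdκ
    by_cases h : i.1 = M
    · rw [if_pos h, if_pos h, if_pos rfl]
    · rw [if_neg h, if_neg h]; exact gammaP_zero _ _ (Λ.P_const _)
  have hM0 : ∀ i, wdM Λ i 0 = (wdκ Λ i)⁻¹ := by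
    intro i
    unfold wdM wdκ
    by_cases h : i.1 = M
    · rw [if_pos h, if_pos h, if_pos rfl]
    · rw [if_neg h, if_neg h, ← gammaM_zero hq _ _ (Λ.P_const _)]; rfl
  have hPn : ∀ i (n : ℤ), 0 ≤ n → ∀ A : CAlg, phiPev q w i ([] : List (Pt M N A.carrier)) n = al (wdP Λ i n.toNat) :=
    fun i n hn A => mkWD_P hq hq2 _ _ _ _ hP0 i n hn A
  have hMn : ∀ i (n : ℤ), n ≤ 0 → ∀ A : CAlg, phiMev q w i ([] : List (Pt M N A.carrier)) n = al (wdM Λ i (-n).toNat) :=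
    fun i n hn A => mkWD_M hq hq2 _ _ _ _ hM0 i n hn A
  have hPneg : ∀ i (n : ℤ), ¬ 0 ≤ n → ∀ A : CAlg, phiPev q w i ([] : List (Pt M N A.carrier)) n = 0 := by
    intro i n hn A; unfold phiPev; rw [if_neg hn]
  have hMneg : ∀ i (n : ℤ), ¬ n ≤ 0 → ∀ A : CAlg, phiMev q w i ([] : List (Pt M N A.carrier)) n = 0 := by
    intro i n hn A; unfold phiMev; rw [if_neg hn]
  have hsm : ∀ (c : ℂ) (A : CAlg), c • (1 : A.carrier) = al c := fun c A =>
    (Algebra.algebraMap_eq_smul_one c).symm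
  have hqq : q - q⁻¹ ≠ 0 := by
    intro h; apply hq2
    have : q = q⁻¹ := sub_eq_zero.mp h
    rw [pow_two]; nth_rewrite 1 [this]; exact inv_mul_cancel₀ hq
  have hMi : 1 ≤ M ∧ M ≤ M + N - 1 := by omega
  have hal0 : ∀ A : CAlg, (al 0 : A.carrier) = 0 := fun A => map_zero (algebraMap ℂ A.carrier)
  have haln : ∀ (A : CAlg) (x : ℂ), (al (-x) : A.carrier) = -al x := fun A x => map_neg (algebraMap ℂ A.carrier) x
  have hals : ∀ (A : CAlg) (x y : ℂ), (al (x - y) : A.carrier) = al x - al y :=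
    fun A x y => map_sub (algebraMap ℂ A.carrier) x y
  apply one_not_mem (w := w) hq hq2 _ _ rfl
  intro x hx
  rcases hx with (((⟨i, n, rfl⟩ | ⟨i, n, hi1, hi2, hi3, rfl | rfl⟩) | hx) | ⟨n, rfl⟩) | ⟨-, rfl⟩
  · refine ⟨_, rfl, ?_⟩
    unfold XpF
    split_ifs with h
    · exact Xp_vac q w _ n
    · intro A l; exact ev_zero _ _ _ _ _
  · refine ⟨phiPF q M N true i n - gammaP q M i (Λ.P i) n • 1, ?_, ?_⟩
    · rw [map_sub, map_smul, map_one, Algebra.algebraMap_eq_smul_one]; rfl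
    · refine Dg_vac (Dg_sub (Dg_phiP ⟨i, hi1, hi2⟩ n) (Dg_smul _ Dg_one)) ?_
      intro A
      rw [hsm]
      by_cases hn : 0 ≤ n
      · rw [hPn _ _ hn, wdP, if_neg hi3, Int.toNat_of_nonneg hn, sub_self]
      · rw [hPneg _ _ hn, gammaP, if_neg hn, hal0, sub_self]
  · refine ⟨phiMF q M N true i n - gammaM q M i (Λ.P i) n • 1, ?_, ?_⟩
    · rw [map_sub, map_smul, map_one, Algebra.algebraMap_eq_smul_one]; rfl
    · refine Dg_vac (Dg_sub (Dg_phiM ⟨i, hi1, hi2⟩ n) (Dg_smul _ Dg_one)) ?_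
      intro A
      rw [hsm]
      by_cases hn : n ≤ 0
      · rw [hMn _ _ hn, wdM, if_neg hi3, Int.toNat_of_nonneg (by omega), neg_neg, sub_self]
      · rw [hMneg _ _ hn, gammaM, if_neg hn, hal0, sub_self]
  · rw [Set.mem_ofPred_eq] at hx
    subst hx
    refine ⟨KF M N true M - Λ.c • 1, ?_, ?_⟩
    · rw [map_sub, map_smul, map_one, Algebra.algebraMap_eq_smul_one]; rfl
    · have e : KF M N true M = gi (Gen.K ⟨M, hMi⟩) := by unfold KF; rw [dif_pos hMi]
      rw [e]
      refine Dg_vac (Dg_sub (Dg_K _) (Dg_smul _ Dg_one)) ?_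
      intro A
      rw [hsm]
      simp only [kev, List.map_nil, List.prod_nil, mul_one]
      have : w.kap ⟨M, hMi⟩ = Λ.c := by
        show wdκ Λ _ = _
        unfold wdκ; rw [if_pos rfl]
      rw [this, sub_self]
  · refine ⟨phiPF q M N true M n - phiMF q M N true M n - ((q - q⁻¹) * Λ.f n) • 1, ?_, ?_⟩
    · rw [map_sub, map_sub, map_smul, map_one, Algebra.algebraMap_eq_smul_one]; rfl
    · refine Dg_vac (Dg_sub (Dg_sub (Dg_phiP ⟨M, hMi⟩ n) (Dg_phiM ⟨M, hMi⟩ n)) (Dg_smul _ Dg_one)) ?_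
      intro A
      rw [hsm]
      rcases lt_trichotomy n 0 with hn | hn | hn
      · rw [hPneg _ _ (by omega), hMn _ _ hn.le, wdM, if_pos rfl, if_neg (by omega), 
          Int.toNat_of_nonneg (by omega), neg_neg, haln]; ring
      · subst hn
        rw [hPn _ _ le_rfl, hMn _ _ le_rfl, Int.toNat_zero, neg_zero, Int.toNat_zero, hP0, hM0, wdκ, if_pos rfl, Λ.f_zero,
          mul_div_cancel₀ _ hqq, hals, sub_self]
      · rw [hMneg _ _ (by omega), hPn _ _ hn.le, wdP, if_pos rfl, if_neg (by omega), 
          Int.toNat_of_nonneg (by omega)]; ring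
  · refine ⟨K0F M N true - 1, ?_, ?_⟩
    · rw [map_sub, map_one]; rfl
    · have e : K0F M N true = gi (Gen.K0 rfl) := by unfold K0F; rw [dif_pos rfl]
      rw [e]
      refine Dg_vac (Dg_sub (Dg_K0 rfl) Dg_one) ?_
      intro A
      simp [k0ev]

end W
end QAS
end

noncomputable section
namespace QAS

section Sep
set_option linter.unusedSectionVars false

lemma rel_mono {q : ℂ} {M N : ℕ} {a b : FA M N true} (h : rel q M N true 1 a b) :
    rel q M N true 3 a b := by
  induction h with
  | KKi i => exact rel.KKi i
  | KiK i => exact rel.KiK i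
  | KK i j => exact rel.KK i j
  | KKi2 i j => exact rel.KKi2 i j
  | KiKi i j => exact rel.KiKi i j
  | KH i j s => exact rel.KH i j s
  | KiH i j s => exact rel.KiH i j s
  | HH i j s t => exact rel.HH i j s t
  | KXp i j n => exact rel.KXp i j n
  | KXm i j n => exact rel.KXm i j n
  | HXp i j s n => exact rel.HXp i j s n
  | HXm i j s n => exact rel.HXm i j s n
  | XpXm i j m n => exact rel.XpXm i j m n
  | K0K0i he => exact rel.K0K0i he
  | K0iK0 he => exact rel.K0iK0 he
  | K0K he i => exact rel.K0K he i
  | K0Ki he i => exact rel.K0Ki he i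
  | K0H he i s => exact rel.K0H he i s
  | K0Xp he i n => exact rel.K0Xp he i n
  | K0Xm he i n => exact rel.K0Xm he i n
  | _ => omega

/-- interpolation: a subspace stable under `T` contains all reweightings of its elements. -/
lemma interp {W : Type} [AddCommGroup W] [Module ℂ W] (T : Module.End ℂ W) (c : ℕ → ℂ)
    (hc : Function.Injective c) (p : Submodule ℂ W) (hp : ∀ w ∈ p, T w ∈ p) (f : ℕ →₀ W)
    (hf : ∀ d, T (f d) = c d • f d) (h : (f.sum fun _ x => x) ∈ p) (k : ℕ → ℂ) :
    (f.sum fun d x => k d • x) ∈ p := by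
  classical
  set g := Lagrange.interpolate f.support c k with hg
  have hev : ∀ d ∈ f.support, g.eval (c d) = k d := fun d hd =>
    Lagrange.eval_interpolate_at_node k (hc.injOn) hd
  have hpow : ∀ (n : ℕ), ∀ w ∈ p, (T ^ n) w ∈ p := by
    intro n
    induction n with
    | zero => intro w hw; simpa using hw
    | succ n ih => intro w hw; rw [pow_succ, Module.End.mul_apply]; exact ih _ (hp w hw)
  have hpg : ∀ w ∈ p, (Polynomial.aeval T g) w ∈ p := by
    intro w hw
    rw [Polynomial.aeval_eq_sum_range, LinearMap.sum_apply]
    refine Submodule.sum_mem _ fun i _ => ?_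
    rw [LinearMap.smul_apply]
    exact Submodule.smul_mem _ _ (hpow i w hw)
  have key : (Polynomial.aeval T g) (f.sum fun _ x => x) = f.sum fun d x => k d • x := by
    unfold Finsupp.sum
    rw [map_sum]
    refine Finset.sum_congr rfl fun d hd => ?_
    have hT : ∀ n : ℕ, (T ^ n) (f d) = (c d) ^ n • f d := by
      intro n
      induction n with
      | zero => simp
      | succ n ih => rw [pow_succ, Module.End.mul_apply, hf, map_smul, ih, smul_smul, pow_succ, mul_comm]
    show (Polynomial.aeval T g) (f d) = k d • f d
    rw [Polynomial.aeval_eq_sum_range, LinearMap.sum_apply, ← hev d hd, Polynomial.eval_eq_sum_range,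
      Finset.sum_smul]
    refine Finset.sum_congr rfl fun i _ => ?_
    rw [LinearMap.smul_apply, hT, smul_smul]
  rw [← key]; exact hpg _ h

/-- the exponents of the separating element. -/
def eexp (t : ℕ → ℤ) (j : ℕ) : ℤ := -∑ k ∈ Finset.range j, t k
def bexp (M N : ℕ) (t : ℕ → ℤ) : ℤ := -∑ j ∈ Finset.range (M + N), lof M (j + 1) * eexp t (j + 1)
def nexp (M N : ℕ) (t : ℕ → ℤ) (i : ℕ) : ℤ :=
  ∑ j ∈ Finset.range i, lof M (j + 1) * (bexp M N t + ((M : ℤ) - N) * eexp t (j + 1))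

lemma lof_sq (M i : ℕ) : lof M i * lof M i = 1 := by unfold lof; split_ifs <;> rfl

lemma sum_lof (M N : ℕ) : ∑ j ∈ Finset.range (M + N), lof M (j + 1) = (M : ℤ) - N := by
  rw [Finset.sum_range_add]
  have h1 : ∑ x ∈ Finset.range M, lof M (x + 1) = M := by
    rw [Finset.sum_congr rfl (g := fun _ => (1 : ℤ))]
    · simp
    · intro x hx; rw [Finset.mem_range] at hx; unfold lof; rw [if_pos (by omega)]
  have h2 : ∑ x ∈ Finset.range N, lof M (M + x + 1) = -N := by
    rw [Finset.sum_congr rfl (g := fun _ => (-1 : ℤ))]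
    · simp
    · intro x hx; unfold lof; rw [if_neg (by omega)]
  rw [h1, h2]; ring

lemma nexp_last (M N : ℕ) (t : ℕ → ℤ) : nexp M N t (M + N) = 0 := by
  unfold nexp
  simp only [mul_add, Finset.sum_add_distrib]
  rw [← Finset.sum_mul, sum_lof]
  have : ∑ x ∈ Finset.range (M + N), lof M (x + 1) * (((M : ℤ) - N) * eexp t (x + 1)) = ((M : ℤ) - N) * (-bexp M N t) := by
    unfold bexp
    rw [neg_neg, Finset.mul_sum]
    refine Finset.sum_congr rfl fun x _ => by ring
  rw [this]; ring

lemma nexp_sum (M N : ℕ) (t : ℕ → ℤ) (j : Idx M N) :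
    ∑ i ∈ Finset.range (M + N - 1), nexp M N t (i + 1) * cc M (i + 1) j.1 = ((M : ℤ) - N) * t j.1 := by
  obtain ⟨j, h1, h2⟩ := j
  obtain ⟨r, hr⟩ : ∃ r, M + N = r + 1 := ⟨M + N - 1, by omega⟩
  obtain ⟨a, rfl⟩ : ∃ a, j = a + 1 := ⟨j - 1, by omega⟩
  have hr' : M + N - 1 = r := by omega
  simp only [hr']
  have hz : nexp M N t (r + 1) = 0 := by rw [← hr]; exact nexp_last M N t
  have h0 : nexp M N t 0 = 0 := rfl
  have hs : ∀ i, nexp M N t (i + 1) = nexp M N t i + lof M (i + 1) * (bexp M N t + ((M : ℤ) - N) * eexp t (i + 1)) := by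
    intro i; unfold nexp; rw [Finset.sum_range_succ]
  have he : eexp t (a + 2) = eexp t (a + 1) - t (a + 1) := by
    unfold eexp; rw [Finset.sum_range_succ _ (a + 1)]; ring
  have har : a < r := by omega
  have hA : ∀ i, nexp M N t (i + 1) * cc M (i + 1) (a + 1) =
      (if i = a then nexp M N t (i + 1) * (lof M (a + 1) + lof M (a + 2)) else 0)
       - (if i = a + 1 then nexp M N t (i + 1) * lof M (a + 2) else 0)
       - (if i + 1 = a then nexp M N t (i + 1) * lof M (a + 1) else 0) := by
    intro i
    unfold cc form4 innerE
    by_cases e1 : i = a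
    · subst e1; simp
    · by_cases e2 : i = a + 1
      · subst e2; rw [if_neg (by omega), if_pos rfl, if_neg (by omega), if_neg (by omega), if_pos rfl, if_neg (by omega), if_neg (by omega)]; ring
      · by_cases e3 : i + 1 = a
        · subst e3; rw [if_neg (by omega), if_neg (by omega), if_pos rfl, if_neg (by omega), if_neg (by omega), if_pos rfl, if_neg (by omega)]; ring
        · rw [if_neg e1, if_neg e2, if_neg e3, if_neg (by omega), if_neg (by omega), if_neg (by omega), if_neg (by omega)]; ring
  rw [Finset.sum_congr rfl (fun i _ => hA i), Finset.sum_sub_distrib, Finset.sum_sub_distrib,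
    Finset.sum_ite_eq', Finset.sum_ite_eq', if_pos (Finset.mem_range.2 har)]
  have hB : ∑ x ∈ Finset.range r, (if x + 1 = a then nexp M N t (x + 1) * lof M (a + 1) else 0) = nexp M N t a * lof M (a + 1) := by
    rcases a with _ | a
    · rw [h0, zero_mul]; exact Finset.sum_eq_zero fun x _ => if_neg (by omega)
    · simp only [Nat.add_right_cancel_iff]
      rw [Finset.sum_ite_eq', if_pos (Finset.mem_range.2 (by omega))]
  have hC : (if a + 1 ∈ Finset.range r then nexp M N t (a + 1 + 1) * lof M (a + 2) else 0) = nexp M N t (a + 2) * lof M (a + 2) := by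
    split_ifs with h
    · rfl
    · have : a + 2 = r + 1 := by rw [Finset.mem_range] at h; omega
      rw [this, hz, zero_mul]
  rw [hB, hC, hs (a + 1), hs a, he]
  have q1 := lof_sq M (a + 1)
  have q2 := lof_sq M (a + 2)
  linear_combination (bexp M N t + ((M : ℤ) - N) * eexp t (a + 1)) * q1 -
    (bexp M N t + ((M : ℤ) - N) * (eexp t (a + 1) - t (a + 1))) * q2

variable {A : Type} [Ring A] [Algebra ℂ A]

/-- the separating element. -/
def kapE (u : ℕ → Aˣ) (n : ℕ → ℤ) : ℕ → Aˣ
  | 0 => 1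
  | r + 1 => u (r + 1) ^ n (r + 1) * kapE u n r

lemma zpow_q (q : ℂ) (hq : q ≠ 0) (u : Aˣ) (x : A) (c : ℤ) (h : (u : A) * x = q ^ c • (x * u)) (n : ℤ) :
    ((u ^ n : Aˣ) : A) * x = q ^ (n * c) • (x * ((u ^ n : Aˣ) : A)) := by
  have hi : ((u⁻¹ : Aˣ) : A) * x = q ^ (-c) • (x * ((u⁻¹ : Aˣ) : A)) := by
    have h2 : x * ((u⁻¹ : Aˣ) : A) = q ^ c • (((u⁻¹ : Aˣ) : A) * x) := by
      calc x * ((u⁻¹ : Aˣ) : A) = ((u⁻¹ : Aˣ) : A) * ((u : A) * x) * ((u⁻¹ : Aˣ) : A) := by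
            rw [← mul_assoc, Units.inv_mul, one_mul]
        _ = _ := by rw [h, mul_smul_comm, smul_mul_assoc, mul_assoc, mul_assoc, Units.mul_inv, mul_one]
    rw [h2, smul_smul, ← zpow_add₀ hq, neg_add_cancel, zpow_zero, one_smul]
  induction n with
  | zero => simp
  | succ n ih =>
    rw [zpow_add_one, Units.val_mul, mul_assoc, h, mul_smul_comm, ← mul_assoc, ih, smul_mul_assoc, smul_smul,
      ← zpow_add₀ hq, mul_assoc]
    congr 2; ring
  | pred n ih =>
    rw [zpow_sub_one, Units.val_mul, mul_assoc, hi, mul_smul_comm, ← mul_assoc, ih, smul_mul_assoc, smul_smul,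
      ← zpow_add₀ hq, mul_assoc]
    congr 2; ring

lemma kapE_q (q : ℂ) (hq : q ≠ 0) (u : ℕ → Aˣ) (n : ℕ → ℤ) (x : A) (c : ℕ → ℤ) (r : ℕ)
    (h : ∀ i < r, (u (i + 1) : A) * x = q ^ c (i + 1) • (x * u (i + 1))) :
    ((kapE u n r : Aˣ) : A) * x = q ^ (∑ i ∈ Finset.range r, n (i + 1) * c (i + 1)) • (x * (kapE u n r : Aˣ)) := by
  induction r with
  | zero => simp [kapE]
  | succ r ih =>
    have ih := ih fun i hi => h i (by omega)
    rw [kapE, Units.val_mul, mul_assoc, ih, mul_smul_comm, ← mul_assoc, zpow_q q hq _ _ _ (h r (by omega)),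
      smul_mul_assoc, smul_smul, ← zpow_add₀ hq, mul_assoc, Finset.sum_range_succ]

lemma zpow_stab {W : Type} [AddCommGroup W] [Module ℂ W] [Module A W] (u : Aˣ) (p : Submodule ℂ W)
    (h : ∀ w ∈ p, (u : A) • w ∈ p) (hi : ∀ w ∈ p, ((u⁻¹ : Aˣ) : A) • w ∈ p) (n : ℤ) :
    ∀ w ∈ p, ((u ^ n : Aˣ) : A) • w ∈ p := by
  induction n with
  | zero => intro w hw; simpa using hw
  | succ n ih => intro w hw; rw [zpow_add_one, Units.val_mul, mul_smul]; exact ih _ (h w hw)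
  | pred n ih => intro w hw; rw [zpow_sub_one, Units.val_mul, mul_smul]; exact ih _ (hi w hw)

lemma kapE_stab {W : Type} [AddCommGroup W] [Module ℂ W] [Module A W] (u : ℕ → Aˣ) (n : ℕ → ℤ) (r : ℕ)
    (p : Submodule ℂ W)
    (h : ∀ i, ∀ w ∈ p, (u i : A) • w ∈ p) (hi : ∀ i, ∀ w ∈ p, (((u i)⁻¹ : Aˣ) : A) • w ∈ p) :
    ∀ w ∈ p, ((kapE u n r : Aˣ) : A) • w ∈ p := by
  induction r with
  | zero => intro w hw; simpa [kapE] using hw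
  | succ r ih =>
    intro w hw
    rw [kapE, Units.val_mul, mul_smul]
    exact zpow_stab _ p (h _) (hi _) _ _ (ih w hw)

/-- if the coefficients of the exponential act by scalars, so do the coefficients of the exponent. -/
lemma expC_line {W : Type} [AddCommGroup W] [Module ℂ W] [Module A W] [IsScalarTower ℂ A W] (t : ℂ) (ht : t ≠ 0)
    (a : ℕ → A) (p : Submodule ℂ W)
    (h : ∀ n, ∀ w ∈ p, expC t a n • w ∈ p) (n : ℕ) : ∀ w ∈ p, a (n + 1) • w ∈ p := by
  induction n using Nat.strong_induction_on with
  | _ n ih =>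
    intro w hw
    have h1 := h (n + 1) w hw
    rw [expC] at h1
    have hn : ((n : ℂ) + 1) ≠ 0 := by exact_mod_cast Nat.succ_ne_zero n
    rw [smul_assoc, Submodule.smul_mem_iff _ (inv_ne_zero hn), smul_assoc, Submodule.smul_mem_iff _ ht,
      Finset.sum_range_succ, add_smul, Nat.sub_self, expC, mul_one, Finset.sum_smul] at h1
    have h2 : ∑ i ∈ Finset.range n, (((i : ℂ) + 1) • (a (i + 1) * expC t a (n - i))) • w ∈ p := by
      refine Submodule.sum_mem _ fun i hi => ?_
      rw [smul_assoc, mul_smul]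
      exact Submodule.smul_mem _ _ (ih i (Finset.mem_range.1 hi) _ (h _ _ hw))
    have h3 := (Submodule.add_mem_iff_right _ h2).1 h1
    rwa [smul_assoc, Submodule.smul_mem_iff _ hn] at h3

end Sep
end QAS
end

noncomputable section
namespace QAS

section Fin
variable {q : ℂ} {M N : ℕ}

/-- the action on a module, seen from the free algebra. -/
def rhoV (q : ℂ) (M N : ℕ) (Λ : HW q M N) : FA M N true →ₐ[ℂ] Module.End ℂ (VermaMod q M N true Λ) :=
  (Algebra.lsmul ℂ ℂ (VermaMod q M N true Λ) : ALG q M N true 3 →ₐ[ℂ] _).comp (mkA q M N true 3)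

lemma rhoV_apply (Λ : HW q M N) (t : FA M N true) (w : VermaMod q M N true Λ) :
    rhoV q M N Λ t w = mkA q M N true 3 t • w := rfl

lemma mkA_rel {a b : FA M N true} (h : rel q M N true 3 a b) : mkA q M N true 3 a = mkA q M N true 3 b :=
  RingQuot.mkAlgHom_rel ℂ h

lemma mkA_surj (x : ALG q M N true 3) : ∃ t, mkA q M N true 3 t = x :=
  RingQuot.mkAlgHom_surjective ℂ _ x

lemma rhoV_rel (Λ : HW q M N) (a b : FA M N true) (h : rel q M N true 1 a b) :
    rhoV q M N Λ a = rhoV q M N Λ b := by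
  unfold rhoV
  rw [AlgHom.comp_apply, AlgHom.comp_apply, mkA_rel (rel_mono h)]

lemma smul_vgen (Λ : HW q M N) (x : ALG q M N true 3) (h : x ∈ vermaRels q M N true Λ) :
    x • vgen q M N Λ = 0 := by
  have h1 : x • vgen q M N Λ = (Submodule.Quotient.mk (x * 1) : ALG q M N true 3 ⧸ vermaIdeal q M N true Λ) := rfl
  rw [h1, mul_one]
  exact (Submodule.Quotient.mk_eq_zero _).2 (Ideal.subset_span h)

lemma vgen_gen (Λ : HW q M N) (w : VermaMod q M N true Λ) : ∃ x : ALG q M N true 3, w = x • vgen q M N Λ := by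
  obtain ⟨x, hx⟩ := Submodule.Quotient.mk_surjective (vermaIdeal q M N true Λ) w
  refine ⟨x, ?_⟩
  have h1 : x • vgen q M N Λ = (Submodule.Quotient.mk (x * 1) : ALG q M N true 3 ⧸ vermaIdeal q M N true Λ) := rfl
  rw [h1, mul_one]; exact hx.symm

lemma vgen_ne (hq : q ≠ 0) (hq2 : q ^ 2 ≠ 1) (hM : 1 ≤ M) (hN : 1 ≤ N) (Λ : HW q M N) : vgen q M N Λ ≠ 0 := by
  intro h
  exact verma_nt hq hq2 hM hN Λ ((Submodule.Quotient.mk_eq_zero _).1 h)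

/-- the line of the highest weight vector. -/
def lineV (q : ℂ) (M N : ℕ) (Λ : HW q M N) : Submodule ℂ (VermaMod q M N true Λ) :=
  Submodule.span ℂ {vgen q M N Λ}

lemma smulC {W : Type} [AddCommGroup W] [Module ℂ W] [Module (ALG q M N true 3) W]
    [IsScalarTower ℂ (ALG q M N true 3) W] (x : ALG q M N true 3) (c : ℂ) (w : W) :
    x • (c • w) = c • (x • w) := by
  rw [← algebraMap_smul (ALG q M N true 3) c w, ← mul_smul, ← Algebra.commutes, mul_smul, algebraMap_smul]

lemma line_of (Λ : HW q M N) (x : ALG q M N true 3) (h : x • vgen q M N Λ ∈ lineV q M N Λ) :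
    ∀ w ∈ lineV q M N Λ, x • w ∈ lineV q M N Λ := by
  intro w hw
  obtain ⟨c, rfl⟩ := Submodule.mem_span_singleton.1 hw
  rw [smulC]; exact Submodule.smul_mem _ _ h

lemma line_sub (Λ : HW q M N) (x : ALG q M N true 3) (c : ℂ)
    (h : x - algebraMap ℂ _ c ∈ vermaRels q M N true Λ) : ∀ w ∈ lineV q M N Λ, x • w ∈ lineV q M N Λ := by
  apply line_of
  have := smul_vgen Λ _ h
  rw [sub_smul, sub_eq_zero, algebraMap_smul] at this
  rw [this]; exact Submodule.smul_mem _ _ (Submodule.mem_span_singleton_self _)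

lemma line_inv (Λ : HW q M N) (x y : ALG q M N true 3) (hxy : y * x = 1)
    (h : ∀ w ∈ lineV q M N Λ, x • w ∈ lineV q M N Λ) : ∀ w ∈ lineV q M N Λ, y • w ∈ lineV q M N Λ := by
  apply line_of
  obtain ⟨c, hc⟩ := Submodule.mem_span_singleton.1 (h _ (Submodule.mem_span_singleton_self _))
  have h1 : vgen q M N Λ = c • (y • vgen q M N Λ) := by
    rw [← smulC, hc, ← mul_smul, hxy, one_smul]
  by_cases h0 : c = 0
  · rw [h0, zero_smul] at h1
    rw [h1, smul_zero]; exact zero_mem _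
  · have : c • (y • vgen q M N Λ) ∈ lineV q M N Λ := by
      rw [← h1]; exact Submodule.mem_span_singleton_self _
    exact (Submodule.smul_mem_iff _ h0).1 this

lemma expC_hom {A B : Type} [Ring A] [Algebra ℂ A] [Ring B] [Algebra ℂ B] (F : A →ₐ[ℂ] B) (t : ℂ) (a : ℕ → A) (n : ℕ) :
    F (expC t a n) = expC t (fun s => F (a s)) n := by
  induction n using Nat.strong_induction_on with
  | _ n ih =>
    rcases n with _ | n
    · simp only [expC, map_one]
    · simp only [expC, map_smul, map_sum, map_mul]
      congr 2
      refine Finset.sum_congr rfl fun s _ => ?_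
      rw [ih _ (by omega)]

lemma line_H (Λ : HW q M N) (t : ℂ) (ht : t ≠ 0) (k ki : FA M N true) (a : ℕ → FA M N true)
    (h1 : mkA q M N true 3 ki * mkA q M N true 3 k = 1)
    (hki : ∀ w ∈ lineV q M N Λ, mkA q M N true 3 ki • w ∈ lineV q M N Λ)
    (h : ∀ n, ∀ w ∈ lineV q M N Λ, mkA q M N true 3 (k * expC t a n) • w ∈ lineV q M N Λ) (n : ℕ) :
    ∀ w ∈ lineV q M N Λ, mkA q M N true 3 (a (n + 1)) • w ∈ lineV q M N Λ := by
  refine expC_line t ht (fun s => mkA q M N true 3 (a s)) _ ?_ n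
  intro n w hw
  have h2 := hki _ (h n w hw)
  rw [map_mul, ← mul_smul, ← mul_assoc, h1, one_mul, expC_hom] at h2
  exact h2

lemma line_zero (Λ : HW q M N) (x : ALG q M N true 3) (h : x = 0) :
    ∀ w ∈ lineV q M N Λ, x • w ∈ lineV q M N Λ := by
  intro w _; rw [h, zero_smul]; exact zero_mem _

lemma qpar_sub_ne (hq : q ≠ 0) (hq2 : q ^ 2 ≠ 1) (i : ℕ) : qpar q M i - (qpar q M i)⁻¹ ≠ 0 := by
  have hqq : q - q⁻¹ ≠ 0 := by
    intro h; apply hq2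
    have : q = q⁻¹ := sub_eq_zero.mp h
    rw [pow_two]; nth_rewrite 1 [this]; exact inv_mul_cancel₀ hq
  unfold qpar lof
  split_ifs
  · simpa using hqq
  · rw [zpow_neg_one, inv_inv]; intro h; apply hqq; rw [← neg_sub, h, neg_zero]

lemma line_C (hq : q ≠ 0) (hq2 : q ^ 2 ≠ 1) (hM : 1 ≤ M) (hN : 1 ≤ N) (Λ : HW q M N) (g : Gen M N true)
    (hg : isC g) : ∀ w ∈ lineV q M N Λ, mkA q M N true 3 (gi g) • w ∈ lineV q M N Λ := by
  have hMi : 1 ≤ M ∧ M ≤ M + N - 1 := by omega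
  have hKi1 : ∀ i, mkA q M N true 3 (gi (Gen.Ki i)) * mkA q M N true 3 (gi (Gen.K i)) = 1 := by
    intro i; rw [← map_mul, mkA_rel (rel.KiK i), map_one]
  have hKi2 : ∀ i, mkA q M N true 3 (gi (Gen.K i)) * mkA q M N true 3 (gi (Gen.Ki i)) = 1 := by
    intro i; rw [← map_mul, mkA_rel (rel.KKi i), map_one]
  have hP0 : ∀ i : Idx M N, phiPF q M N true i.1 0 = gi (Gen.K i) := by
    intro i; unfold phiPF; rw [if_pos le_rfl, KF_of, Int.toNat_zero, expC, mul_one]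
  have hM0 : ∀ i : Idx M N, phiMF q M N true i.1 0 = gi (Gen.Ki i) := by
    intro i; unfold phiMF; rw [if_pos le_rfl, KiF_of, neg_zero, Int.toNat_zero, expC, mul_one]
  have hPhi : ∀ i : Idx M N, i.1 ≠ M → ∀ n, (∀ w ∈ lineV q M N Λ, mkA q M N true 3 (phiPF q M N true i.1 n) • w ∈ lineV q M N Λ) ∧
      (∀ w ∈ lineV q M N Λ, mkA q M N true 3 (phiMF q M N true i.1 n) • w ∈ lineV q M N Λ) := by
    intro i hi n
    refine ⟨line_sub Λ _ (gammaP q M i.1 (Λ.P i.1) n) ?_, line_sub Λ _ (gammaM q M i.1 (Λ.P i.1) n) ?_⟩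
    · exact Or.inl (Or.inl (Or.inl (Or.inr ⟨i.1, n, i.2.1, i.2.2, hi, Or.inl rfl⟩)))
    · exact Or.inl (Or.inl (Or.inl (Or.inr ⟨i.1, n, i.2.1, i.2.2, hi, Or.inr rfl⟩)))
  have hK : ∀ i, ∀ w ∈ lineV q M N Λ, mkA q M N true 3 (gi (Gen.K i)) • w ∈ lineV q M N Λ := by
    intro i
    by_cases hi : i.1 = M
    · obtain ⟨j, hj⟩ := i
      have hi : j = M := hi
      subst hi
      refine line_sub Λ _ Λ.c ?_
      refine Or.inl (Or.inl (Or.inr ?_))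
      show mkA q j N true 3 (gi (Gen.K ⟨j, hj⟩)) - _ = mkA q j N true 3 (KF j N true j) - _
      rw [KF_of ⟨j, hj⟩]
    · have := (hPhi i hi 0).1
      rwa [hP0] at this
  have hKi : ∀ i, ∀ w ∈ lineV q M N Λ, mkA q M N true 3 (gi (Gen.Ki i)) • w ∈ lineV q M N Λ :=
    fun i => line_inv Λ _ _ (hKi1 i) (hK i)
  have hK0 : ∀ he, ∀ w ∈ lineV q M N Λ, mkA q M N true 3 (gi (Gen.K0 he)) • w ∈ lineV q M N Λ := by
    intro he
    refine line_sub Λ _ 1 ?_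
    refine Or.inr ⟨rfl, ?_⟩
    rw [map_one]; rfl
  have hPP : ∀ i : Idx M N, ∀ n, (∀ w ∈ lineV q M N Λ, mkA q M N true 3 (phiPF q M N true i.1 n) • w ∈ lineV q M N Λ) ∧
      (∀ w ∈ lineV q M N Λ, mkA q M N true 3 (phiMF q M N true i.1 n) • w ∈ lineV q M N Λ) := by
    intro i n
    by_cases hi : i.1 = M
    · have hd : ∀ w ∈ lineV q M N Λ, (mkA q M N true 3 (phiPF q M N true i.1 n) - mkA q M N true 3 (phiMF q M N true i.1 n)) • w ∈ lineV q M N Λ := by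
        refine line_sub Λ _ ((q - q⁻¹) * Λ.f n) ?_
        rw [hi]
        exact Or.inl (Or.inr ⟨n, rfl⟩)
      rcases lt_trichotomy n 0 with hn | hn | hn
      · have hz : phiPF q M N true i.1 n = 0 := by unfold phiPF; rw [if_neg (by omega)]
        refine ⟨line_zero _ _ (by rw [hz, map_zero]), fun w hw => ?_⟩
        have := hd w hw
        rw [hz, map_zero, zero_sub, neg_smul] at this
        exact (Submodule.neg_mem_iff _).1 this
      · subst hn
        rw [hP0, hM0]; exact ⟨hK i, hKi i⟩
      · have hz : phiMF q M N true i.1 n = 0 := by unfold phiMF; rw [if_neg (by omega)]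
        refine ⟨fun w hw => ?_, line_zero _ _ (by rw [hz, map_zero])⟩
        have := hd w hw
        rwa [hz, map_zero, sub_zero] at this
    · exact hPhi i hi n
  cases g with
  | Xp i m => exact hg.elim
  | Xm i m => exact hg.elim
  | K i => exact hK i
  | Ki i => exact hKi i
  | K0 he => exact hK0 he
  | K0i he =>
    refine line_inv Λ _ _ ?_ (hK0 he)
    rw [← map_mul, mkA_rel (rel.K0iK0 he), map_one]
  | H i s =>
    obtain ⟨s, hs⟩ := s
    rcases lt_or_gt_of_ne hs with h | h
    · obtain ⟨n, rfl⟩ : ∃ n : ℕ, s = -((n + 1 : ℕ) : ℤ) := ⟨(-s - 1).toNat, by omega⟩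
      have := line_H Λ (-(qpar q M i.1 - (qpar q M i.1)⁻¹)) (neg_ne_zero.2 (qpar_sub_ne hq hq2 _)) (gi (Gen.Ki i)) (gi (Gen.K i))
        (fun s => HF M N true i.1 (-(s : ℤ))) (hKi2 i) (hK i) ?_ n
      · rw [HF_of i _ hs] at this; exact this
      · intro m
        have h3 := (hPP i (-(m : ℤ))).2
        unfold phiMF at h3
        rw [if_pos (by omega), KiF_of, neg_neg, Int.toNat_natCast] at h3
        exact h3
    · obtain ⟨n, rfl⟩ : ∃ n : ℕ, s = ((n + 1 : ℕ) : ℤ) := ⟨(s - 1).toNat, by omega⟩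
      have := line_H Λ (qpar q M i.1 - (qpar q M i.1)⁻¹) (qpar_sub_ne hq hq2 _) (gi (Gen.K i)) (gi (Gen.Ki i))
        (fun s => HF M N true i.1 (s : ℤ)) (hKi1 i) (hKi i) ?_ n
      · rw [HF_of i _ hs] at this; exact this
      · intro m
        have h3 := (hPP i (m : ℤ)).1
        unfold phiPF at h3
        rw [if_pos (by omega), KF_of, Int.toNat_natCast] at h3
        exact h3

abbrev LV (q : ℂ) (M N : ℕ) (Λ : HW q M N) (d : ℕ) : Submodule ℂ (VermaMod q M N true Λ) :=
  Lf (rhoV q M N Λ) (lineV q M N Λ) d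

lemma LV_top (hq : q ≠ 0) (hq2 : q ^ 2 ≠ 1) (hM : 1 ≤ M) (hN : 1 ≤ N) (Λ : HW q M N) :
    (⨆ d, LV q M N Λ d) = ⊤ := by
  rw [eq_top_iff]
  intro w _
  obtain ⟨x, rfl⟩ := vgen_gen Λ w
  obtain ⟨t, rfl⟩ := mkA_surj x
  refine Lf_stable hq (rhoV_rel Λ) (fun g hg w hw => line_C hq hq2 hM hN Λ g hg w hw) ?_ t (vgen q M N Λ) ?_
  · intro i m w hw
    obtain ⟨c, rfl⟩ := Submodule.mem_span_singleton.1 hw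
    rw [map_smul, rhoV_apply, smul_vgen, smul_zero]
    refine Or.inl (Or.inl (Or.inl (Or.inl ⟨i.1, m, ?_⟩)))
    unfold XpA; rw [XpF_of]
  · exact (le_iSup (LV q M N Λ) 0) (Submodule.mem_span_singleton_self _)

end Fin
end QAS
end

noncomputable section
namespace QAS

section Main
variable {q : ℂ} {M N : ℕ}

/-- the units `K_i`. -/
def kuA (q : ℂ) (M N : ℕ) (i : ℕ) : (ALG q M N true 3)ˣ :=
  if h : 1 ≤ i ∧ i ≤ M + N - 1 then
    { val := mkA q M N true 3 (gi (Gen.K ⟨i, h⟩))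
      inv := mkA q M N true 3 (gi (Gen.Ki ⟨i, h⟩))
      val_inv := by rw [← map_mul, mkA_rel (rel.KKi _), map_one]
      inv_val := by rw [← map_mul, mkA_rel (rel.KiK _), map_one] }
  else 1

def kapA (q : ℂ) (M N : ℕ) (t : ℕ → ℤ) : (ALG q M N true 3)ˣ :=
  kapE (kuA q M N) (nexp M N t) (M + N - 1)

lemma kapA_Xm (hq : q ≠ 0) (t : ℕ → ℤ) (j : Idx M N) (n : ℤ) :
    (kapA q M N t : ALG q M N true 3) * mkA q M N true 3 (gi (Gen.Xm j n)) =
      q ^ (-(((M : ℤ) - N) * t j.1)) • (mkA q M N true 3 (gi (Gen.Xm j n)) * (kapA q M N t : ALG q M N true 3)) := by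
  have := kapE_q q hq (kuA q M N) (nexp M N t) (mkA q M N true 3 (gi (Gen.Xm j n))) (fun i => -cc M i j.1)
    (M + N - 1) ?_
  · rw [kapA, this]
    congr 2
    rw [← nexp_sum M N t j, ← Finset.sum_neg_distrib]
    refine Finset.sum_congr rfl fun i _ => by ring
  · intro i hi
    unfold kuA
    rw [dif_pos (by omega)]
    show mkA q M N true 3 _ * _ = _ • (_ * mkA q M N true 3 _)
    rw [← map_mul, mkA_rel (rel.KXm _ _ _), map_smul, map_mul]

lemma kapA_stab {W : Type} [AddCommGroup W] [Module ℂ W] [Module (ALG q M N true 3) W] (t : ℕ → ℤ)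
    (p : Submodule ℂ W)
    (h : ∀ i, ∀ w ∈ p, mkA q M N true 3 (gi (Gen.K i)) • w ∈ p)
    (hi : ∀ i, ∀ w ∈ p, mkA q M N true 3 (gi (Gen.Ki i)) • w ∈ p) :
    ∀ w ∈ p, (kapA q M N t : ALG q M N true 3) • w ∈ p := by
  apply kapE_stab
  · intro i w hw
    unfold kuA
    split_ifs with h1
    · exact h _ _ hw
    · simpa using hw
  · intro i w hw
    unfold kuA
    split_ifs with h1
    · exact hi _ _ hw
    · simpa using hw

lemma zpow_eq_one (hq0 : q ≠ 0) (hq1 : ∀ k : ℕ, k ≠ 0 → q ^ k ≠ 1) (m : ℤ) (h : q ^ m = 1) : m = 0 := by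
  by_contra hm
  apply hq1 m.natAbs (by omega)
  rcases Int.natAbs_eq m with h1 | h1
  · rw [h1, zpow_natCast] at h; exact h
  · rw [h1, zpow_neg, zpow_natCast, inv_eq_one] at h; exact h

lemma inj_eig (hq0 : q ≠ 0) (hq1 : ∀ k : ℕ, k ≠ 0 → q ^ k ≠ 1) (D : ℤ) (hD : D ≠ 0) (C : ℂ) (hC : C ≠ 0) :
    Function.Injective (fun d : ℕ => q ^ (-(D * d)) * C) := by
  intro a b h
  have h1 : q ^ (-(D * a)) = q ^ (-(D * b)) := mul_right_cancel₀ hC h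
  have h2 : q ^ (-(D * a) - -(D * b)) = 1 := by
    rw [zpow_sub₀ hq0, h1, div_self (zpow_ne_zero _ hq0)]
  have h3 := zpow_eq_one hq0 hq1 _ h2
  have h4 : D * ((b : ℤ) - a) = 0 := by linarith
  rcases mul_eq_zero.1 h4 with h5 | h5
  · exact absurd h5 hD
  · omega

lemma kapA_v (hq : q ≠ 0) (hq2 : q ^ 2 ≠ 1) (hM : 1 ≤ M) (hN : 1 ≤ N) (Λ : HW q M N) (t : ℕ → ℤ) :
    ∃ C : ℂ, C ≠ 0 ∧ (kapA q M N t : ALG q M N true 3) • vgen q M N Λ = C • vgen q M N Λ := by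
  have h := kapA_stab t (lineV q M N Λ) (fun i => line_C hq hq2 hM hN Λ (Gen.K i) trivial)
    (fun i => line_C hq hq2 hM hN Λ (Gen.Ki i) trivial) _ (Submodule.mem_span_singleton_self _)
  obtain ⟨C, hC⟩ := Submodule.mem_span_singleton.1 h
  refine ⟨C, ?_, hC.symm⟩
  rintro rfl
  apply vgen_ne hq hq2 hM hN Λ
  rw [zero_smul] at hC
  have h1 : (((kapA q M N t)⁻¹ : (ALG q M N true 3)ˣ) : ALG q M N true 3) • ((kapA q M N t : ALG q M N true 3) • vgen q M N Λ) = vgen q M N Λ := by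
    rw [← mul_smul, Units.inv_mul, one_smul]
  rw [← h1, ← hC, smul_zero]

/-- one step of an eigenvalue computation. -/
lemma eig_step {W : Type} [AddCommGroup W] [Module ℂ W] [Module (ALG q M N true 3) W]
    [IsScalarTower ℂ (ALG q M N true 3) W] (k x : ALG q M N true 3) (a b : ℂ) (w : W)
    (h : k * x = a • (x * k)) (hw : k • w = b • w) : k • (x • w) = (a * b) • (x • w) := by
  rw [← mul_smul, h, smul_assoc, mul_smul, hw, smulC, smul_smul]

lemma LV_height (hq : q ≠ 0) (Λ : HW q M N) (C : ℂ)
    (hC : (kapA q M N (fun _ => 1) : ALG q M N true 3) • vgen q M N Λ = C • vgen q M N Λ) (d : ℕ) :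
    ∀ w ∈ LV q M N Λ d, (kapA q M N (fun _ => 1) : ALG q M N true 3) • w =
      (q ^ (-(((M : ℤ) - N) * d)) * C) • w := by
  induction d with
  | zero =>
    intro w hw
    obtain ⟨c, rfl⟩ := Submodule.mem_span_singleton.1 hw
    rw [smulC, hC, smul_comm]; simp
  | succ d ih =>
    intro w hw
    refine Submodule.span_induction (p := fun w _ => (kapA q M N (fun _ => 1) : ALG q M N true 3) • w =
      (q ^ (-(((M : ℤ) - N) * ((d + 1 : ℕ) : ℤ))) * C) • w) ?_ ?_ ?_ ?_ hw
    · rintro x ⟨j, n, w, hw, rfl⟩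
      rw [rhoV_apply, eig_step _ _ _ _ w (kapA_Xm hq _ j n) (ih w hw), ← mul_assoc, ← zpow_add₀ hq]
      congr 3
      push_cast; ring
    · rw [smul_zero, smul_zero]
    · intro x y _ _ hx hy; rw [smul_add, smul_add, hx, hy]
    · intro c x _ hx; rw [smulC, hx, smul_comm]

/-- the parts of given degree in the first simple root. -/
def EV (q : ℂ) (M N : ℕ) (Λ : HW q M N) (C : ℂ) (d : ℕ) : Submodule ℂ (VermaMod q M N true Λ) where
  carrier := {w | (kapA q M N (fun j => if j = 1 then 1 else 0) : ALG q M N true 3) • w =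
      (q ^ (-(((M : ℤ) - N) * d)) * C) • w ∧
      mkA q M N true 3 (gi (Gen.K0 rfl)) • w = (q ^ (-(d : ℤ))) • w}
  add_mem' := by
    rintro a b ⟨h1, h2⟩ ⟨h3, h4⟩
    exact ⟨by rw [smul_add, smul_add, h1, h3], by rw [smul_add, smul_add, h2, h4]⟩
  zero_mem' := ⟨by rw [smul_zero, smul_zero], by rw [smul_zero, smul_zero]⟩
  smul_mem' := by
    rintro c w ⟨h1, h2⟩
    exact ⟨by rw [smulC, h1, smul_comm], by rw [smulC, h2, smul_comm]⟩

lemma EV_top (hq : q ≠ 0) (hq2 : q ^ 2 ≠ 1) (hM : 1 ≤ M) (hN : 1 ≤ N) (Λ : HW q M N) (C : ℂ)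
    (hC : (kapA q M N (fun j => if j = 1 then 1 else 0) : ALG q M N true 3) • vgen q M N Λ = C • vgen q M N Λ) :
    (⨆ d, EV q M N Λ C d) = ⊤ := by
  rw [eq_top_iff, ← LV_top hq hq2 hM hN Λ]
  apply iSup_le
  intro d
  induction d with
  | zero =>
    refine le_trans ?_ (le_iSup (EV q M N Λ C) 0)
    refine Submodule.span_le.2 ?_
    rintro x hx
    rw [Set.mem_singleton_iff] at hx
    subst hx
    refine ⟨by simpa using hC, ?_⟩
    have := smul_vgen Λ (K0A q M N true 3 - 1) (Or.inr ⟨rfl, rfl⟩)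
    rw [sub_smul, sub_eq_zero, one_smul] at this
    simp only [Nat.cast_zero, neg_zero, zpow_zero, one_smul]
    exact this
  | succ d ih =>
    refine Submodule.span_le.2 ?_
    rintro x ⟨j, n, w, hw, rfl⟩
    have hle : (⨆ d, EV q M N Λ C d) ≤ (⨆ d, EV q M N Λ C d).comap (rhoV q M N Λ (gi (Gen.Xm j n))) := by
      apply iSup_le
      rintro d w ⟨h1, h2⟩
      rw [Submodule.mem_comap]
      by_cases hj : j.1 = 1
      · refine (le_iSup (EV q M N Λ C) (d + 1)) ⟨?_, ?_⟩
        · rw [rhoV_apply, eig_step _ _ _ _ w (kapA_Xm hq _ j n) h1, ← mul_assoc, ← zpow_add₀ hq, if_pos hj]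
          congr 3
          push_cast; ring
        · have hr := mkA_rel (q := q) (rel.K0Xm (q := q) (lvl := 3) rfl j n)
          rw [map_smul, map_mul, map_mul, if_pos hj] at hr
          rw [rhoV_apply, eig_step _ _ _ _ w hr h2, ← zpow_add₀ hq]
          congr 2
          push_cast; ring
      · refine (le_iSup (EV q M N Λ C) d) ⟨?_, ?_⟩
        · rw [rhoV_apply, eig_step _ _ _ _ w (kapA_Xm hq _ j n) h1, if_neg hj, mul_zero, neg_zero, zpow_zero, one_mul]
        · have hr := mkA_rel (q := q) (rel.K0Xm (q := q) (lvl := 3) rfl j n)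
          rw [map_smul, map_mul, map_mul, if_neg hj] at hr
          rw [rhoV_apply, eig_step _ _ _ _ w hr h2, zpow_zero, one_mul]
    exact hle (ih hw)

/-- the operator of an algebra element. -/
def opV (q : ℂ) (M N : ℕ) (Λ : HW q M N) (x : ALG q M N true 3) : Module.End ℂ (VermaMod q M N true Λ) :=
  Algebra.lsmul ℂ ℂ _ x

lemma opV_apply (Λ : HW q M N) (x : ALG q M N true 3) (w : VermaMod q M N true Λ) : opV q M N Λ x w = x • w := rfl

/-- the part of positive height. -/
def LP (q : ℂ) (M N : ℕ) (Λ : HW q M N) : Submodule ℂ (VermaMod q M N true Λ) := ⨆ d, LV q M N Λ (d + 1)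

lemma vgen_not_LP (hq0 : q ≠ 0) (hq1 : ∀ k : ℕ, k ≠ 0 → q ^ k ≠ 1) (hM : 1 ≤ M) (hN : 1 ≤ N) (hMN : M ≠ N)
    (Λ : HW q M N) : vgen q M N Λ ∉ LP q M N Λ := by
  have hq2 := hq1 2 (by norm_num)
  intro hv
  obtain ⟨C, hC0, hC⟩ := kapA_v hq0 hq2 hM hN Λ (fun _ => 1)
  have hinj := inj_eig hq0 hq1 ((M : ℤ) - N) (by omega) C hC0
  unfold LP at hv
  rw [Submodule.mem_iSup_iff_exists_finsupp] at hv
  obtain ⟨f, hf, hs⟩ := hv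
  have hT := LV_height hq0 Λ C hC
  set g : ℕ →₀ VermaMod q M N true Λ := Finsupp.mapDomain (fun d => d + 1) f - Finsupp.single 0 (vgen q M N Λ) with hg
  have hg0 : g 0 = - vgen q M N Λ := by
    rw [hg, Finsupp.sub_apply, Finsupp.single_eq_same, Finsupp.mapDomain_of_notMem_range, zero_sub]
    rintro ⟨y, hy⟩
    simp at hy
  have hgs : ∀ d, g (d + 1) = f d := by
    intro d
    rw [hg, Finsupp.sub_apply, Finsupp.single_eq_of_ne (by omega), sub_zero]
    exact Finsupp.mapDomain_apply (add_left_injective 1) f d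
  have h := interp (opV q M N Λ (kapA q M N (fun _ => 1))) _ hinj ⊥ (by
      intro w hw; rw [Submodule.mem_bot] at hw ⊢; rw [hw, map_zero]) g ?_ ?_ (fun d => if d = 0 then 1 else 0)
  · rw [Submodule.mem_bot] at h
    apply vgen_ne hq0 hq2 hM hN Λ
    have : (g.sum fun d x => (if d = 0 then (1 : ℂ) else 0) • x) = g 0 := by
      rw [Finsupp.sum_of_support_subset g (s := insert 0 g.support) (Finset.subset_insert _ _) _ (by simp)]
      simp
    rw [this, hg0, neg_eq_zero] at h
    exact h
  · intro d
    rcases d with _ | d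
    · rw [hg0, map_neg, opV_apply, hC]; simp
    · rw [hgs, opV_apply]; exact hT (d + 1) _ (hf d)
  · rw [Submodule.mem_bot, hg, Finsupp.sum_sub_index (by simp), Finsupp.sum_single_index rfl,
      Finsupp.sum_mapDomain_index (by simp) (by simp), hs, sub_self]

lemma le_LP (hq0 : q ≠ 0) (hq1 : ∀ k : ℕ, k ≠ 0 → q ^ k ≠ 1) (hM : 1 ≤ M) (hN : 1 ≤ N) (hMN : M ≠ N)
    (Λ : HW q M N) (p : Submodule (ALG q M N true 3) (VermaMod q M N true Λ)) (hp : vgen q M N Λ ∉ p)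
    (w : VermaMod q M N true Λ) (hw : w ∈ p) : w ∈ LP q M N Λ := by
  have hq2 := hq1 2 (by norm_num)
  obtain ⟨C, hC0, hC⟩ := kapA_v hq0 hq2 hM hN Λ (fun _ => 1)
  have hinj := inj_eig hq0 hq1 ((M : ℤ) - N) (by omega) C hC0
  have hT := LV_height hq0 Λ C hC
  have hw' : w ∈ ⨆ d, LV q M N Λ d := by rw [LV_top hq0 hq2 hM hN Λ]; trivial
  rw [Submodule.mem_iSup_iff_exists_finsupp] at hw'
  obtain ⟨f, hf, hs⟩ := hw'
  have h := interp (opV q M N Λ (kapA q M N (fun _ => 1))) _ hinj (p.restrictScalars ℂ)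
    (fun w hw => p.smul_mem _ hw) f (fun d => hT d _ (hf d)) (by rw [hs]; exact hw) (fun d => if d = 0 then 1 else 0)
  have h0 : (f.sum fun d x => (if d = 0 then (1 : ℂ) else 0) • x) = f 0 := by
    rw [Finsupp.sum_of_support_subset f (s := insert 0 f.support) (Finset.subset_insert _ _) _ (by simp)]
    simp
  rw [h0] at h
  obtain ⟨c, hc⟩ := Submodule.mem_span_singleton.1 (hf 0)
  have hc0 : c = 0 := by
    by_contra hne
    apply hp
    rw [← hc] at h
    exact (Submodule.smul_mem_iff (p.restrictScalars ℂ) hne).1 h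
  rw [hc0, zero_smul] at hc
  rw [← hs]
  refine Submodule.sum_mem _ fun d _ => ?_
  rcases d with _ | d
  · rw [← hc]; exact zero_mem _
  · exact (le_iSup (fun d => LV q M N Λ (d + 1)) d) (hf (d + 1))

lemma vgen_not_rad (hq0 : q ≠ 0) (hq1 : ∀ k : ℕ, k ≠ 0 → q ^ k ≠ 1) (hM : 1 ≤ M) (hN : 1 ≤ N) (hMN : M ≠ N)
    (Λ : HW q M N) : vgen q M N Λ ∉ radV q M N Λ := by
  intro h
  apply vgen_not_LP hq0 hq1 hM hN hMN Λ
  unfold radV at h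
  rw [sSup_eq_iSup'] at h
  refine Submodule.iSup_induction _ (motive := fun x => x ∈ LP q M N Λ) h ?_ ?_ ?_
  · rintro ⟨p, hp⟩ x hx
    exact le_LP hq0 hq1 hM hN hMN Λ p hp x hx
  · exact zero_mem _
  · intro x y hx hy; exact add_mem hx hy

/-- a subspace of the Verma module stable under `U` is stable under everything. -/
lemma U_stab (hq0 : q ≠ 0) (hq1 : ∀ k : ℕ, k ≠ 0 → q ^ k ≠ 1) (hM : 1 ≤ M) (hN : 1 ≤ N) (hMN : M ≠ N)
    (Λ : HW q M N) (p : Submodule ℂ (VermaMod q M N true Λ))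
    (hp : ∀ g ∈ UGenSet q M N, ∀ w ∈ p, g • w ∈ p) (t : FA M N true) : ∀ w ∈ p, mkA q M N true 3 t • w ∈ p := by
  have hq2 := hq1 2 (by norm_num)
  have hK : ∀ i, ∀ w ∈ p, mkA q M N true 3 (gi (Gen.K i)) • w ∈ p := by
    intro i; refine hp _ (Or.inr (Or.inr (Or.inl ⟨i.1, ?_⟩))); unfold KA; rw [KF_of]
  have hKi : ∀ i, ∀ w ∈ p, mkA q M N true 3 (gi (Gen.Ki i)) • w ∈ p := by
    intro i; refine hp _ (Or.inr (Or.inr (Or.inr (Or.inl ⟨i.1, ?_⟩)))); unfold KiA; rw [KiF_of]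
  obtain ⟨C, hC0, hC⟩ := kapA_v hq0 hq2 hM hN Λ (fun j => if j = 1 then 1 else 0)
  have hinj := inj_eig hq0 hq1 ((M : ℤ) - N) (by omega) C hC0
  have hkey : ∀ (x : ALG q M N true 3) (k : ℕ → ℂ), (∀ d, ∀ w ∈ EV q M N Λ C d, x • w = k d • w) → ∀ w ∈ p, x • w ∈ p := by
    intro x k hx w hw
    have hw' : w ∈ ⨆ d, EV q M N Λ C d := by rw [EV_top hq0 hq2 hM hN Λ C hC]; trivial
    rw [Submodule.mem_iSup_iff_exists_finsupp] at hw'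
    obtain ⟨f, hf, hs⟩ := hw'
    have h := interp (opV q M N Λ (kapA q M N (fun j => if j = 1 then 1 else 0))) _ hinj p
      (kapA_stab _ p hK hKi) f (fun d => (hf d).1) (by rw [hs]; exact hw) k
    have h2 : x • w = f.sum fun d y => k d • y := by
      rw [← hs]
      unfold Finsupp.sum
      rw [Finset.smul_sum]
      exact Finset.sum_congr rfl fun d _ => hx d _ (hf d)
    rw [h2]; exact h
  have hK0 : ∀ he, ∀ w ∈ p, mkA q M N true 3 (gi (Gen.K0 he)) • w ∈ p := fun he =>
    hkey _ (fun d => q ^ (-(d : ℤ))) fun d w hw => hw.2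
  have hK0i : ∀ he, ∀ w ∈ p, mkA q M N true 3 (gi (Gen.K0i he)) • w ∈ p := by
    intro he
    refine hkey _ (fun d => q ^ (d : ℤ)) fun d w hw => ?_
    have h1 : w = (q ^ (-(d : ℤ))) • (mkA q M N true 3 (gi (Gen.K0i he)) • w) := by
      rw [← smulC, ← hw.2, ← mul_smul, ← map_mul, mkA_rel (rel.K0iK0 he), map_one, one_smul]
    conv_rhs => rw [h1]
    rw [smul_smul, ← zpow_add₀ hq0, add_neg_cancel, zpow_zero, one_smul]
  induction t using FreeAlgebra.induction with
  | grade0 r =>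
    intro w hw
    rw [AlgHom.commutes, algebraMap_smul]
    exact Submodule.smul_mem _ _ hw
  | grade1 g =>
    change ∀ w ∈ p, mkA q M N true 3 (gi g) • w ∈ p
    cases g with
    | Xp i n => refine hp _ (Or.inl ⟨i.1, n, ?_⟩); unfold XpA; rw [XpF_of]
    | Xm i n => refine hp _ (Or.inr (Or.inl ⟨i.1, n, ?_⟩)); unfold XmA; rw [XmF_of]
    | K i => exact hK i
    | Ki i => exact hKi i
    | H i s => refine hp _ (Or.inr (Or.inr (Or.inr (Or.inr ⟨i.1, s.1, ?_⟩)))); unfold HA; rw [HF_of i s.1 s.2]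
    | K0 h => exact hK0 h
    | K0i h => exact hK0i h
  | mul a b ha hb => intro w hw; rw [map_mul, mul_smul]; exact ha _ (hb w hw)
  | add a b ha hb => intro w hw; rw [map_add, add_smul]; exact add_mem (ha w hw) (hb w hw)

end Main
end QAS
end

open QAS in
/-- Lemma 4.7: when `MN > 0` and `M ≠ N`, the unique `U'`-simple quotient
`S'(P̲,f,c)` of the Verma module is simple already as a `U_q(Lsl(M,N))`-module: every
ℂ-subspace stable under the action of all the `U`-generators is `⊥` or `⊤`, and the
module is nonzero. -/
theorem Sprime_simple_over_U (q : ℂ) (hq0 : q ≠ 0)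
    (hq1 : ∀ k : ℕ, k ≠ 0 → q ^ k ≠ 1) (M N : ℕ) (hM : 1 ≤ M) (hN : 1 ≤ N)
    (hMN : M ≠ N) (Λ : HW q M N) :
    (∀ p : Submodule ℂ (SimpMod q M N Λ),
        (∀ g ∈ UGenSet q M N, ∀ w ∈ p, g • w ∈ p) → p = ⊥ ∨ p = ⊤) ∧
      Nontrivial (SimpMod q M N Λ) := by
  have hnr := vgen_not_rad hq0 hq1 hM hN hMN Λ
  set π : VermaMod q M N true Λ →ₗ[ALG q M N true 3] SimpMod q M N Λ := (radV q M N Λ).mkQ with hπ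
  have hsurj : Function.Surjective π := Submodule.mkQ_surjective _
  have hker : ∀ w, π w = 0 ↔ w ∈ radV q M N Λ := fun w => Submodule.Quotient.mk_eq_zero _
  have hπc : ∀ (c : ℂ) w, π (c • w) = c • π w := fun c w => rfl
  refine ⟨fun p hp => ?_, ⟨π (vgen q M N Λ), 0, fun h => hnr ((hker _).1 h)⟩⟩
  let P : Submodule ℂ (VermaMod q M N true Λ) :=
    { carrier := {w | π w ∈ p}
      add_mem' := fun {a b} ha hb => by
        show π (a + b) ∈ p
        rw [map_add]; exact add_mem ha hb
      zero_mem' := by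
        show π 0 ∈ p
        rw [map_zero]; exact zero_mem _
      smul_mem' := fun c w hw => by
        show π (c • w) ∈ p
        rw [hπc]; exact Submodule.smul_mem _ _ hw }
  have hP := U_stab hq0 hq1 hM hN hMN Λ P (fun g hg w hw => by
    show π (g • w) ∈ p
    rw [map_smul]; exact hp g hg _ hw)
  let P' : Submodule (ALG q M N true 3) (VermaMod q M N true Λ) :=
    { carrier := {w | π w ∈ p}
      add_mem' := fun ha hb => P.add_mem ha hb
      zero_mem' := P.zero_mem
      smul_mem' := fun x w hw => by
        obtain ⟨t, rfl⟩ := mkA_surj x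
        exact hP t w hw }
  by_cases hv : vgen q M N Λ ∈ P'
  · right
    rw [eq_top_iff]
    intro y _
    obtain ⟨w, rfl⟩ := hsurj y
    obtain ⟨x, rfl⟩ := vgen_gen Λ w
    exact P'.smul_mem x hv
  · left
    rw [eq_bot_iff]
    intro y hy
    obtain ⟨w, rfl⟩ := hsurj y
    rw [Submodule.mem_bot, hker]
    have : P' ≤ radV q M N Λ := le_sSup hv
    exact this hy
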